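/- Let j ≥ 1, k ≥ 2 and let c_1,…,c_k be nonnegative integers with c_1+…+c_k = j(2^k−1) such that the number of equivalence classes of (c_1,…,c_k)-equiparting matrices is odd. Set d = max(c_1,…,c_k). Then for any masses μ_1,…,μ_j on ℝ^d there exists an arrangement of k affine hyperplanes in ℝ^d that equiparts every μ_i. -/

import Mathlib

/-- The predecessor-endpoint of the `i`-th consecutive pair in a sequence of
length `2 ^ k`. -/
def finLo (k : ℕ) (i : Fin (2 ^ k - 1)) : Fin (2 ^ k) :=
  ⟨i.val, by have h := i.isLt; have h2 : 0 < 2 ^ k := pow_pos (by norm_num) k; omega⟩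

/-- The successor-endpoint of the `i`-th consecutive pair in a sequence of
length `2 ^ k`. -/
def finHi (k : ℕ) (i : Fin (2 ^ k - 1)) : Fin (2 ^ k) :=
  ⟨i.val + 1, by have h := i.isLt; have h2 : 0 < 2 ^ k := pow_pos (by norm_num) k; omega⟩

/-- A `k`-bit Gray code: a sequence of `2 ^ k` vectors in `{0,1}^k` in which every
vector occurs exactly once and consecutive vectors differ in exactly one coordinate. -/
def IsGrayCode (k : ℕ) (g : Fin (2 ^ k) → Fin k → Bool) : Prop :=
  Function.Bijective g ∧
    ∀ i : Fin (2 ^ k - 1), ∃! t : Fin k, g (finLo k i) t ≠ g (finHi k i) t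

/-- `D` is the delta sequence of `g`: for each `i`, `D i` is the unique coordinate in
which the `i`-th and `(i+1)`-st vector differ. -/
def IsDeltaOf (k : ℕ) (g : Fin (2 ^ k) → Fin k → Bool)
    (D : Fin (2 ^ k - 1) → Fin k) : Prop :=
  ∀ (i : Fin (2 ^ k - 1)) (t : Fin k), (g (finLo k i) t ≠ g (finHi k i) t) ↔ t = D i

/-- A `k`-bit delta sequence: the delta sequence of some `k`-bit Gray code. -/
def IsDeltaSequence (k : ℕ) (D : Fin (2 ^ k - 1) → Fin k) : Prop :=
  ∃ g, IsGrayCode k g ∧ IsDeltaOf k g D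

/-- Transition counts of a sequence over `Fin k`: the number of occurrences of each symbol. -/
def transCount {m k : ℕ} (D : Fin m → Fin k) (t : Fin k) : ℕ :=
  (Finset.univ.filter fun i => D i = t).card

/-- Transition counts of a Gray code: the number of consecutive pairs differing in
coordinate `t`. -/
def grayTransCount (k : ℕ) (g : Fin (2 ^ k) → Fin k → Bool) (t : Fin k) : ℕ :=
  (Finset.univ.filter fun i : Fin (2 ^ k - 1) => g (finLo k i) t ≠ g (finHi k i) t).card

/-- The standard (reflected binary) `k`-bit Gray code, whose `i`-th vector is the
binary expansion of `i XOR (i / 2)`; coordinate `0` (row 1) changes most often.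
This agrees with the inductive definition: the front facet (last coordinate `0`) is
traversed by the standard `(k-1)`-bit Gray code, then the back facet in reverse order. -/
def standardGray (k : ℕ) : Fin (2 ^ k) → Fin k → Bool :=
  fun i t => Nat.testBit (i.val ^^^ (i.val / 2)) t.val

/-- A `(c 0, …, c (k-1))`-equiparting matrix: a `j`-tuple of `k`-bit Gray codes where
the last column of each Gray code equals the first column of the next, and the sum of
the transition counts equals `c`. -/
def IsEquipartingMatrix (j k : ℕ) (c : Fin k → ℕ)
    (G : Fin j → Fin (2 ^ k) → Fin k → Bool) : Prop :=
  (∀ i, IsGrayCode k (G i)) ∧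
    (∀ i : Fin j, ∀ h : i.val + 1 < j,
      G i ⟨2 ^ k - 1, by have h2 : 0 < 2 ^ k := pow_pos (by norm_num) k; omega⟩ =
        G ⟨i.val + 1, h⟩ ⟨0, pow_pos (by norm_num) k⟩) ∧
    ∀ t, (∑ i, grayTransCount k (G i) t) = c t

/-- Two equiparting matrices are isomorphic if they lie in one orbit of `(ℤ/2)^k`,
acting by simultaneously flipping all bits in selected rows. -/
def EMIso (j k : ℕ) (G G' : Fin j → Fin (2 ^ k) → Fin k → Bool) : Prop :=
  ∃ β : Fin k → Bool, ∀ i m t, G' i m t = xor (β t) (G i m t)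

/-- Two equiparting matrices are equivalent if they lie in one orbit of
`(ℤ/2)^k ⋊ Stab`, where `Stab` is the stabilizer of `c` in `S_k`, acting by flipping
bits in selected rows and permuting rows. -/
def EMEquiv (j k : ℕ) (c : Fin k → ℕ)
    (G G' : Fin j → Fin (2 ^ k) → Fin k → Bool) : Prop :=
  ∃ (β : Fin k → Bool) (τ : Equiv.Perm (Fin k)),
    (∀ t, c (τ t) = c t) ∧ ∀ i m t, G' i m t = xor (β t) (G i m (τ t))

/-- The number of isomorphism classes of `c`-equiparting matrices. -/
noncomputable def numIsoClasses (j k : ℕ) (c : Fin k → ℕ) : ℕ :=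
  Nat.card (Quot fun G G' : {G // IsEquipartingMatrix j k c G} => EMIso j k G.1 G'.1)

/-- The number of equivalence classes of `c`-equiparting matrices. -/
noncomputable def numEquivClasses (j k : ℕ) (c : Fin k → ℕ) : ℕ :=
  Nat.card (Quot fun G G' : {G // IsEquipartingMatrix j k c G} => EMEquiv j k c G.1 G'.1)

open MeasureTheory

/-- A mass on `ℝ^d`: a finite Borel measure vanishing on every affine hyperplane
(the zero set of an affine map with nonzero linear part). -/
def IsMass {d : ℕ} (μ : Measure (Fin d → ℝ)) : Prop :=
  IsFiniteMeasure μ ∧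
    ∀ f : (Fin d → ℝ) →ᵃ[ℝ] ℝ, f.linear ≠ 0 → μ {x | f x = 0} = 0

/-- The arrangement of `k` affine hyperplanes given by the affine maps `f t`
equiparts `μ`: every open orthant carries measure `μ(ℝ^d) / 2 ^ k`. -/
def Equiparts {d k : ℕ} (f : Fin k → ((Fin d → ℝ) →ᵃ[ℝ] ℝ))
    (μ : Measure (Fin d → ℝ)) : Prop :=
  ∀ ε : Fin k → Bool,
    μ {x | ∀ t, if ε t then 0 < f t x else f t x < 0} = μ Set.univ / 2 ^ k

/-! ### Part 1: parity of zero simplices on `M+2` points -/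

/-- `0` is a convex combination of the family `w`. -/
def ZeroIn {κ E : Type*} [Fintype κ] [AddCommGroup E] [Module ℝ E] (w : κ → E) : Prop :=
  ∃ a : κ → ℝ, (∀ q, 0 ≤ a q) ∧ ∑ q, a q = 1 ∧ ∑ q, a q • w q = 0

/-- `0` is a convex combination of the family `w` not using `o`. -/
def ZeroOmit {κ E : Type*} [Fintype κ] [AddCommGroup E] [Module ℝ E] (w : κ → E) (o : κ) : Prop :=
  ∃ a : κ → ℝ, (∀ q, 0 ≤ a q) ∧ a o = 0 ∧ ∑ q, a q = 1 ∧ ∑ q, a q • w q = 0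

section parity
variable {κ E : Type*} [Fintype κ] [DecidableEq κ] [AddCommGroup E] [Module ℝ E]

/-- genericity -/
def GenFam (M : ℕ) (w : κ → E) : Prop :=
  ∀ a : κ → ℝ, ∑ q, a q • w q = 0 → (Finset.univ.filter fun q => a q ≠ 0).card ≤ M → a = 0

lemma gen_two {M : ℕ} (hκ : Fintype.card κ = M + 2) {w : κ → E} (hg : GenFam M w)
    (a : κ → ℝ) (ha : ∑ q, a q • w q = 0) (o o' : κ) (hne : o ≠ o') (h1 : a o = 0) (h2 : a o' = 0) :
    a = 0 := by
  apply hg a ha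
  have : (Finset.univ.filter fun q => a q ≠ 0) ⊆ (Finset.univ.erase o).erase o' := by
    intro q hq
    simp only [Finset.mem_filter, Finset.mem_univ, true_and] at hq
    simp only [Finset.mem_erase, Finset.mem_univ, and_true]
    constructor
    · rintro rfl; exact hq h2
    · rintro rfl; exact hq h1
  refine (Finset.card_le_card this).trans ?_
  rw [Finset.card_erase_of_mem (by simp [hne.symm]), Finset.card_erase_of_mem (by simp), Finset.card_univ, hκ]
  omega

lemma omit_pos {M : ℕ} (hκ : Fintype.card κ = M + 2) {w : κ → E} (hg : GenFam M w)
    (a : κ → ℝ) (hnn : ∀ q, 0 ≤ a q) (o : κ) (h0 : a o = 0) (h1 : ∑ q, a q = 1)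
    (ha : ∑ q, a q • w q = 0) : ∀ q, q ≠ o → 0 < a q := by
  intro q hq
  rcases (hnn q).lt_or_eq with h | h
  · exact h
  · exfalso
    have := gen_two hκ hg a ha q o hq h.symm h0
    subst this
    simp at h1

lemma zeroOmit_third {M : ℕ} (hκ : Fintype.card κ = M + 2) {w : κ → E} (hg : GenFam M w)
    {o o' o'' : κ} (h : ZeroOmit w o) (h' : ZeroOmit w o') (h'' : ZeroOmit w o'')
    (n1 : o ≠ o') (n2 : o ≠ o'') (n3 : o' ≠ o'') : False := by
  obtain ⟨a, a1, a2, a3, a4⟩ := h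
  obtain ⟨b, b1, b2, b3, b4⟩ := h'
  obtain ⟨e, e1, e2, e3, e4⟩ := h''
  have pa := omit_pos hκ hg a a1 o a2 a3 a4
  have pb := omit_pos hκ hg b b1 o' b2 b3 b4
  have pe := omit_pos hκ hg e e1 o'' e2 e3 e4
  set s := e o' / a o'
  set t := e o / b o
  have hs : 0 < s := div_pos (pe _ n3) (pa _ n1.symm)
  have ht : 0 < t := div_pos (pe _ n2) (pb _ n1)
  have := gen_two hκ hg (fun q => e q - s * a q - t * b q) ?_ o o' n1 ?_ ?_
  · have h := congrFun this o''
    simp only [e2, Pi.zero_apply] at h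
    have := mul_pos hs (pa _ n2.symm)
    have := mul_pos ht (pb _ n3.symm)
    linarith
  · simp only [sub_smul, mul_smul, Finset.sum_sub_distrib, ← Finset.smul_sum, a4, b4, e4]
    simp
  · simp only [a2, t]
    have := (pb _ n1).ne'
    field_simp
    ring
  · simp only [b2, s]
    have := (pa _ n1.symm).ne'
    field_simp
    ring

lemma zeroOmit_second [Module.Finite ℝ E] {M : ℕ} (hκ : Fintype.card κ = M + 2)
    (hE : Module.finrank ℝ E = M) {w : κ → E} (hg : GenFam M w)
    {o : κ} (h : ZeroOmit w o) : ∃ o', o' ≠ o ∧ ZeroOmit w o' := by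
  obtain ⟨a, a1, a2, a3, a4⟩ := h
  have pa := omit_pos hκ hg a a1 o a2 a3 a4
  have hcard : 1 < Fintype.card κ := by omega
  obtain ⟨o1, ho1⟩ : ∃ o1, o1 ≠ o := by
    have := Fintype.one_lt_card_iff_nontrivial.mp hcard
    exact exists_ne o
  let f : (κ → ℝ) →ₗ[ℝ] E × ℝ :=
    LinearMap.prod (∑ q, (LinearMap.toSpanSingleton ℝ E (w q)).comp (LinearMap.proj q)) (LinearMap.proj o1)
  have hker : LinearMap.ker f ≠ ⊥ := by
    apply LinearMap.ker_ne_bot_of_finrank_lt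
    simp [hE, hκ]
  obtain ⟨n, hn, hn0⟩ := (Submodule.ne_bot_iff _).mp hker
  have hf : (∑ q, n q • w q = 0) ∧ n o1 = 0 := by
    have := LinearMap.mem_ker.mp hn
    simpa [f, Prod.ext_iff] using this
  have hno : n o ≠ 0 := fun h0 => hn0 (gen_two hκ hg n hf.1 o o1 ho1.symm h0 hf.2)
  obtain ⟨m, hm, hmo⟩ : ∃ m : κ → ℝ, (∑ q, m q • w q = 0) ∧ m o < 0 := by
    rcases lt_or_gt_of_ne hno with h | h
    · exact ⟨n, hf.1, h⟩
    · refine ⟨fun q => - n q, ?_, by simpa using h⟩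
      simp [neg_smul, hf.1]
  obtain ⟨q0, hq0, hmax⟩ := Finset.exists_max_image (Finset.univ.erase o) (fun q => m q / a q)
    ⟨o1, by simp [ho1]⟩
  have hq0' : q0 ≠ o := by simpa using hq0
  set K := m q0 / a q0
  have hb : ∀ q, 0 ≤ K * a q - m q := by
    intro q
    by_cases hq : q = o
    · subst hq; rw [a2]; linarith
    · have h1 := hmax q (by simp [hq])
      have h2 := pa q hq
      rw [div_le_iff₀ h2] at h1
      linarith
  have hbo : 0 < K * a o - m o := by rw [a2]; linarith
  have hsum : 0 < ∑ q, (K * a q - m q) :=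
    Finset.sum_pos' (fun q _ => hb q) ⟨o, by simp, hbo⟩
  refine ⟨q0, hq0', fun q => (∑ q, (K * a q - m q))⁻¹ * (K * a q - m q), ?_, ?_, ?_, ?_⟩
  · intro q; exact mul_nonneg (inv_nonneg.mpr hsum.le) (hb q)
  · have := (pa q0 hq0').ne'
    have : K * a q0 - m q0 = 0 := by simp only [K]; field_simp; ring
    simp only [this, mul_zero]
  · rw [← Finset.mul_sum]; exact inv_mul_cancel₀ hsum.ne'
  · simp only [mul_smul, ← Finset.smul_sum, sub_smul, Finset.sum_sub_distrib, a4, hm]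
    simp

lemma zeroOmit_card [Module.Finite ℝ E] {M : ℕ} (hκ : Fintype.card κ = M + 2)
    (hE : Module.finrank ℝ E = M) {w : κ → E} (hg : GenFam M w) (h : ∃ o, ZeroOmit w o)
    (s : Finset κ) (hs : ∀ o, o ∈ s ↔ ZeroOmit w o) : s.card = 2 := by
  obtain ⟨o, ho⟩ := h
  obtain ⟨o', hne, ho'⟩ := zeroOmit_second hκ hE hg ho
  have : s = {o, o'} := by
    ext q
    rw [hs]
    simp only [Finset.mem_insert, Finset.mem_singleton]
    constructor
    · intro hq
      by_contra hcon
      push Not at hcon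
      exact zeroOmit_third hκ hg ho ho' hq hne.symm hcon.1.symm hcon.2.symm
    · rintro (rfl | rfl)
      · exact ho
      · exact ho'
  rw [this, Finset.card_pair hne.symm]

end parity

/-! ### Part 2: free actions -/

lemma card_free {G X : Type*} [Group G] [Finite G] [MulAction G X] [Finite X]
    (hf : ∀ (g : G) (x : X), g • x = x → g = 1) :
    Nat.card X = Nat.card (Quotient (MulAction.orbitRel G X)) * Nat.card G := by
  rw [← Nat.card_prod]
  apply Nat.card_congr
  apply MulAction.selfEquivOrbitsQuotientProd
  intro x
  rw [eq_bot_iff]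
  intro g hg
  exact hf g x hg

lemma even_card_of_involution {X : Type*} [Finite X] (i : X → X) (h1 : ∀ x, i (i x) = x)
    (h2 : ∀ x, i x ≠ x) : 2 ∣ Nat.card X := by
  have := Fintype.ofFinite X
  classical
  rw [Nat.card_eq_fintype_card]
  have : ∑ x : X, (1 : ZMod 2) = 0 :=
    Finset.sum_involution (fun x _ => i x) (fun x _ => by decide) (fun x _ _ => h2 x)
      (fun x _ => Finset.mem_univ _) (fun x _ => h1 x)
  simp at this
  exact (ZMod.natCast_eq_zero_iff _ _).mp this

lemma card_free_set {G X : Type*} [Group G] [Finite G] [MulAction G X] (T : Set X) (hT : T.Finite)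
    (hinv : ∀ (g : G) x, x ∈ T → g • x ∈ T)
    (hf : ∀ (g : G) (x : X), x ∈ T → g • x = x → g = 1) :
    Nat.card G ∣ T.ncard := by
  let S : SubMulAction G X := ⟨T, fun g {x} hx => hinv g x hx⟩
  have : Finite S := hT
  have := card_free (G := G) (X := S) (fun g x h => hf g x.1 x.2 (congrArg Subtype.val h))
  have h2 : T.ncard = Nat.card S := rfl
  rw [h2, this]
  exact Dvd.intro_left _ rfl

lemma card_free_set_two {G X : Type*} [Group G] [Finite G] [MulAction G X] (T : Set X) (hT : T.Finite)
    (hinv : ∀ (g : G) x, x ∈ T → g • x ∈ T)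
    (hf : ∀ (g : G) (x : X), x ∈ T → g • x = x → g = 1)
    (i : X → X) (hi : ∀ x ∈ T, i x ∈ T) (hii : ∀ x ∈ T, i (i x) = x)
    (hig : ∀ (g : G), ∀ x ∈ T, i (g • x) = g • i x) (hne : ∀ (g : G), ∀ x ∈ T, i x ≠ g • x) :
    2 * Nat.card G ∣ T.ncard := by
  let S : SubMulAction G X := ⟨T, fun g {x} hx => hinv g x hx⟩
  have : Finite S := hT
  have := card_free (G := G) (X := S) (fun g x h => hf g x.1 x.2 (congrArg Subtype.val h))
  have h2 : T.ncard = Nat.card S := rfl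
  rw [h2, this]
  apply Nat.mul_dvd_mul_right
  let iS : S → S := fun x => ⟨i x.1, hi x.1 x.2⟩
  have hrel : ∀ x y : S, (MulAction.orbitRel G S) x y → (MulAction.orbitRel G S) (iS x) (iS y) := by
    rintro x y ⟨g, rfl⟩
    refine ⟨g, ?_⟩
    apply Subtype.ext
    exact (hig g y.1 y.2).symm
  have : Finite (Quotient (MulAction.orbitRel G S)) := Quotient.finite _
  apply even_card_of_involution (Quotient.map' iS hrel)
  · intro q
    induction q using Quotient.inductionOn' with
    | h x =>
      simp only [Quotient.map'_mk'']
      congr 1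
      exact Subtype.ext (hii x.1 x.2)
  · intro q
    induction q using Quotient.inductionOn' with
    | h x =>
      simp only [Quotient.map'_mk'']
      intro h
      obtain ⟨g, hg⟩ := Quotient.eq''.mp h
      exact hne g x.1 x.2 (congrArg Subtype.val hg).symm

/-! ### Part 3: abstract parity theorem -/

/-- A system of maximal chains with flips. -/
structure ChainSys (G V : Type*) [Group G] [MulAction G V] (M : ℕ) where
  ch : Set (Fin (M + 1) → V)
  rk : V → ℕ
  rk_smul : ∀ (g : G) v, rk (g • v) = rk v
  rk_ch : ∀ C ∈ ch, ∀ l, rk (C l) = l.val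
  inv : ∀ (g : G), ∀ C ∈ ch, g • C ∈ ch
  alt : Fin (M + 1) → (Fin (M + 1) → V) → (Fin (M + 1) → V)
  alt_mem : ∀ l, ∀ C ∈ ch, alt l C ∈ ch
  alt_off : ∀ l, ∀ C ∈ ch, ∀ m, m ≠ l → alt l C m = C m
  alt_ne : ∀ l, ∀ C ∈ ch, alt l C ≠ C
  alt_inv : ∀ l, ∀ C ∈ ch, alt l (alt l C) = C
  alt_smul : ∀ l (g : G), ∀ C ∈ ch, alt l (g • C) = g • alt l C

/-- the `M+2` points at stage `r` -/
def zpt {V E : Type*} {M : ℕ} (W : Bool → V → E) (r : Fin (M + 1)) (C : Fin (M + 1) → V) :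
    Option (Fin (M + 1)) → E
  | none => W true (C r)
  | some l => if l.val < r.val then W true (C l) else W false (C l)

/-- the mixed values -/
def mixv {V E : Type*} {M : ℕ} (W : Bool → V → E) (n : ℕ) (C : Fin (M + 1) → V) :
    Fin (M + 1) → E :=
  fun l => if l.val < n then W true (C l) else W false (C l)

lemma zeroOmit_none {V E : Type*} [AddCommGroup E] [Module ℝ E] {M : ℕ} (W : Bool → V → E)
    (r : Fin (M + 1)) (C : Fin (M + 1) → V) :
    ZeroOmit (zpt W r C) none ↔ ZeroIn (mixv W r.val C) := by
  constructor
  · rintro ⟨a, h1, h2, h3, h4⟩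
    refine ⟨fun l => a (some l), fun l => h1 _, ?_, ?_⟩
    · rw [Fintype.sum_option, h2] at h3; simpa using h3
    · rw [Fintype.sum_option, h2] at h4; simpa [zpt, mixv] using h4
  · rintro ⟨a, h1, h3, h4⟩
    refine ⟨fun o => o.elim 0 a, ?_, rfl, ?_, ?_⟩
    · rintro (_ | l)
      · simp
      · exact h1 l
    · rw [Fintype.sum_option]; simpa using h3
    · rw [Fintype.sum_option]; simpa [zpt, mixv] using h4

lemma zeroOmit_some {V E : Type*} [AddCommGroup E] [Module ℝ E] {M : ℕ} (W : Bool → V → E)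
    (r : Fin (M + 1)) (C : Fin (M + 1) → V) :
    ZeroOmit (zpt W r C) (some r) ↔ ZeroIn (mixv W (r.val + 1) C) := by
  have key : ∀ l, l ≠ r → zpt W r C (some l) = mixv W (r.val + 1) C l := by
    intro l hl
    have : l.val ≠ r.val := fun h => hl (Fin.ext h)
    have : (l.val < r.val) ↔ (l.val < r.val + 1) := by omega
    simp [zpt, mixv, this]
  have keyr : mixv W (r.val + 1) C r = W true (C r) := by simp [mixv]
  constructor
  · rintro ⟨a, h1, h2, h3, h4⟩
    refine ⟨fun l => if l = r then a none else a (some l), fun l => ?_, ?_, ?_⟩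
    · dsimp only; split_ifs <;> exact h1 _
    · rw [Fintype.sum_option, ← Finset.add_sum_erase _ _ (Finset.mem_univ r), h2] at h3
      rw [← Finset.add_sum_erase _ _ (Finset.mem_univ r), ← h3, if_pos rfl, zero_add]
      congr 1
      exact Finset.sum_congr rfl fun l hl => by rw [if_neg (Finset.ne_of_mem_erase hl)]
    · rw [Fintype.sum_option, ← Finset.add_sum_erase _ _ (Finset.mem_univ r), h2, zero_smul, zero_add] at h4
      rw [← Finset.add_sum_erase _ _ (Finset.mem_univ r), ← h4, keyr]
      simp only [if_true]
      congr 1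
      exact Finset.sum_congr rfl fun l hl => by
        rw [if_neg (Finset.ne_of_mem_erase hl), key l (Finset.ne_of_mem_erase hl)]
  · rintro ⟨a, h1, h3, h4⟩
    refine ⟨fun o => o.elim (a r) (fun l => if l = r then 0 else a l), ?_, by simp, ?_, ?_⟩
    · rintro (_ | l)
      · exact h1 r
      · simp only [Option.elim_some]; split_ifs
        · exact le_rfl
        · exact h1 l
    · rw [Fintype.sum_option, ← Finset.add_sum_erase _ _ (Finset.mem_univ r)]
      rw [← Finset.add_sum_erase _ _ (Finset.mem_univ r)] at h3
      simp only [Option.elim_none, Option.elim_some, if_true, zero_add]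
      rw [← h3]
      congr 1
      exact Finset.sum_congr rfl fun l hl => by rw [if_neg (Finset.ne_of_mem_erase hl)]
    · rw [Fintype.sum_option, ← Finset.add_sum_erase _ _ (Finset.mem_univ r)]
      rw [← Finset.add_sum_erase _ _ (Finset.mem_univ r)] at h4
      simp only [Option.elim_none, Option.elim_some, if_true, zero_smul, zero_add]
      rw [← h4, keyr]
      congr 1
      exact Finset.sum_congr rfl fun l hl => by
        rw [if_neg (Finset.ne_of_mem_erase hl), key l (Finset.ne_of_mem_erase hl)]

section abstract
variable {G V E : Type*} [Group G] [Finite G] [MulAction G V] [AddCommGroup E] [Module ℝ E]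
  [Module.Finite ℝ E] [DistribMulAction G E] [SMulCommClass G ℝ E]

lemma not_zeroIn_of_pos {κ E : Type*} [Fintype κ] [AddCommGroup E] [Module ℝ E] {w : κ → E}
    (f : E →ₗ[ℝ] ℝ) (h : ∀ q, 0 < f (w q)) : ¬ ZeroIn w := by
  rintro ⟨a, h1, h2, h3⟩
  have h4 := congrArg f h3
  simp only [map_sum, map_smul, map_zero, smul_eq_mul] at h4
  have h5 : ∀ q, a q = 0 := by
    intro q
    have := (Finset.sum_eq_zero_iff_of_nonneg (fun q _ => mul_nonneg (h1 q) (h q).le)).mp h4 q (Finset.mem_univ _)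
    rcases mul_eq_zero.mp this with h | h'
    · exact h
    · exact absurd h' (h q).ne'
  simp [h5] at h2

lemma zeroOmit.zeroIn {κ E : Type*} [Fintype κ] [AddCommGroup E] [Module ℝ E] {w : κ → E} {o : κ}
    (h : ZeroOmit w o) : ZeroIn w := by
  obtain ⟨a, h1, h2, h3, h4⟩ := h
  exact ⟨a, h1, h3, h4⟩

lemma zeroOmit.smul {κ : Type*} [Fintype κ] {w : κ → E} {o : κ}
    (h : ZeroOmit w o) (g : G) : ZeroOmit (fun q => g • w q) o := by
  obtain ⟨a, h1, h2, h3, h4⟩ := h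
  refine ⟨a, h1, h2, h3, ?_⟩
  have := congrArg (fun e => g • e) h4
  simp only [Finset.smul_sum, smul_zero] at this
  rw [← this]
  exact Finset.sum_congr rfl fun q _ => (smul_comm _ _ _).symm

theorem parity_count {M : ℕ} (hM : 1 ≤ M) (hE : Module.finrank ℝ E = M) (S : ChainSys G V M)
    (W : Bool → V → E) (A : Set V) (hA : A.Finite) (Ainv : ∀ (g : G), ∀ v ∈ A, g • v ∈ A)
    (Afree : ∀ (g : G), ∀ v ∈ A, g • v = v → g = 1)
    (Weq : ∀ b, ∀ v ∈ A, ∀ g : G, W b (g • v) = g • W b v)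
    (gen : ∀ C ∈ S.ch, (∀ l, C l ∈ A) → ∀ r, GenFam M (zpt W r C))
    (h1 : ∀ C ∈ S.ch, (∃ l, C l ∉ A) → ∃ f : E →ₗ[ℝ] ℝ, ∀ b l, 0 < f (W b (C l)))
    (h2 : ∀ C ∈ S.ch, ¬ ZeroIn (fun l => W true (C l))) :
    2 * Nat.card G ∣ {C | C ∈ S.ch ∧ ZeroIn (fun l => W false (C l))}.ncard := by
  classical
  set P : Set (Fin (M + 1) → V) := {C | C ∈ S.ch ∧ ∀ l, C l ∈ A} with hP
  have hPfin : P.Finite := by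
    apply Set.Finite.subset (Set.Finite.pi' (fun _ : Fin (M + 1) => hA))
    intro C hC l
    exact hC.2 l
  -- everything zero lies in P
  have hin : ∀ C ∈ S.ch, ∀ r, ZeroIn (zpt W r C) → C ∈ P := by
    intro C hC r hz
    refine ⟨hC, ?_⟩
    by_contra hcon
    push Not at hcon
    obtain ⟨f, hf⟩ := h1 C hC hcon
    refine not_zeroIn_of_pos f ?_ hz
    rintro (_ | l)
    · exact hf _ _
    · simp only [zpt]; split_ifs <;> exact hf _ _
  have zsm : ∀ C ∈ P, ∀ (g : G) r, zpt W r (g • C) = fun o => g • zpt W r C o := by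
    intro C hC g r
    funext o
    rcases o with _ | l
    · exact Weq _ _ (hC.2 r) g
    · simp only [zpt, Pi.smul_apply]
      rw [Weq _ _ (hC.2 l) g, Weq _ _ (hC.2 l) g]
      split_ifs <;> rfl
  have Pinv : ∀ (g : G), ∀ C ∈ P, g • C ∈ P := fun g C hC =>
    ⟨S.inv g C hC.1, fun l => Ainv g _ (hC.2 l)⟩
  have Pfree : ∀ (g : G), ∀ C ∈ P, ∀ l, g • C l = C l → g = 1 := fun g C hC l h =>
    Afree g _ (hC.2 l) h
  let D : Fin (M + 1) → Option (Fin (M + 1)) → Set (Fin (M + 1) → V) := fun r o =>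
    {C | C ∈ P ∧ ZeroOmit (zpt W r C) o}
  have Dfin : ∀ r o, (D r o).Finite := fun r o => hPfin.subset fun C hC => hC.1
  have Dinv : ∀ r o (g : G) C, C ∈ D r o → g • C ∈ D r o := by
    intro r o g C hC
    refine ⟨Pinv g C hC.1, ?_⟩
    rw [zsm C hC.1]
    exact zeroOmit.smul hC.2 g
  -- D for l ≠ r
  have Dl : ∀ r l, l ≠ r → 2 * Nat.card G ∣ (D r (some l)).ncard := by
    intro r l hlr
    have hz : ∀ C ∈ S.ch, ZeroOmit (zpt W r C) (some l) → ZeroOmit (zpt W r (S.alt l C)) (some l) := by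
      rintro C hC ⟨a, a1, a2, a3, a4⟩
      refine ⟨a, a1, a2, a3, ?_⟩
      rw [← a4]
      apply Finset.sum_congr rfl
      rintro (_ | m) _
      · simp only [zpt]; rw [S.alt_off l C hC r hlr.symm]
      · by_cases hm : m = l
        · subst hm; rw [a2, zero_smul, zero_smul]
        · simp only [zpt]; rw [S.alt_off l C hC m hm]
    apply card_free_set_two (G := G) (D r (some l)) (Dfin r _) (Dinv r _) ?_ (S.alt l)
    · intro C hC
      have h := hz C hC.1.1 hC.2
      exact ⟨hin _ (S.alt_mem l C hC.1.1) r (zeroOmit.zeroIn h), h⟩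
    · intro C hC; exact S.alt_inv l C hC.1.1
    · intro g C hC; exact S.alt_smul l g C hC.1.1
    · intro g C hC h
      have h0 : g = 1 := by
        apply Pfree g C hC.1 r
        have := congrFun h r
        rw [S.alt_off l C hC.1.1 r hlr.symm] at this
        exact this.symm
      rw [h0, one_smul] at h
      exact S.alt_ne l C hC.1.1 h
    · intro g C hC h
      exact Pfree g C hC.1 0 (congrFun h 0)
  -- the total count
  have Dtot : ∀ r, 2 * Nat.card G ∣ ∑ o, (D r o).ncard := by
    intro r
    let U : Set (Fin (M + 1) → V) := {C | C ∈ P ∧ ∃ o, ZeroOmit (zpt W r C) o}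
    have Ufin : U.Finite := hPfin.subset fun C hC => hC.1
    have hU : Nat.card G ∣ U.ncard := by
      apply card_free_set U Ufin
      · rintro g C ⟨hC, o, ho⟩
        have := Dinv r o g C ⟨hC, ho⟩
        exact ⟨this.1, o, this.2⟩
      · intro g C hC h
        exact Pfree g C hC.1 0 (congrFun h 0)
    have : ∑ o, (D r o).ncard = 2 * U.ncard := by
      have e1 : ∀ o, (D r o).ncard =
          ∑ C ∈ Ufin.toFinset, if ZeroOmit (zpt W r C) o then 1 else 0 := by
        intro o
        rw [← Finset.card_filter, ← Set.ncard_coe_finset]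
        congr 1
        ext C
        simp only [D, U, Set.mem_ofPred_eq, Finset.coe_filter, Set.Finite.mem_toFinset]
        constructor
        · rintro ⟨h, h'⟩; exact ⟨⟨h, o, h'⟩, h'⟩
        · rintro ⟨⟨h, _⟩, h'⟩; exact ⟨h, h'⟩
      simp only [e1]
      rw [Finset.sum_comm]
      have e2 : ∀ C ∈ Ufin.toFinset,
          (∑ o, if ZeroOmit (zpt W r C) o then 1 else 0) = 2 := by
        intro C hC
        rw [Set.Finite.mem_toFinset] at hC
        rw [← Finset.card_filter]
        exact zeroOmit_card (M := M) (by simp) hE (gen C hC.1.1 hC.1.2 r) hC.2 _ (by simp)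
      rw [Finset.sum_congr rfl e2, Finset.sum_const, Set.ncard_eq_toFinset_card _ Ufin]
      simp [mul_comm]
    rw [this]
    exact Nat.mul_dvd_mul_left 2 hU
  let T : ℕ → Set (Fin (M + 1) → V) := fun n => {C | C ∈ S.ch ∧ ZeroIn (mixv W n C)}
  have T1 : ∀ r : Fin (M + 1), D r none = T r.val := by
    intro r
    ext C
    simp only [D, T, Set.mem_ofPred_eq, ← zeroOmit_none]
    exact ⟨fun h => ⟨h.1.1, h.2⟩, fun h => ⟨hin C h.1 r (zeroOmit.zeroIn h.2), h.2⟩⟩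
  have T2 : ∀ r : Fin (M + 1), D r (some r) = T (r.val + 1) := by
    intro r
    ext C
    simp only [D, T, Set.mem_ofPred_eq, ← zeroOmit_some]
    exact ⟨fun h => ⟨h.1.1, h.2⟩, fun h => ⟨hin C h.1 r (zeroOmit.zeroIn h.2), h.2⟩⟩
  have step : ∀ r : Fin (M + 1), 2 * Nat.card G ∣ (T (r.val + 1)).ncard → 2 * Nat.card G ∣ (T r.val).ncard := by
    intro r h
    have h3 := Dtot r
    rw [Fintype.sum_option, ← Finset.add_sum_erase _ _ (Finset.mem_univ r), T1, T2] at h3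
    have h4 : 2 * Nat.card G ∣ ∑ l ∈ Finset.univ.erase r, (D r (some l)).ncard :=
      Finset.dvd_sum fun l hl => Dl r l (Finset.ne_of_mem_erase hl)
    exact (Nat.dvd_add_left (dvd_add h h4)).mp h3
  have all : ∀ i : ℕ, i ≤ M + 1 → 2 * Nat.card G ∣ (T (M + 1 - i)).ncard := by
    intro i
    induction i with
    | zero =>
      intro _
      have : T (M + 1) = ∅ := by
        ext C
        simp only [T, Set.mem_ofPred_eq, Set.mem_empty_iff_false, iff_false, not_and]
        intro hC
        have : mixv W (M + 1) C = fun l => W true (C l) := by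
          funext l; have := l.isLt; simp only [mixv, this, if_true]
        rw [this]; exact h2 C hC
      simp [this]
    | succ i ih =>
      intro hi
      have := step ⟨M + 1 - (i + 1), by omega⟩
      simp only at this
      rw [show M + 1 - (i + 1) + 1 = M + 1 - i by omega] at this
      exact this (ih (by omega))
  have := all (M + 1) le_rfl
  rw [Nat.sub_self] at this
  have e : T 0 = {C | C ∈ S.ch ∧ ZeroIn (fun l => W false (C l))} := by
    ext C
    have : mixv W 0 C = fun l => W false (C l) := by funext l; simp [mixv]
    simp [T, this]
  rwa [e] at this

end abstract

/-! ### Part 4: general position -/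

section gp
variable {G E : Type*} [Group G] [Finite G] [NormedAddCommGroup E] [NormedSpace ℝ E]
  [FiniteDimensional ℝ E] [DistribMulAction G E] [SMulCommClass G ℝ E]

lemma exists_avoid {I : Type*} [Finite I] (U : I → Submodule ℝ E) (hU : ∀ i, U i ≠ ⊤) (y : E) {ε : ℝ}
    (hε : 0 < ε) : ∃ z, ‖z - y‖ < ε ∧ ∀ i, z ∉ U i := by
  have hd : Dense (⋂ i, ((U i : Set E)ᶜ)) := by
    apply dense_iInter_of_isOpen
    · intro i
      exact (Submodule.closed_of_finiteDimensional (U i)).isOpen_compl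
    · intro i
      rw [← interior_eq_empty_iff_dense_compl]
      by_contra h
      exact hU i (Submodule.eq_top_of_nonempty_interior' _ (Set.nonempty_iff_ne_empty.mpr h))
  obtain ⟨z, hz, hz'⟩ := Metric.dense_iff.mp hd y ε hε
  refine ⟨z, by simpa [dist_eq_norm] using hz, ?_⟩
  intro i
  exact Set.mem_iInter.mp hz' i

/-- the linear map given by a group element -/
def gLin (g : G) : E →ₗ[ℝ] E where
  toFun e := g • e
  map_add' := smul_add g
  map_smul' r e := smul_comm g r e

lemma gLin_surj (g : G) : Function.Surjective (gLin (E := E) g) := fun e =>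
  ⟨g⁻¹ • e, by simp [gLin]⟩

lemma exists_gp {Q : Type*} [Finite Q] [DecidableEq Q] (y0 : Q → E) {ε : ℝ} (hε : 0 < ε) :
    ∃ y : Q → E, (∀ q, ‖y q - y0 q‖ < ε) ∧ ∀ (s : Finset Q) (g : Q → G) (a : Q → ℝ),
      s.card ≤ Module.finrank ℝ E → ∑ q ∈ s, a q • (g q • y q) = 0 → ∀ q ∈ s, a q = 0 := by
  have := Fintype.ofFinite Q
  suffices H : ∀ u : Finset Q, ∃ y : Q → E, (∀ q, ‖y q - y0 q‖ < ε) ∧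
      ∀ (s : Finset Q) (g : Q → G) (a : Q → ℝ), s ⊆ u →
      s.card ≤ Module.finrank ℝ E → ∑ q ∈ s, a q • (g q • y q) = 0 → ∀ q ∈ s, a q = 0 by
    obtain ⟨y, hy, hy'⟩ := H Finset.univ
    exact ⟨y, hy, fun s g a => hy' s g a (Finset.subset_univ s)⟩
  intro u
  induction u using Finset.induction_on with
  | empty =>
    refine ⟨y0, fun _ => by simpa using hε, ?_⟩
    intro s g a hs _ _ q hq
    exact absurd (hs hq) (by simp)
  | insert q0 u hq0 ih =>
    obtain ⟨y, hy, hy'⟩ := ih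
    let I := {p : Finset Q × (Q → G) × G // p.1.card < Module.finrank ℝ E}
    let U : I → Submodule ℝ E := fun p =>
      (Submodule.span ℝ ((fun q => p.1.2.1 q • y q) '' (p.1.1 : Set Q))).comap (gLin p.1.2.2)
    have hU : ∀ i, U i ≠ ⊤ := by
      rintro ⟨⟨s, g, h⟩, hs⟩ htop
      have h1 : Submodule.span ℝ ((fun q => g q • y q) '' (s : Set Q)) = ⊤ := by
        rw [eq_top_iff]
        intro e _
        obtain ⟨e', rfl⟩ := gLin_surj h e
        have : e' ∈ U ⟨⟨s, g, h⟩, hs⟩ := by rw [htop]; trivial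
        exact this
      have h2 : Module.finrank ℝ E ≤ s.card := by
        rw [← finrank_top ℝ E, ← h1]
        classical
        have h3 := finrank_span_finset_le_card (R := ℝ) (s.image (fun q => g q • y q))
        rw [Set.finrank, Finset.coe_image] at h3
        exact h3.trans Finset.card_image_le
      simp only at hs
      omega
    obtain ⟨z, hz, hz'⟩ := exists_avoid U hU (y0 q0) hε
    refine ⟨Function.update y q0 z, ?_, ?_⟩
    · intro q
      by_cases h : q = q0
      · subst h; simpa using hz
      · simpa [Function.update_of_ne h] using hy q
    · intro s g a hs hcard hsum
      have hupd : ∀ q ∈ s.erase q0, Function.update y q0 z q = y q := fun q hq =>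
        Function.update_of_ne (Finset.ne_of_mem_erase hq) _ _
      have hsub : s.erase q0 ⊆ u := by
        intro q hq
        have := hs (Finset.mem_of_mem_erase hq)
        rcases Finset.mem_insert.mp this with h | h
        · exact absurd h (Finset.ne_of_mem_erase hq)
        · exact h
      by_cases hm : q0 ∈ s
      · rw [← Finset.add_sum_erase _ _ hm, Function.update_self,
          Finset.sum_congr rfl (fun q hq => by rw [hupd q hq])] at hsum
        have ha : a q0 = 0 := by
          by_contra ha
          have hc : (s.erase q0).card < Module.finrank ℝ E := by
            rw [Finset.card_erase_of_mem hm]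
            have := Finset.card_pos.mpr ⟨q0, hm⟩
            omega
          apply hz' ⟨⟨s.erase q0, g, g q0⟩, hc⟩
          change g q0 • z ∈ Submodule.span ℝ ((fun q => g q • y q) '' ((s.erase q0 : Finset Q) : Set Q))
          have : g q0 • z = -(a q0)⁻¹ • ∑ q ∈ s.erase q0, a q • (g q • y q) := by
            have h5 := eq_neg_of_add_eq_zero_right hsum
            rw [h5, smul_neg, neg_smul, neg_neg, smul_smul, inv_mul_cancel₀ ha, one_smul]
          rw [this]
          apply Submodule.smul_mem
          apply Submodule.sum_mem
          intro q hq
          apply Submodule.smul_mem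
          exact Submodule.subset_span ⟨q, hq, rfl⟩
        rw [ha, zero_smul, zero_add] at hsum
        intro q hq
        by_cases h : q = q0
        · rw [h, ha]
        · exact hy' (s.erase q0) g a hsub ((Finset.card_erase_le).trans hcard) hsum q
            (Finset.mem_erase.mpr ⟨h, hq⟩)
      · have he : s.erase q0 = s := Finset.erase_eq_of_notMem hm
        rw [he] at hupd hsub
        rw [Finset.sum_congr rfl (fun q hq => by rw [hupd q hq])] at hsum
        exact hy' s g a hsub hcard hsum

end gp

section pert
variable {G V E : Type*} [Group G] [Finite G] [MulAction G V] [NormedAddCommGroup E]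
  [NormedSpace ℝ E] [FiniteDimensional ℝ E] [DistribMulAction G E] [SMulCommClass G ℝ E]

theorem parity_count' {M : ℕ} (hM : 1 ≤ M) (hE : Module.finrank ℝ E = M) (S : ChainSys G V M)
    (hiso : ∀ (g : G) (e : E), ‖g • e‖ = ‖e‖)
    (w : Bool → V → E) (A : Set V) (hA : A.Finite) (Ainv : ∀ (g : G), ∀ v ∈ A, g • v ∈ A)
    (Afree : ∀ (g : G), ∀ v ∈ A, g • v = v → g = 1)
    (weq : ∀ b, ∀ v ∈ A, ∀ g : G, w b (g • v) = g • w b v)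
    (ε : ℝ) (hε : 0 < ε)
    (h1 : ∀ C ∈ S.ch, (∃ l, C l ∉ A) → ∃ f : E →ₗ[ℝ] ℝ, (∀ e, |f e| ≤ ‖e‖) ∧
      ∀ b l, ε ≤ f (w b (C l)))
    (h2 : ∀ C ∈ S.ch, (∀ l, C l ∈ A) → ∀ w' : Fin (M + 1) → E,
      (∀ l, ‖w' l - w true (C l)‖ < ε) → ¬ ZeroIn w')
    (T : Set (Fin (M + 1) → V)) (hT : ∀ C ∈ T, C ∈ S.ch ∧ ∀ l, C l ∈ A)
    (h3 : ∀ C ∈ S.ch, (∀ l, C l ∈ A) → ∀ w' : Fin (M + 1) → E,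
      (∀ l, ‖w' l - w false (C l)‖ < ε) → (ZeroIn w' ↔ C ∈ T)) :
    2 * Nat.card G ∣ T.ncard := by
  classical
  let rep : V → V := fun v => (Quotient.mk (MulAction.orbitRel G V) v).out
  have hrep : ∀ v, ∃ g : G, g • rep v = v := by
    intro v
    have : (MulAction.orbitRel G V) (rep v) v := Quotient.exact (Quotient.out_eq _)
    have := (MulAction.orbitRel G V).symm this
    exact this
  choose γ hγ using hrep
  have rep_smul : ∀ (g : G) v, rep (g • v) = rep v := by
    intro g v
    simp only [rep]
    congr 1
    exact Quotient.sound ⟨g, rfl⟩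
  have rep_mem : ∀ v ∈ A, rep v ∈ A := by
    intro v hv
    have : rep v = (γ v)⁻¹ • v := eq_inv_smul_iff.mpr (hγ v)
    rw [this]; exact Ainv _ v hv
  have γ_smul : ∀ (g : G), ∀ v ∈ A, γ (g • v) = g * γ v := by
    intro g v hv
    have h := hγ (g • v)
    rw [rep_smul] at h
    have h' : ((g * γ v)⁻¹ * γ (g • v)) • rep v = rep v := by
      rw [mul_smul, h, inv_smul_eq_iff, mul_smul, hγ v]
    have := Afree _ _ (rep_mem v hv) h'
    exact (inv_mul_eq_one.mp this).symm
  have rk_rep : ∀ v, S.rk (rep v) = S.rk v := by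
    intro v
    conv_rhs => rw [← hγ v, S.rk_smul]
  have : Finite A := hA
  obtain ⟨y, hy, hy'⟩ := exists_gp (G := G) (Q := A × Bool) (fun q => w q.2 q.1.1) hε
  let W : Bool → V → E := fun b v =>
    if h : v ∈ A then γ v • y (⟨rep v, rep_mem v h⟩, b) else w b v
  have Wout : ∀ b v, v ∉ A → W b v = w b v := fun b v h => by simp [W, h]
  have Win : ∀ b v (h : v ∈ A), W b v = γ v • y (⟨rep v, rep_mem v h⟩, b) := fun b v h => by
    simp [W, h]
  have Wclose : ∀ b v, ‖W b v - w b v‖ < ε := by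
    intro b v
    by_cases h : v ∈ A
    · have e : w b v = γ v • w b (rep v) := by
        rw [← weq b _ (rep_mem v h), hγ v]
      rw [Win b v h, e, ← smul_sub, hiso]
      exact hy (⟨rep v, rep_mem v h⟩, b)
    · rw [Wout b v h]; simpa using hε
  have key := parity_count hM hE S W A hA Ainv Afree ?_ ?_ ?_ ?_
  · convert key using 2
    ext C
    simp only [Set.mem_ofPred_eq]
    by_cases hC : C ∈ S.ch
    · by_cases hCA : ∀ l, C l ∈ A
      · rw [← h3 C hC hCA (fun l => W false (C l)) (fun l => Wclose _ _)]
        simp [hC]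
      · have hn : C ∉ T := fun h => hCA (hT C h).2
        push Not at hCA
        obtain ⟨f, hf, hf'⟩ := h1 C hC hCA
        simp only [hn, false_iff, not_and]
        intro _
        apply not_zeroIn_of_pos f
        intro l
        have a1 := hf' false l
        have a2 := hf (W false (C l) - w false (C l))
        have a3 := Wclose false (C l)
        rw [map_sub] at a2
        have := abs_le.mp a2
        linarith [this.1]
    · simp only [hC, false_and, iff_false]
      exact fun h => hC (hT C h).1
  · intro b v hv g
    rw [Win b v hv, Win b (g • v) (Ainv g v hv), γ_smul g v hv, mul_smul]
    congr 3
    simp [rep_smul]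
  · -- genericity
    intro C hC hCA r a ha hcard
    let bo : Option (Fin (M + 1)) → Bool := fun o => o.elim true (fun l => decide (l.val < r.val))
    let lo : Option (Fin (M + 1)) → Fin (M + 1) := fun o => o.elim r id
    have hz : ∀ o, zpt W r C o = W (bo o) (C (lo o)) := by
      rintro (_ | l)
      · rfl
      · simp only [zpt, bo, lo, Option.elim_some, id]
        by_cases h : l.val < r.val <;> simp [h]
    let q : Option (Fin (M + 1)) → A × Bool := fun o => (⟨rep (C (lo o)), rep_mem _ (hCA _)⟩, bo o)
    have hlo : ∀ o o', q o = q o' → lo o = lo o' := by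
      intro o o' h
      have h5 : rep (C (lo o)) = rep (C (lo o')) := congrArg (fun p => (p.1.1 : V)) h
      have h6 := congrArg S.rk h5
      rw [rk_rep, rk_rep, S.rk_ch C hC, S.rk_ch C hC] at h6
      exact Fin.ext h6
    have hq : Function.Injective q := by
      intro o o' h
      have h5 := hlo o o' h
      have h6 : bo o = bo o' := congrArg Prod.snd h
      rcases o with _ | l <;> rcases o' with _ | l'
      · rfl
      · simp only [lo, Option.elim_some, Option.elim_none, id] at h5
        subst h5
        simp [bo] at h6
      · simp only [lo, Option.elim_some, Option.elim_none, id] at h5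
        subst h5
        simp [bo] at h6
      · simp only [lo, Option.elim_some, id] at h5
        rw [h5]
    let g : A × Bool → G := Function.extend q (fun o => γ (C (lo o))) (fun _ => 1)
    let a' : A × Bool → ℝ := Function.extend q a (fun _ => 0)
    have hs := hy' ((Finset.univ.filter fun o => a o ≠ 0).image q) g a' ?_ ?_
    · funext o
      by_contra ho
      have := hs (q o) (Finset.mem_image.mpr ⟨o, by simpa using ho, rfl⟩)
      simp only [a', hq.extend_apply] at this
      exact ho this
    · rw [hE]; exact Finset.card_image_le.trans hcard
    · rw [Finset.sum_image (fun o _ o' _ h => hq h)]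
      rw [Finset.sum_filter_of_ne]
      · rw [← ha]
        apply Finset.sum_congr rfl
        intro o _
        simp only [a', g, hq.extend_apply]
        rw [hz o, Win _ _ (hCA _)]
      · intro o _ h
        simp only [a', hq.extend_apply] at h
        intro h0
        rw [h0, zero_smul] at h
        exact h rfl
  · intro C hC hCA
    obtain ⟨f, hf, hf'⟩ := h1 C hC hCA
    refine ⟨f, ?_⟩
    intro b l
    have a1 := hf' b l
    have a2 := hf (W b (C l) - w b (C l))
    have a3 := Wclose b (C l)
    rw [map_sub] at a2
    have := abs_le.mp a2
    linarith [this.1]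
  · intro C hC
    by_cases hCA : ∀ l, C l ∈ A
    · exact h2 C hC hCA _ (fun l => Wclose _ _)
    · push Not at hCA
      obtain ⟨f, hf, hf'⟩ := h1 C hC hCA
      apply not_zeroIn_of_pos f
      intro l
      have a1 := hf' true l
      have a2 := hf (W true (C l) - w true (C l))
      have a3 := Wclose true (C l)
      rw [map_sub] at a2
      have := abs_le.mp a2
      linarith [this.1]

end pert

/-! ### Part 5: zigzag chains -/

section zig
variable {ι : Type*} [Fintype ι] [DecidableEq ι] {M : ℕ}

/-- zigzag chains in the integer lattice -/
def zch (ι : Type*) (M : ℕ) : Set (Fin (M + 1) → ι → ℤ) :=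
  {C | ∃ (e σ : ι → ℤ) (r : ι ≃ Fin M), (∀ i, Even (e i)) ∧ (∀ i, σ i = 1 ∨ σ i = -1) ∧
    ∀ l i, C l i = e i + if (r i).val < l.val then σ i else 0}

/-- extension of a chain to all natural indices -/
def zcx (C : Fin (M + 1) → ι → ℤ) (n : ℕ) : ι → ℤ := C ⟨min n M, by omega⟩

/-- flipping a vertex of a chain -/
def zalt (l : Fin (M + 1)) (C : Fin (M + 1) → ι → ℤ) : Fin (M + 1) → ι → ℤ := fun m =>
  if m = l then
    (if l.val = 0 then 2 * zcx C 1 - C l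
     else if l.val = M then 2 * zcx C (M - 1) - C l
     else zcx C (l.val - 1) + zcx C (l.val + 1) - C l)
  else C m

lemma zcx_zalt (l : Fin (M + 1)) (C : Fin (M + 1) → ι → ℤ) (n : ℕ) (h : min n M ≠ l.val) :
    zcx (zalt l C) n = zcx C n := by
  unfold zcx zalt
  rw [if_neg]
  intro h'
  exact h (congrArg Fin.val h')

lemma zalt_off (l : Fin (M + 1)) (C : Fin (M + 1) → ι → ℤ) (m) (h : m ≠ l) :
    zalt l C m = C m := by simp [zalt, h]

lemma zalt_lo (l : Fin (M + 1)) (C : Fin (M + 1) → ι → ℤ) (h : l.val = 0) (a : Fin (M + 1))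
    (ha : a.val = 1) (i : ι) : zalt l C l i = 2 * C a i - C l i := by
  have hal := a.isLt
  have : (⟨min 1 M, by omega⟩ : Fin (M + 1)) = a := Fin.ext (by simp; omega)
  simp [zalt, h, zcx, this]

lemma zalt_hi (hM : 1 ≤ M) (l : Fin (M + 1)) (C : Fin (M + 1) → ι → ℤ) (h : l.val = M) (a : Fin (M + 1))
    (ha : a.val + 1 = M) (i : ι) : zalt l C l i = 2 * C a i - C l i := by
  have hal := a.isLt
  have h0 : l.val ≠ 0 := by omega
  have : (⟨min (M - 1) M, by omega⟩ : Fin (M + 1)) = a := Fin.ext (by simp; omega)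
  unfold zalt
  rw [if_pos rfl, if_neg h0, if_pos h]
  simp only [zcx, this, Pi.sub_apply, Pi.mul_apply, Pi.ofNat_apply]

lemma zalt_mid (l : Fin (M + 1)) (C : Fin (M + 1) → ι → ℤ) (a b : Fin (M + 1))
    (ha : a.val + 1 = l.val) (hb : l.val + 1 = b.val) (i : ι) :
    zalt l C l i = C a i + C b i - C l i := by
  have hbl := b.isLt
  have h0 : l.val ≠ 0 := by omega
  have h1 : l.val ≠ M := by omega
  have h2 : (⟨min (l.val - 1) M, by omega⟩ : Fin (M + 1)) = a := Fin.ext (by simp; omega)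
  have h3 : (⟨min (l.val + 1) M, by omega⟩ : Fin (M + 1)) = b := Fin.ext (by simp; omega)
  unfold zalt
  rw [if_pos rfl, if_neg h0, if_neg h1]
  simp only [zcx, h2, h3, Pi.sub_apply, Pi.add_apply]

lemma zalt_zalt (hM : 1 ≤ M) (l : Fin (M + 1)) (C : Fin (M + 1) → ι → ℤ) :
    zalt l (zalt l C) = C := by
  have hl := l.isLt
  funext m
  by_cases hm : m = l
  · subst hm
    funext i
    by_cases h0 : m.val = 0
    · rw [zalt_lo m _ h0 ⟨1, by omega⟩ rfl, zalt_lo m _ h0 ⟨1, by omega⟩ rfl,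
        zalt_off _ _ _ (by rw [Ne, Fin.ext_iff]; simp; omega)]; ring
    · by_cases h1 : m.val = M
      · rw [zalt_hi hM m _ h1 ⟨M - 1, by omega⟩ (by simp; omega), zalt_hi hM m _ h1 ⟨M - 1, by omega⟩ (by simp; omega),
          zalt_off _ _ _ (by rw [Ne, Fin.ext_iff]; simp; omega)]; ring
      · rw [zalt_mid m _ ⟨m.val - 1, by omega⟩ ⟨m.val + 1, by omega⟩ (by simp; omega) rfl,
          zalt_mid m _ ⟨m.val - 1, by omega⟩ ⟨m.val + 1, by omega⟩ (by simp; omega) rfl,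
          zalt_off _ _ _ (by rw [Ne, Fin.ext_iff]; simp; omega),
          zalt_off _ _ _ (by rw [Ne, Fin.ext_iff]; simp)]; ring
  · rw [zalt_off _ _ _ hm, zalt_off _ _ _ hm]

lemma zalt_mem (hM : 1 ≤ M) (l : Fin (M + 1)) (C : Fin (M + 1) → ι → ℤ) (hC : C ∈ zch ι M) :
    zalt l C ∈ zch ι M := by
  obtain ⟨e, σ, r, he, hσ, h⟩ := hC
  have hl := l.isLt
  by_cases h0 : l.val = 0
  · let i0 := r.symm ⟨0, by omega⟩
    refine ⟨fun i => if i = i0 then e i + 2 * σ i else e i, fun i => if i = i0 then - σ i else σ i,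
      r, ?_, ?_, ?_⟩
    · intro i; dsimp only; split_ifs
      · exact (he i).add (even_two_mul _)
      · exact he i
    · intro i; dsimp only; split_ifs
      · rcases hσ i with h | h <;> rw [h] <;> simp
      · exact hσ i
    · intro m i
      have hi : i = i0 ↔ (r i).val = 0 := by
        simp only [i0, Equiv.eq_symm_apply, Fin.ext_iff]
      by_cases hm : m = l
      · subst hm
        rw [zalt_lo m _ h0 ⟨1, by omega⟩ rfl, h, h]
        dsimp only
        by_cases hi' : i = i0
        · have := hi.mp hi'
          rw [if_pos hi', if_pos (by omega), if_neg (by omega), if_neg (by omega)]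
          ring
        · have := mt hi.mpr hi'
          rw [if_neg hi', if_neg (by omega), if_neg (by omega), if_neg (by omega)]
          ring
      · have : m.val ≠ 0 := fun h' => hm (Fin.ext (by omega))
        simp only [zalt, hm, if_false, h]
        by_cases hi' : i = i0
        · have := hi.mp hi'
          have h3 : (r i).val < m.val := by omega
          simp only [hi', if_true]
          rw [← hi']
          simp only [h3, if_true]; ring
        · simp only [hi', if_false]
  · by_cases h1 : l.val = M
    · let i0 := r.symm ⟨M - 1, by omega⟩
      refine ⟨e, fun i => if i = i0 then - σ i else σ i, r, he, ?_, ?_⟩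
      · intro i; dsimp only; split_ifs
        · rcases hσ i with h | h <;> rw [h] <;> simp
        · exact hσ i
      · intro m i
        have hri := (r i).isLt
        have hi : i = i0 ↔ (r i).val = M - 1 := by
          simp only [i0, Equiv.eq_symm_apply, Fin.ext_iff]
        by_cases hm : m = l
        · subst hm
          rw [zalt_hi hM m _ h1 ⟨M - 1, by omega⟩ (by simp; omega), h, h]
          dsimp only
          by_cases hi' : i = i0
          · have := hi.mp hi'
            rw [if_pos hi', if_neg (by omega), if_pos (by omega), if_pos (by omega)]
            ring
          · have := mt hi.mpr hi'
            rw [if_neg hi', if_pos (by omega), if_pos (by omega)]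
            ring
        · have : m.val ≠ M := fun h' => hm (Fin.ext (by omega))
          have := m.isLt
          simp only [zalt, hm, if_false, h]
          by_cases hi' : i = i0
          · have := hi.mp hi'
            have h3 : ¬ (r i).val < m.val := by omega
            simp only [h3, if_false]
          · simp only [hi', if_false]
    · refine ⟨e, σ, r.trans (Equiv.swap ⟨l.val - 1, by omega⟩ ⟨l.val, by omega⟩), he, hσ, ?_⟩
      intro m i
      have hri := (r i).isLt
      have key : (((r.trans (Equiv.swap ⟨l.val - 1, by omega⟩ ⟨l.val, by omega⟩)) i : Fin M) : ℕ) =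
          if (r i).val = l.val - 1 then l.val else if (r i).val = l.val then l.val - 1 else (r i).val := by
        simp only [Equiv.trans_apply, Equiv.swap_apply_def, Fin.ext_iff]
        split_ifs <;> simp_all
      rw [key]
      by_cases hm : m = l
      · subst hm
        rw [zalt_mid m _ ⟨m.val - 1, by omega⟩ ⟨m.val + 1, by omega⟩ (by simp; omega) rfl, h, h, h]
        dsimp only
        split_ifs <;> first | omega | ring
      · have : m.val ≠ l.val := fun h' => hm (Fin.ext (by omega))
        simp only [zalt, hm, if_false, h]
        congr 1
        split_ifs <;> first | omega | rfl

lemma zch_ne {C : Fin (M + 1) → ι → ℤ} (hC : C ∈ zch ι M) (a b : Fin (M + 1)) (hab : a < b) :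
    C a ≠ C b := by
  obtain ⟨e, σ, r, he, hσ, h⟩ := hC
  intro h'
  have hb := b.isLt
  have hab' : a.val < b.val := hab
  have := congrFun h' (r.symm ⟨a.val, by omega⟩)
  rw [h, h] at this
  simp only [Equiv.apply_symm_apply, lt_irrefl, if_false, hab', if_true] at this
  rcases hσ (r.symm ⟨a.val, by omega⟩) with h | h <;> rw [h] at this <;> omega

lemma zalt_ne (hM : 1 ≤ M) (l : Fin (M + 1)) (C : Fin (M + 1) → ι → ℤ) (hC : C ∈ zch ι M) :
    zalt l C ≠ C := by
  intro h
  have hl := l.isLt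
  have h' := fun i => congrFun (congrFun h l) i
  by_cases h0 : l.val = 0
  · refine zch_ne hC l ⟨1, by omega⟩ (by rw [Fin.lt_def]; dsimp only; omega) ?_
    funext i
    have := h' i
    rw [zalt_lo l _ h0 ⟨1, by omega⟩ rfl] at this
    omega
  · by_cases h1 : l.val = M
    · refine zch_ne hC ⟨M - 1, by omega⟩ l (by rw [Fin.lt_def]; dsimp only; omega) ?_
      funext i
      have := h' i
      rw [zalt_hi hM l _ h1 ⟨M - 1, by omega⟩ (by simp; omega)] at this
      omega
    · obtain ⟨e, σ, r, he, hσ, hh⟩ := hC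
      have := h' (r.symm ⟨l.val, by omega⟩)
      rw [zalt_mid l _ ⟨l.val - 1, by omega⟩ ⟨l.val + 1, by omega⟩ (by simp; omega) rfl] at this
      simp only [hh, Equiv.apply_symm_apply, lt_irrefl, if_false] at this
      rw [if_neg (by omega), if_pos (by omega)] at this
      rcases hσ (r.symm ⟨l.val, by omega⟩) with h | h <;> rw [h] at this <;> omega

/-- the system of zigzag chains -/
def zsys {G : Type*} [Group G] [MulAction G (ι → ℤ)] (hM : 1 ≤ M)
    (hact : ∀ g : G, ∃ (s : ι → ℤ) (p : Equiv.Perm ι), (∀ i, s i = 1 ∨ s i = -1) ∧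
      ∀ (v : ι → ℤ) i, (g • v) i = s i * v (p i)) : ChainSys G (ι → ℤ) M where
  ch := zch ι M
  rk v := (Finset.univ.filter fun i => Odd (v i)).card
  rk_smul := by
    intro g v
    obtain ⟨s, p, hs, h⟩ := hact g
    refine Finset.card_bij (fun i _ => p i) ?_ (fun a _ b _ h => p.injective h) ?_
    · intro i hi
      simp only [Finset.mem_filter, Finset.mem_univ, true_and, h] at hi ⊢
      exact (Int.odd_mul.mp hi).2
    · intro i hi
      refine ⟨p.symm i, ?_, by simp⟩
      simp only [Finset.mem_filter, Finset.mem_univ, true_and, h, Equiv.apply_symm_apply] at hi ⊢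
      refine Int.odd_mul.mpr ⟨?_, hi⟩
      rcases hs (p.symm i) with h | h <;> rw [h] <;> decide
  rk_ch := by
    rintro C ⟨e, σ, r, he, hσ, h⟩ l
    have hl := l.isLt
    have : (Finset.univ.filter fun i => Odd (C l i)) =
        (Finset.univ.filter fun a : Fin M => a.val < l.val).map r.symm.toEmbedding := by
      ext i
      simp only [Finset.mem_filter, Finset.mem_univ, true_and, Finset.mem_map_equiv, Equiv.symm_symm, h]
      split_ifs with hi
      · simp only [hi, iff_true]
        refine (he i).add_odd ?_
        rcases hσ i with h | h <;> rw [h] <;> decide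
      · simp [hi, he i]
    rw [this, Finset.card_map]
    have h2 := Fin.card_filter_val_lt (n := M) (m := l.val)
    rw [h2]; omega
  inv := by
    rintro g C ⟨e, σ, r, he, hσ, h⟩
    obtain ⟨s, p, hs, hh⟩ := hact g
    refine ⟨fun i => s i * e (p i), fun i => s i * σ (p i), p.trans r, ?_, ?_, ?_⟩
    · intro i; exact (he _).mul_left _
    · intro i; dsimp only
      rcases hs i with h | h <;> rcases hσ (p i) with h' | h' <;> rw [h, h'] <;> simp
    · intro l i
      rw [Pi.smul_apply, hh, h]
      by_cases hlt : (r (p i)).val < l.val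
      · have hlt' : ((p.trans r) i).val < l.val := hlt
        rw [if_pos hlt, if_pos hlt']; ring
      · have hlt' : ¬ ((p.trans r) i).val < l.val := hlt
        rw [if_neg hlt, if_neg hlt']; ring
  alt := zalt
  alt_mem := fun l C hC => zalt_mem hM l C hC
  alt_off := by
    intro l C _ m hm
    simp [zalt, hm]
  alt_ne := fun l C hC => zalt_ne hM l C hC
  alt_inv := fun l C _ => zalt_zalt hM l C
  alt_smul := by
    intro l g C _
    obtain ⟨s, p, hs, hh⟩ := hact g
    funext m i
    simp only [Pi.smul_apply, zalt]
    split_ifs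
    all_goals simp only [hh, zcx, Pi.sub_apply, Pi.add_apply, Pi.mul_apply, Pi.smul_apply, Pi.ofNat_apply]
    all_goals ring

end zig

section zig2
variable {ι : Type*} [Fintype ι] [DecidableEq ι] {M : ℕ}

lemma zig_sum {C : Fin (M + 1) → ι → ℤ} {e σ : ι → ℤ} {r : ι ≃ Fin M}
    (h : ∀ l i, C l i = e i + if (r i).val < l.val then σ i else 0) (a : Fin (M + 1) → ℝ) (i : ι) :
    ∑ l, a l * (C l i : ℝ) = e i * ∑ l, a l + σ i * ∑ l : Fin (M + 1), if (r i).val < l.val then a l else 0 := by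
  rw [Finset.mul_sum, Finset.mul_sum, ← Finset.sum_add_distrib]
  refine Finset.sum_congr rfl fun l _ => ?_
  rw [h]
  split_ifs <;> push_cast <;> ring

lemma zig_indep {C : Fin (M + 1) → ι → ℤ} (hC : C ∈ zch ι M) (a : Fin (M + 1) → ℝ)
    (h0 : ∑ l, a l = 0) (h1 : ∀ i, ∑ l, a l * (C l i : ℝ) = 0) : ∀ l, a l = 0 := by
  obtain ⟨e, σ, r, he, hσ, h⟩ := hC
  have key : ∀ n : ℕ, ∑ l : Fin (M + 1), (if n ≤ l.val then a l else 0) = 0 := by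
    intro n
    rcases Nat.eq_zero_or_pos n with rfl | hn
    · simpa using h0
    · by_cases hnM : n ≤ M
      · have h2 := h1 (r.symm ⟨n - 1, by omega⟩)
        rw [zig_sum h, h0, mul_zero, zero_add] at h2
        rcases mul_eq_zero.mp h2 with h3 | h3
        · exfalso
          have h4 : σ (r.symm ⟨n - 1, by omega⟩) = 0 := by exact_mod_cast h3
          rcases hσ (r.symm ⟨n - 1, by omega⟩) with h5 | h5 <;> omega
        · refine Eq.trans ?_ h3
          refine Finset.sum_congr rfl fun l _ => ?_
          have : (n ≤ l.val) ↔ ((r (r.symm ⟨n - 1, by omega⟩)).val < l.val) := by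
            rw [Equiv.apply_symm_apply]; dsimp only; omega
          simp only [this]
      · refine Finset.sum_eq_zero fun l _ => ?_
        have := l.isLt
        rw [if_neg (by omega)]
  intro l
  have h2 := key l.val
  have h3 := key (l.val + 1)
  have h4 : ∑ m : Fin (M + 1), ((if l.val ≤ m.val then a m else 0) - (if l.val + 1 ≤ m.val then a m else 0)) = a l := by
    rw [Finset.sum_eq_single l]
    · simp
    · intro m _ hm
      have : m.val ≠ l.val := fun h => hm (Fin.ext h)
      have : (l.val ≤ m.val) ↔ (l.val + 1 ≤ m.val) := by omega
      simp [this]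
    · simp
  rw [← h4, Finset.sum_sub_distrib, h2, h3, sub_zero]

lemma zig_unique (hM : Fintype.card ι = M) {z : ι → ℝ} {e σ : ι → ℤ} {φ : ι → ℝ} (he : ∀ i, Even (e i))
    (hσ : ∀ i, σ i = 1 ∨ σ i = -1) (h0 : ∀ i, 0 < φ i) (h1 : ∀ i, φ i < 1)
    (hinj : Function.Injective φ) (hz : ∀ i, z i = e i + σ i * φ i) :
    ∃ C ∈ zch ι M, (∃ a : Fin (M + 1) → ℝ, (∀ l, 0 < a l) ∧ ∑ l, a l = 1 ∧
      ∀ i, ∑ l, a l * (C l i : ℝ) = z i) ∧ ∀ C' ∈ zch ι M, ∀ a : Fin (M + 1) → ℝ, (∀ l, 0 ≤ a l) →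
      ∑ l, a l = 1 → (∀ i, ∑ l, a l * (C' l i : ℝ) = z i) → C' = C := by
  let D : ι → Finset ι := fun i => Finset.univ.filter fun j => φ i < φ j
  have hDlt : ∀ i j, φ i < φ j → (D j).card < (D i).card := by
    intro i j hij
    apply Finset.card_lt_card
    rw [Finset.ssubset_iff_of_subset]
    · exact ⟨j, by simp [D, hij], by simp [D]⟩
    · intro m hm
      simp only [D, Finset.mem_filter, Finset.mem_univ, true_and] at hm ⊢
      exact hij.trans hm
  have hDM : ∀ i, (D i).card < M := by
    intro i
    rw [← hM]
    apply Finset.card_lt_univ_of_notMem (x := i)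
    simp [D]
  have hDinj : ∀ i j, (D i).card = (D j).card → i = j := by
    intro i j hij
    by_contra hne
    rcases lt_or_gt_of_ne (fun h => hne (hinj h)) with h | h
    · have := hDlt _ _ h; omega
    · have := hDlt _ _ h; omega
  have hbij : Function.Bijective (fun i => (⟨(D i).card, hDM i⟩ : Fin M)) := by
    rw [Fintype.bijective_iff_injective_and_card]
    exact ⟨fun i j h => hDinj i j (by simpa using h), by simp [hM]⟩
  let r : ι ≃ Fin M := Equiv.ofBijective _ hbij
  have hr : ∀ i, (r i).val = (D i).card := fun i => rfl
  refine ⟨fun l i => e i + if (r i).val < l.val then σ i else 0, ⟨e, σ, r, he, hσ, fun _ _ => rfl⟩, ?_, ?_⟩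
  · let s : ℕ → ℝ := fun n => if n = 0 then 1 else if h : n - 1 < M then φ (r.symm ⟨n - 1, h⟩) else 0
    have hs1 : ∀ n (hn : n < M), s (n + 1) = φ (r.symm ⟨n, hn⟩) := by
      intro n hn; simp [s, hn]
    have hs0 : s 0 = 1 := by simp [s]
    have hsM : s (M + 1) = 0 := by simp [s]
    have hsr : ∀ i, s ((r i).val + 1) = φ i := by
      intro i; rw [hs1 _ (r i).isLt]; simp
    have hdec : ∀ n, n ≤ M → s (n + 1) < s n := by
      intro n hn
      rcases Nat.eq_zero_or_pos n with rfl | hpos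
      · rw [hs0]
        rcases Nat.eq_zero_or_pos M with hM0 | hM0
        · have : s 1 = 0 := by simp [s, hM0]
          rw [zero_add, this]; norm_num
        · rw [hs1 0 hM0]; exact h1 _
      · obtain ⟨m, rfl⟩ : ∃ m, n = m + 1 := ⟨n - 1, by omega⟩
        rw [hs1 m (by omega)]
        by_cases hmM : m + 1 < M
        · rw [hs1 _ hmM]
          by_contra hcon
          push Not at hcon
          rcases hcon.lt_or_eq with hlt | heq
          · have := hDlt _ _ hlt
            rw [← hr, ← hr, Equiv.apply_symm_apply, Equiv.apply_symm_apply] at this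
            simp at this
          · have := hinj heq
            simp at this
        · have : m + 1 + 1 = M + 1 := by omega
          rw [this, hsM]; exact h0 _
    refine ⟨fun l => s l.val - s (l.val + 1), fun l => sub_pos.mpr (hdec _ (by omega)), ?_, ?_⟩
    · rw [Fin.sum_univ_eq_sum_range (fun n => s n - s (n + 1)), Finset.sum_range_sub', hs0, hsM, sub_zero]
    · intro i
      rw [zig_sum (fun _ _ => rfl), hz,
        Fin.sum_univ_eq_sum_range (fun n => s n - s (n + 1)), Finset.sum_range_sub', hs0, hsM, sub_zero, mul_one]
      congr 2
      rw [Fin.sum_univ_eq_sum_range (fun n => if (r i).val < n then s n - s (n + 1) else 0), ← hsr i]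
      have : ∀ N, ∑ n ∈ Finset.range N, (if (r i).val < n then s n - s (n + 1) else 0) =
          if (r i).val < N then s ((r i).val + 1) - s N else 0 := by
        intro N
        induction N with
        | zero => simp
        | succ N ih =>
          rw [Finset.sum_range_succ, ih]
          rcases lt_trichotomy (r i).val N with h | h | h
          · rw [if_pos h, if_pos h, if_pos (by omega)]; ring
          · rw [if_neg (by omega), if_neg (by omega), if_pos (by omega), h]; ring
          · rw [if_neg (by omega), if_neg (by omega), if_neg (by omega)]; ring
      rw [this, if_pos (by have := (r i).isLt; omega), hsM, sub_zero]
  · rintro C' ⟨e', σ', r', he', hσ', h'⟩ a ha0 ha1 haz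
    let ψ : ι → ℝ := fun i => ∑ l : Fin (M + 1), if (r' i).val < l.val then a l else 0
    have hψ0 : ∀ i, 0 ≤ ψ i := fun i => Finset.sum_nonneg fun l _ => by
      split_ifs
      · exact ha0 l
      · exact le_rfl
    have hψ1 : ∀ i, ψ i ≤ 1 := fun i => by
      rw [← ha1]
      refine Finset.sum_le_sum fun l _ => ?_
      split_ifs
      · exact le_rfl
      · exact ha0 l
    have heq : ∀ i, (e' i : ℝ) + σ' i * ψ i = e i + σ i * φ i := by
      intro i
      rw [← hz, ← haz, zig_sum h', ha1, mul_one]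
    have hee : ∀ i, e' i = e i ∧ σ' i = σ i ∧ ψ i = φ i := by
      intro i
      have h2 := heq i
      have h3 : |(e' i : ℝ) - e i| < 2 := by
        have a1 := hψ0 i
        have a2 := hψ1 i
        have a3 := h0 i
        have a4 := h1 i
        rw [abs_lt]
        rcases hσ i with hh | hh <;> rcases hσ' i with hh' | hh' <;> rw [hh, hh'] at h2 <;>
          push_cast at h2 <;> constructor <;> linarith
      have h4 : |e' i - e i| < 2 := by exact_mod_cast h3
      have h5 : e' i = e i := by
        have := (he' i).sub (he i)
        obtain ⟨m, hm⟩ := this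
        rw [abs_lt] at h4
        omega
      rw [h5] at h2
      have a1 := hψ0 i
      have a3 := h0 i
      refine ⟨h5, ?_⟩
      rcases hσ i with hh | hh <;> rcases hσ' i with hh' | hh' <;> rw [hh, hh'] at h2 ⊢ <;>
          push_cast at h2
      · exact ⟨rfl, by linarith⟩
      · exfalso; linarith
      · exfalso; linarith
      · exact ⟨rfl, by linarith⟩
    have hmono : ∀ i j, (r' i).val < (r' j).val → φ j < φ i := by
      intro i j hij
      have h2 : ψ j ≤ ψ i := by
        refine Finset.sum_le_sum fun l _ => ?_
        by_cases hl : (r' j).val < l.val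
        · rw [if_pos hl, if_pos (by omega)]
        · rw [if_neg hl]
          split_ifs
          · exact ha0 l
          · exact le_rfl
      rw [(hee i).2.2, (hee j).2.2] at h2
      refine lt_of_le_of_ne h2 fun h => ?_
      have := hinj h
      subst this
      omega
    have hrr : ∀ i, (r' i).val = (r i).val := by
      intro i
      rw [hr]
      have : D i = (Finset.univ.filter fun b : Fin M => b.val < (r' i).val).map r'.symm.toEmbedding := by
        ext m
        simp only [D, Finset.mem_filter, Finset.mem_univ, true_and, Finset.mem_map_equiv, Equiv.symm_symm]
        constructor
        · intro hm
          by_contra hcon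
          push Not at hcon
          rcases hcon.lt_or_eq with hlt | heq
          · exact absurd (hmono _ _ hlt) (by linarith)
          · have : i = m := r'.injective (Fin.ext heq)
            subst this
            exact lt_irrefl _ hm
        · exact hmono _ _
      rw [this, Finset.card_map, Fin.card_filter_val_lt]
      have := (r' i).isLt
      omega
    funext l i
    rw [h', (hee i).1, (hee i).2.1, hrr]

end zig2

section robust
variable {E : Type*} [NormedAddCommGroup E] [NormedSpace ℝ E] [FiniteDimensional ℝ E] {M : ℕ}

lemma robust_not {κ : Type*} [Fintype κ] {w : κ → E} (h : ¬ ZeroIn w) :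
    ∃ ε > 0, ∀ w' : κ → E, (∀ l, ‖w' l - w l‖ < ε) → ¬ ZeroIn w' := by
  rcases (stdSimplex ℝ κ).eq_empty_or_nonempty with hemp | hne
  · refine ⟨1, one_pos, fun w' _ hz => ?_⟩
    obtain ⟨a, h1, h2, h3⟩ := hz
    have : a ∈ stdSimplex ℝ κ := ⟨h1, h2⟩
    rw [hemp] at this
    exact this
  · have hcont : ContinuousOn (fun a : κ → ℝ => ‖∑ l, a l • w l‖) (stdSimplex ℝ κ) := by
      apply Continuous.continuousOn
      fun_prop
    obtain ⟨a0, ha0, hmin⟩ := (isCompact_stdSimplex ℝ κ).exists_isMinOn hne hcont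
    have hpos : 0 < ‖∑ l, a0 l • w l‖ := by
      rw [norm_pos_iff]
      intro hz
      exact h ⟨a0, ha0.1, ha0.2, hz⟩
    refine ⟨‖∑ l, a0 l • w l‖, hpos, ?_⟩
    rintro w' hw' ⟨a, h1, h2, h3⟩
    have h4 : ‖∑ l, a0 l • w l‖ ≤ ‖∑ l, a l • w l‖ := hmin ⟨h1, h2⟩
    have h5 : ∑ l, a l • w l = - ∑ l, a l • (w' l - w l) := by
      simp only [smul_sub, Finset.sum_sub_distrib, h3]; simp
    have h6 : ‖∑ l, a l • w l‖ < ‖∑ l, a0 l • w l‖ := by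
      rw [h5, norm_neg]
      calc ‖∑ l, a l • (w' l - w l)‖ ≤ ∑ l, ‖a l • (w' l - w l)‖ := norm_sum_le _ _
        _ = ∑ l, a l * ‖w' l - w l‖ := by
          refine Finset.sum_congr rfl fun l _ => ?_
          rw [norm_smul, Real.norm_of_nonneg (h1 l)]
        _ < ∑ l, a l * ‖∑ l, a0 l • w l‖ := by
          have : ∃ l, 0 < a l := by
            by_contra hcon
            push Not at hcon
            have : ∑ l, a l ≤ 0 := Finset.sum_nonpos fun l _ => hcon l
            linarith
          obtain ⟨l, hl⟩ := this
          exact Finset.sum_lt_sum (fun l _ => mul_le_mul_of_nonneg_left (hw' l).le (h1 l))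
            ⟨l, Finset.mem_univ _, mul_lt_mul_of_pos_left (hw' l) hl⟩
        _ = ‖∑ l, a0 l • w l‖ := by rw [← Finset.sum_mul, h2, one_mul]
    linarith

lemma robust_yes (hE : Module.finrank ℝ E = M) {w : Fin (M + 1) → E} {a0 : Fin (M + 1) → ℝ}
    (hpos : ∀ l, 0 < a0 l) (hs : ∑ l, a0 l = 1) (hz : ∑ l, a0 l • w l = 0)
    (hind : ∀ a : Fin (M + 1) → ℝ, ∑ l, a l = 0 → ∑ l, a l • w l = 0 → ∀ l, a l = 0) :
    ∃ ε > 0, ∀ w' : Fin (M + 1) → E, (∀ l, ‖w' l - w l‖ < ε) → ZeroIn w' := by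
  let Tm : (Fin (M + 1) → E) → ((Fin (M + 1) → ℝ) →L[ℝ] E × ℝ) := fun w =>
    ∑ l, (ContinuousLinearMap.proj (R := ℝ) (φ := fun _ : Fin (M + 1) => ℝ) l).smulRight (w l, (1 : ℝ))
  have hT : ∀ w a, Tm w a = (∑ l, a l • w l, ∑ l, a l) := by
    intro w a
    simp only [Tm, ContinuousLinearMap.sum_apply, ContinuousLinearMap.smulRight_apply,
      ContinuousLinearMap.proj_apply, Prod.smul_mk, smul_eq_mul, mul_one]
    exact Prod.ext (by simp [Prod.fst_sum]) (by simp [Prod.snd_sum])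
  have hTc : Continuous Tm := by
    refine continuous_finsetSum _ fun l _ => ?_
    have : Continuous fun y : E × ℝ => (ContinuousLinearMap.proj (R := ℝ) (φ := fun _ : Fin (M + 1) => ℝ) l).smulRight y :=
      (ContinuousLinearMap.smulRightL ℝ (Fin (M + 1) → ℝ) (E × ℝ) (ContinuousLinearMap.proj l)).continuous
    exact this.comp ((continuous_apply l).prodMk continuous_const)
  have hinj : Function.Injective (Tm w) := by
    rw [injective_iff_map_eq_zero]
    intro a ha
    rw [hT, Prod.mk_eq_zero] at ha
    funext l
    exact hind a ha.2 ha.1 l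
  have hfr : Module.finrank ℝ (Fin (M + 1) → ℝ) = Module.finrank ℝ (E × ℝ) := by
    simp [hE]
  let e0 : (Fin (M + 1) → ℝ) ≃ₗ[ℝ] E × ℝ :=
    LinearEquiv.ofInjectiveOfFinrankEq (Tm w).toLinearMap hinj hfr
  let e : (Fin (M + 1) → ℝ) ≃L[ℝ] E × ℝ := e0.toContinuousLinearEquiv
  have hew : (e : (Fin (M + 1) → ℝ) →L[ℝ] E × ℝ) = Tm w := by
    ext a <;> rfl
  have h1 : ContinuousAt (fun w' => ContinuousLinearMap.inverse (Tm w') ((0 : E), (1 : ℝ))) w := by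
    have h2 : ContinuousAt (ContinuousLinearMap.inverse : ((Fin (M + 1) → ℝ) →L[ℝ] E × ℝ) → _) (Tm w) := by
      rw [← hew]
      exact (contDiffAt_map_inverse (n := 0) e).continuousAt
    have h3 : ContinuousAt (fun w' => ContinuousLinearMap.inverse (Tm w')) w :=
      ContinuousAt.comp (f := Tm) h2 hTc.continuousAt
    exact h3.clm_apply continuousAt_const
  have h0 : ContinuousLinearMap.inverse (Tm w) ((0 : E), (1 : ℝ)) = a0 := by
    rw [← hew, ContinuousLinearMap.inverse_equiv]
    change e.symm (0, 1) = a0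
    rw [ContinuousLinearEquiv.symm_apply_eq]
    change _ = Tm w a0
    rw [hT, hz, hs]
  have h4 : ∀ᶠ w' in nhds w, ∀ l, 0 < ContinuousLinearMap.inverse (Tm w') ((0 : E), (1 : ℝ)) l := by
    rw [Filter.eventually_all]
    intro l
    have h5 := ((continuous_apply l).continuousAt.comp h1 : ContinuousAt _ w)
    refine h5.eventually (lt_mem_nhds ?_)
    simp only [Function.comp]
    rw [h0]; exact hpos l
  have h5 : ∀ᶠ w' in nhds w, ∃ e' : (Fin (M + 1) → ℝ) ≃L[ℝ] E × ℝ, (e' : _ →L[ℝ] _) = Tm w' := by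
    have h6 : Set.range ((↑) : ((Fin (M + 1) → ℝ) ≃L[ℝ] E × ℝ) → _) ∈ nhds (Tm w) := by
      rw [← hew]; exact e.nhds
    exact hTc.continuousAt.eventually h6
  obtain ⟨ε, hε, hball⟩ := Metric.eventually_nhds_iff.mp (h4.and h5)
  refine ⟨ε, hε, fun w' hw' => ?_⟩
  obtain ⟨h6, e', he'⟩ := hball (y := w') ((dist_pi_lt_iff hε).mpr fun l => by rw [dist_eq_norm]; exact hw' l)
  rw [← he', ContinuousLinearMap.inverse_equiv] at h6
  have h7 : Tm w' (e'.symm (0, 1)) = (0, 1) := by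
    rw [← he']; exact e'.apply_symm_apply _
  rw [hT, Prod.mk.injEq] at h7
  exact ⟨_, fun l => (h6 l).le, h7.2, h7.1⟩

/-- if all points are close to a point of large norm then zero is not in the hull -/
lemma not_zeroIn_of_close {κ : Type*} [Fintype κ] {w : κ → E} {y : E} {η : ℝ} (hy : η ≤ ‖y‖)
    (h : ∀ l, ‖w l - y‖ < η) : ¬ ZeroIn w := by
  rintro ⟨a, h1, h2, h3⟩
  have h5 : y = - ∑ l, a l • (w l - y) := by
    simp only [smul_sub, Finset.sum_sub_distrib, h3, ← Finset.sum_smul, h2]; simp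
  have : ∃ l, 0 < a l := by
    by_contra hcon
    push Not at hcon
    have : ∑ l, a l ≤ 0 := Finset.sum_nonpos fun l _ => hcon l
    linarith
  obtain ⟨l, hl⟩ := this
  have h6 : ‖y‖ < η := by
    rw [h5, norm_neg]
    calc ‖∑ l, a l • (w l - y)‖ ≤ ∑ l, ‖a l • (w l - y)‖ := norm_sum_le _ _
      _ = ∑ l, a l * ‖w l - y‖ := by
        refine Finset.sum_congr rfl fun l _ => ?_
        rw [norm_smul, Real.norm_of_nonneg (h1 l)]
      _ < ∑ l, a l * η :=
        Finset.sum_lt_sum (fun l _ => mul_le_mul_of_nonneg_left (h l).le (h1 l))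
            ⟨l, Finset.mem_univ _, mul_lt_mul_of_pos_left (h l) hl⟩
      _ = η := by rw [← Finset.sum_mul, h2, one_mul]
  linarith

end robust

/-! ### Part 6: the symmetry group -/

/-- the group of row flips and row permutations fixing `c` -/
@[ext] structure SGrp (k : ℕ) (c : Fin k → ℕ) where
  β : Fin k → Bool
  τ : Equiv.Perm (Fin k)
  h : ∀ t, c (τ t) = c t

/-- sign of a bit -/
def sg (b : Bool) : ℤ := if b then -1 else 1

lemma sg_or (b : Bool) : sg b = 1 ∨ sg b = -1 := by cases b <;> simp [sg]
lemma sg_xor (a b : Bool) : sg (xor a b) = sg a * sg b := by cases a <;> cases b <;> simp [sg]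
lemma sg_sq (a : Bool) : sg a * sg a = 1 := by cases a <;> simp [sg]
lemma sg_inj {a b : Bool} (h : sg a = sg b) : a = b := by
  cases a <;> cases b <;> simp [sg] at h ⊢

/-- index set of coordinates -/
abbrev Ix (k : ℕ) (c : Fin k → ℕ) := Σ t : Fin k, Fin (c t + 1)

/-- nonempty subsets -/
abbrev NE (k : ℕ) := {A : Finset (Fin k) // A.Nonempty}

/-- target space -/
abbrev TE (j k : ℕ) := (Fin j × NE k → ℝ) × (Fin k → ℝ)

namespace SGrp
variable {k : ℕ} {c : Fin k → ℕ}

instance : Mul (SGrp k c) := ⟨fun g₁ g₂ =>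
  ⟨fun t => xor (g₁.β t) (g₂.β (g₁.τ t)), g₂.τ * g₁.τ, fun t => by
    rw [Equiv.Perm.mul_apply, g₂.h, g₁.h]⟩⟩
instance : One (SGrp k c) := ⟨⟨fun _ => false, 1, fun _ => rfl⟩⟩
instance : Inv (SGrp k c) := ⟨fun g => ⟨fun t => g.β (g.τ.symm t), g.τ.symm, fun t => by
  rw [← g.h, Equiv.apply_symm_apply]⟩⟩

lemma mul_β (g₁ g₂ : SGrp k c) (t) : (g₁ * g₂).β t = xor (g₁.β t) (g₂.β (g₁.τ t)) := rfl
lemma mul_τ (g₁ g₂ : SGrp k c) (t) : (g₁ * g₂).τ t = g₂.τ (g₁.τ t) := rfl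
lemma one_β (t) : (1 : SGrp k c).β t = false := rfl
lemma one_τ (t) : (1 : SGrp k c).τ t = t := rfl

instance : Group (SGrp k c) := Group.ofLeftAxioms
  (by
    intro a b d
    ext t
    · simp [mul_β, mul_τ]
    · simp [mul_τ])
  (by
    intro a
    ext t
    · simp [mul_β, one_β, one_τ]
    · simp [mul_τ, one_τ])
  (by
    intro a
    ext t
    · rw [mul_β]; simp only [one_β, Inv.inv]; simp
    · rw [mul_τ]; simp only [one_τ, Inv.inv]; simp)

instance : Finite (SGrp k c) :=
  Finite.of_injective (fun g : SGrp k c => (g.β, g.τ)) (by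
    intro a b h
    simp only [Prod.mk.injEq] at h
    exact SGrp.ext h.1 h.2)

/-- induced permutation of the coordinates -/
def px (g : SGrp k c) : Equiv.Perm (Ix k c) where
  toFun i := ⟨g.τ i.1, ⟨i.2.val, by rw [g.h]; exact i.2.isLt⟩⟩
  invFun i := ⟨g.τ.symm i.1, ⟨i.2.val, by
    have := g.h (g.τ.symm i.1)
    rw [Equiv.apply_symm_apply] at this
    rw [← this]; exact i.2.isLt⟩⟩
  left_inv := by
    rintro ⟨t, m⟩
    rw [Sigma.mk.injEq]
    refine ⟨by simp, ?_⟩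
    rw [Fin.heq_ext_iff (by simp)]
  right_inv := by
    rintro ⟨t, m⟩
    rw [Sigma.mk.injEq]
    refine ⟨by simp, ?_⟩
    rw [Fin.heq_ext_iff (by simp)]

instance : MulAction (SGrp k c) (Ix k c → ℤ) where
  smul g v := fun i => sg (g.β i.1) * v (g.px i)
  one_smul v := by
    funext i
    change sg ((1 : SGrp k c).β i.1) * v ((1 : SGrp k c).px i) = v i
    rw [one_β]
    change 1 * v i = v i
    rw [one_mul]
  mul_smul a b v := by
    funext i
    change sg ((a * b).β i.1) * v ((a * b).px i) = sg (a.β i.1) * (sg (b.β (a.τ i.1)) * v (b.px (a.px i)))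
    rw [mul_β, sg_xor, mul_assoc]
    rfl

lemma smul_v (g : SGrp k c) (v : Ix k c → ℤ) (i) : (g • v) i = sg (g.β i.1) * v (g.px i) := rfl

/-- action on subsets -/
def ne (g : SGrp k c) (A : NE k) : NE k := ⟨A.1.map g.τ.toEmbedding, by simpa using A.2⟩

variable {j : ℕ}

instance : DistribMulAction (SGrp k c) (TE j k) where
  smul g y := (fun q => (∏ t ∈ q.2.1, (sg (g.β t) : ℝ)) * y.1 (q.1, g.ne q.2), fun t => y.2 (g.τ t))
  one_smul y := by
    refine Prod.ext ?_ ?_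
    · funext q
      change (∏ t ∈ q.2.1, (sg ((1 : SGrp k c).β t) : ℝ)) * y.1 (q.1, (1 : SGrp k c).ne q.2) = y.1 q
      have : (1 : SGrp k c).ne q.2 = q.2 := by
        refine Subtype.ext ?_
        have h1 : (1 : SGrp k c).τ = 1 := rfl
        ext t; simp only [ne, h1, Finset.mem_map_equiv]; rfl
      rw [this]
      simp [one_β, sg]
    · rfl
  mul_smul a b y := by
    refine Prod.ext ?_ ?_
    · funext q
      change (∏ t ∈ q.2.1, (sg ((a * b).β t) : ℝ)) * y.1 (q.1, (a * b).ne q.2) =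
        (∏ t ∈ q.2.1, (sg (a.β t) : ℝ)) * ((∏ t ∈ (a.ne q.2).1, (sg (b.β t) : ℝ)) * y.1 (q.1, b.ne (a.ne q.2)))
      have : (a * b).ne q.2 = b.ne (a.ne q.2) := by
        refine Subtype.ext ?_
        simp only [ne, Finset.map_map]
        rfl
      rw [this, ← mul_assoc]
      congr 1
      simp only [ne, Finset.prod_map, ← Finset.prod_mul_distrib]
      refine Finset.prod_congr rfl fun t _ => ?_
      rw [mul_β, sg_xor]; push_cast; rfl
    · rfl
  smul_zero g := by
    refine Prod.ext ?_ ?_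
    · funext q
      exact mul_zero _
    · rfl
  smul_add g y z := by
    refine Prod.ext ?_ ?_
    · funext q
      exact mul_add _ _ _
    · rfl

lemma smul_fst (g : SGrp k c) (y : TE j k) (q) :
    (g • y).1 q = (∏ t ∈ q.2.1, (sg (g.β t) : ℝ)) * y.1 (q.1, g.ne q.2) := rfl
lemma smul_snd (g : SGrp k c) (y : TE j k) (t) : (g • y).2 t = y.2 (g.τ t) := rfl

instance : SMulCommClass (SGrp k c) ℝ (TE j k) := ⟨by
  intro g a y
  refine Prod.ext ?_ ?_
  · funext q
    simp only [smul_fst, Prod.smul_fst, Pi.smul_apply, smul_eq_mul]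
    ring
  · rfl⟩

lemma norm_smul_le (g : SGrp k c) (y : TE j k) : ‖g • y‖ ≤ ‖y‖ := by
  rw [Prod.norm_def, max_le_iff]
  constructor
  · rw [pi_norm_le_iff_of_nonneg (norm_nonneg _)]
    intro q
    rw [smul_fst, norm_mul, norm_prod]
    have : ∏ t ∈ q.2.1, ‖(sg (g.β t) : ℝ)‖ = 1 := by
      refine Finset.prod_eq_one fun t _ => ?_
      rcases sg_or (g.β t) with h | h <;> rw [h] <;> simp
    rw [this, one_mul]
    exact (norm_le_pi_norm _ _).trans (norm_fst_le y)
  · rw [pi_norm_le_iff_of_nonneg (norm_nonneg _)]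
    intro t
    rw [smul_snd]
    exact (norm_le_pi_norm _ _).trans (norm_snd_le y)

lemma norm_smul_eq (g : SGrp k c) (y : TE j k) : ‖g • y‖ = ‖y‖ := by
  refine le_antisymm (norm_smul_le g y) ?_
  have := norm_smul_le g⁻¹ (g • y)
  rwa [inv_smul_smul] at this

end SGrp

lemma card_NE (k : ℕ) : Fintype.card (NE k) = 2 ^ k - 1 := by
  rw [Fintype.card_subtype]
  have : (Finset.univ.filter fun A : Finset (Fin k) => A.Nonempty) = Finset.univ.erase ∅ := by
    ext A; simp [Finset.nonempty_iff_ne_empty]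
  rw [this, Finset.card_erase_of_mem (Finset.mem_univ _)]
  simp

lemma finrank_TE (j k : ℕ) : Module.finrank ℝ (TE j k) = j * (2 ^ k - 1) + k := by
  rw [Module.finrank_prod, Module.finrank_fintype_fun_eq_card, Module.finrank_fintype_fun_eq_card,
    Fintype.card_prod, card_NE]
  simp

lemma card_Ix {j k : ℕ} {c : Fin k → ℕ} (hsum : (∑ t, c t) = j * (2 ^ k - 1)) :
    Fintype.card (Ix k c) = j * (2 ^ k - 1) + k := by
  rw [Fintype.card_sigma]
  simp [Finset.sum_add_distrib, hsum]

/-- equiparting matrices -/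
abbrev EMx (j k : ℕ) (c : Fin k → ℕ) := {G : Fin j → Fin (2 ^ k) → Fin k → Bool // IsEquipartingMatrix j k c G}

section mats
variable {j k : ℕ} {c : Fin k → ℕ}

/-- action on columns -/
def cact (g : SGrp k c) (u : Fin k → Bool) : Fin k → Bool := fun t => xor (g.β t) (u (g.τ t))

lemma cact_one (u : Fin k → Bool) : cact (1 : SGrp k c) u = u := by
  funext t; simp [cact, SGrp.one_β, SGrp.one_τ]

lemma cact_mul (a b : SGrp k c) (u : Fin k → Bool) : cact (a * b) u = cact a (cact b u) := by
  funext t; simp [cact, SGrp.mul_β, SGrp.mul_τ]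

lemma cact_bij (g : SGrp k c) : Function.Bijective (cact g) := by
  refine Function.bijective_iff_has_inverse.mpr ⟨cact g⁻¹, fun u => ?_, fun u => ?_⟩
  · rw [← cact_mul, inv_mul_cancel, cact_one]
  · rw [← cact_mul, mul_inv_cancel, cact_one]

lemma cact_ne (g : SGrp k c) (u v : Fin k → Bool) (t) :
    cact g u t ≠ cact g v t ↔ u (g.τ t) ≠ v (g.τ t) := by
  simp [cact]

lemma em_smul (g : SGrp k c) {G : Fin j → Fin (2 ^ k) → Fin k → Bool} (hG : IsEquipartingMatrix j k c G) :
    IsEquipartingMatrix j k c (fun i m => cact g (G i m)) := by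
  obtain ⟨h1, h2, h3⟩ := hG
  refine ⟨fun i => ⟨(cact_bij g).comp (h1 i).1, fun m => ?_⟩, fun i h => ?_, fun t => ?_⟩
  · obtain ⟨t, ht, hu⟩ := (h1 i).2 m
    refine ⟨g.τ.symm t, ?_, ?_⟩
    · simp only [cact_ne, Equiv.apply_symm_apply]; exact ht
    · intro t' ht'
      simp only [cact_ne] at ht'
      rw [Equiv.eq_symm_apply]
      exact hu _ ht'
  · dsimp only; rw [h2 i h]
  · rw [← g.h t, ← h3]
    refine Finset.sum_congr rfl fun i _ => ?_
    simp only [grayTransCount, cact_ne]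

instance : MulAction (SGrp k c) (EMx j k c) where
  smul g G := ⟨fun i m => cact g (G.1 i m), em_smul g G.2⟩
  one_smul G := by
    refine Subtype.ext ?_
    funext i m
    exact cact_one _
  mul_smul a b G := by
    refine Subtype.ext ?_
    funext i m
    exact cact_mul _ _ _

lemma em_free (hj : 1 ≤ j) (g : SGrp k c) (G : EMx j k c) (h : g • G = G) : g = 1 := by
  have h' : ∀ m, cact g (G.1 ⟨0, hj⟩ m) = G.1 ⟨0, hj⟩ m := fun m =>
    congrFun (congrFun (congrArg Subtype.val h) ⟨0, hj⟩) m
  have h2 : ∀ u, cact g u = u := by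
    intro u
    obtain ⟨m, rfl⟩ := ((G.2.1 ⟨0, hj⟩).1).2 u
    exact h' m
  have hβ : ∀ t, g.β t = false := by
    intro t
    have := congrFun (h2 fun _ => false) t
    simpa [cact] using this
  have hτ : ∀ t, g.τ t = t := by
    intro t
    have := congrFun (h2 fun s => decide (s = t)) t
    simpa [cact, hβ] using this
  refine SGrp.ext (funext hβ) (Equiv.ext hτ)

lemma card_em (hj : 1 ≤ j) : Nat.card (EMx j k c) = numEquivClasses j k c * Nat.card (SGrp k c) := by
  have h1 := card_free (G := SGrp k c) (X := EMx j k c) (fun g G h => em_free hj g G h)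
  rw [h1]
  congr 1
  unfold numEquivClasses
  refine Nat.card_congr (Quot.congrRight ?_).symm
  intro G G'
  constructor
  · rintro ⟨β, τ, h2, h3⟩
    have : (⟨β, τ, h2⟩ : SGrp k c) • G = G' := by
      refine Subtype.ext ?_
      funext i m t
      exact (h3 i m t).symm
    exact (MulAction.orbitRel (SGrp k c) (EMx j k c)).symm ⟨_, this⟩
  · intro h
    obtain ⟨g, hg⟩ := (MulAction.orbitRel (SGrp k c) (EMx j k c)).symm h
    refine ⟨g.β, g.τ, g.h, fun i m t => ?_⟩
    rw [← hg]
    rfl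

end mats

/-! ### Part 7: test maps -/

section test
variable {j k : ℕ} {c : Fin k → ℕ}

/-- a row of coordinates, extended by zero -/
def row (x : Ix k c → ℝ) (t : Fin k) (m : ℕ) : ℝ :=
  if h : m < c t + 1 then x ⟨t, ⟨m, h⟩⟩ else 0

/-- real version of the action -/
def gact (g : SGrp k c) (x : Ix k c → ℝ) : Ix k c → ℝ := fun i => (sg (g.β i.1) : ℝ) * x (g.px i)

lemma row_gact (g : SGrp k c) (x : Ix k c → ℝ) (t : Fin k) :
    row (gact g x) t = fun m => (sg (g.β t) : ℝ) * row x (g.τ t) m := by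
  funext m
  unfold row
  by_cases h : m < c t + 1
  · rw [dif_pos h, dif_pos (by rw [g.h]; exact h)]; rfl
  · rw [dif_neg h, dif_neg (by rw [g.h]; exact h), mul_zero]

lemma continuous_row (t : Fin k) (m : ℕ) : Continuous fun x : Ix k c → ℝ => row x t m := by
  unfold row
  by_cases h : m < c t + 1
  · simp only [dif_pos h]; fun_prop
  · simp only [dif_neg h]; fun_prop

/-- l1 norm of a row -/
def rnorm (x : Ix k c → ℝ) (t : Fin k) : ℝ := ∑ m : Fin (c t + 1), |x ⟨t, m⟩|

lemma rnorm_row (x : Ix k c → ℝ) (t : Fin k) : rnorm x t = ∑ m ∈ Finset.range (c t + 1), |row x t m| := by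
  rw [← Fin.sum_univ_eq_sum_range (fun m => |row x t m|)]
  refine Finset.sum_congr rfl fun m _ => ?_
  rw [row, dif_pos m.isLt]

lemma rnorm_gact (g : SGrp k c) (x : Ix k c → ℝ) (t : Fin k) : rnorm (gact g x) t = rnorm x (g.τ t) := by
  rw [rnorm_row, rnorm_row, row_gact, g.h]
  refine Finset.sum_congr rfl fun m _ => ?_
  rw [abs_mul]
  rcases sg_or (g.β t) with h | h <;> rw [h] <;> simp

lemma continuous_rnorm (t : Fin k) : Continuous fun x : Ix k c → ℝ => rnorm x t := by
  unfold rnorm; fun_prop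

/-- the compact domain -/
def KK (k : ℕ) (c : Fin k → ℕ) (Y ρ : ℝ) : Set (Ix k c → ℝ) := {x | ∀ t, |rnorm x t - Y| ≤ ρ}

lemma isCompact_KK (Y ρ : ℝ) : IsCompact (KK k c Y ρ) := by
  refine Metric.isCompact_of_isClosed_isBounded ?_ ?_
  · have : KK k c Y ρ = ⋂ t, {x | |rnorm x t - Y| ≤ ρ} := by ext x; simp [KK]
    rw [this]
    refine isClosed_iInter fun t => ?_
    have := continuous_rnorm (c := c) t
    exact isClosed_le (by fun_prop) continuous_const
  · refine (Metric.isBounded_closedBall (x := (0 : Ix k c → ℝ)) (r := |Y| + |ρ|)).subset ?_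
    intro x hx
    rw [mem_closedBall_zero_iff, pi_norm_le_iff_of_nonneg (by positivity)]
    rintro ⟨t, m⟩
    have h1 : |x ⟨t, m⟩| ≤ rnorm x t :=
      Finset.single_le_sum (f := fun m => |x ⟨t, m⟩|) (fun _ _ => abs_nonneg _) (Finset.mem_univ m)
    have h2 := abs_le.mp (hx t)
    have h3 := le_abs_self Y
    have h4 := le_abs_self ρ
    rw [Real.norm_eq_abs]; linarith [h2.2]

variable {Ω : Type*} [MeasurableSpace Ω]

/-- component of the test map -/
noncomputable def tF (S : (ℕ → ℝ) → Ω → ℝ) (ν : Fin j → Measure Ω) (x : Ix k c → ℝ) (i : Fin j) (A : Finset (Fin k)) : ℝ :=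
  ∫ p, ∏ t ∈ A, S (row x t) p ∂(ν i)

/-- the test map -/
noncomputable def tPhi (S : (ℕ → ℝ) → Ω → ℝ) (ν : Fin j → Measure Ω) (Y : ℝ) (x : Ix k c → ℝ) : TE j k :=
  (fun q => tF S ν x q.1 q.2.1, fun t => rnorm x t - Y)

/-- admissible kernels -/
structure KerOK (S : (ℕ → ℝ) → Ω → ℝ) (ν : Fin j → Measure Ω) (K : Set (Ix k c → ℝ)) : Prop where
  fin : ∀ i, IsFiniteMeasure (ν i)
  odd : ∀ r p, S (fun m => - r m) p = - S r p
  bdd : ∀ r p, |S r p| ≤ 1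
  meas : ∀ r, Measurable (S r)
  sq : ∀ x ∈ K, ∀ t i, ∀ᵐ p ∂(ν i), S (row x t) p * S (row x t) p = 1
  cont : ∀ x ∈ K, ∀ t i, ∀ᵐ p ∂(ν i), ContinuousWithinAt (fun x' => S (row x' t) p) K x

namespace KerOK
variable {S : (ℕ → ℝ) → Ω → ℝ} {ν : Fin j → Measure Ω} {K : Set (Ix k c → ℝ)}

lemma prod_bdd (h : KerOK S ν K) (x : Ix k c → ℝ) (A : Finset (Fin k)) (p : Ω) :
    ‖∏ t ∈ A, S (row x t) p‖ ≤ 1 := by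
  rw [norm_prod]
  exact Finset.prod_le_one (fun _ _ => norm_nonneg _) (fun t _ => h.bdd _ _)

lemma prod_meas (h : KerOK S ν K) (x : Ix k c → ℝ) (A : Finset (Fin k)) :
    Measurable fun p => ∏ t ∈ A, S (row x t) p :=
  Finset.measurable_prod _ fun t _ => h.meas _

lemma integrable (h : KerOK S ν K) (x : Ix k c → ℝ) (A : Finset (Fin k)) (i : Fin j) :
    Integrable (fun p => ∏ t ∈ A, S (row x t) p) (ν i) := by
  have := h.fin i
  exact Integrable.of_bound (h.prod_meas x A).aestronglyMeasurable 1 (Filter.Eventually.of_forall (h.prod_bdd x A))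

lemma tF_cont (h : KerOK S ν K) (i : Fin j) (A : Finset (Fin k)) :
    ContinuousOn (fun x => tF S ν x i A) K := by
  intro x hx
  have := h.fin i
  refine continuousWithinAt_of_dominated (bound := fun _ => 1) ?_ ?_ (integrable_const _) ?_
  · exact Filter.Eventually.of_forall fun x => (h.prod_meas x A).aestronglyMeasurable
  · exact Filter.Eventually.of_forall fun x => Filter.Eventually.of_forall (h.prod_bdd x A)
  · have h1 : ∀ᵐ p ∂(ν i), ∀ t, ContinuousWithinAt (fun x' => S (row x' t) p) K x :=
      (ae_all_iff).mpr fun t => h.cont x hx t i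
    filter_upwards [h1] with p hp
    exact tendsto_finsetProd A fun t _ => hp t

lemma tPhi_cont (h : KerOK S ν K) (Y : ℝ) : ContinuousOn (tPhi S ν Y) K := by
  refine ContinuousOn.prodMk ?_ ?_
  · exact continuousOn_pi.mpr fun q => h.tF_cont _ _
  · refine continuousOn_pi.mpr fun t => ?_
    exact ((continuous_rnorm t).sub continuous_const).continuousOn

lemma sg_smul (h : KerOK S ν K) (b : Bool) (r : ℕ → ℝ) (p : Ω) :
    S (fun m => (sg b : ℝ) * r m) p = sg b * S r p := by
  cases b
  · simp [sg]
  · simp [sg, h.odd]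

lemma tPhi_gact (h : KerOK S ν K) (Y : ℝ) (g : SGrp k c) (x : Ix k c → ℝ) :
    tPhi S ν Y (gact g x) = g • tPhi S ν Y x := by
  refine Prod.ext ?_ ?_
  · funext q
    rw [SGrp.smul_fst]
    simp only [tPhi, tF, row_gact, h.sg_smul, Finset.prod_mul_distrib, SGrp.ne, Finset.prod_map]
    rw [integral_const_mul]
    rfl
  · funext t
    rw [SGrp.smul_snd]
    simp only [tPhi, rnorm_gact]

lemma pair (h : KerOK S ν K) {x : Ix k c → ℝ} (hx : x ∈ K) {t s : Fin k} (hts : t ≠ s) {b : Bool}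
    (hr : row x t = fun m => (sg b : ℝ) * row x s m) (i : Fin j) :
    tF S ν x i {t, s} = sg b * (ν i).real Set.univ := by
  have h1 := h.sq x hx s i
  unfold tF
  have : ∫ p, ∏ t ∈ ({t, s} : Finset (Fin k)), S (row x t) p ∂(ν i) = ∫ p, (sg b : ℝ) ∂(ν i) := by
    refine integral_congr_ae ?_
    filter_upwards [h1] with p hp
    rw [Finset.prod_pair hts, hr, h.sg_smul, mul_assoc, hp, mul_one]
  rw [this, integral_const, smul_eq_mul, mul_comm]

end KerOK

lemma row_ne_zero {x : Ix k c → ℝ} {t : Fin k} (h : 0 < rnorm x t) : ∃ m < c t + 1, row x t m ≠ 0 := by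
  by_contra hcon
  push Not at hcon
  rw [rnorm_row, Finset.sum_eq_zero] at h
  · exact lt_irrefl _ h
  · intro m hm
    rw [hcon m (by simpa using hm), abs_zero]

lemma nonfree {x : Ix k c → ℝ} (hx : ∀ t, 0 < rnorm x t) {g : SGrp k c} (hg : g ≠ 1) (h : gact g x = x) :
    ∃ t s : Fin k, t ≠ s ∧ ∃ b, row x t = fun m => (sg b : ℝ) * row x s m := by
  by_cases hτ : ∃ t, g.τ t ≠ t
  · obtain ⟨t, ht⟩ := hτ
    refine ⟨t, g.τ t, ht.symm, g.β t, ?_⟩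
    rw [← row_gact, h]
  · push Not at hτ
    exfalso
    apply hg
    refine SGrp.ext (funext fun t => ?_) (Equiv.ext hτ)
    rw [SGrp.one_β]
    by_contra hb
    have hb' : g.β t = true := by simpa using hb
    obtain ⟨m, _, hm⟩ := row_ne_zero (hx t)
    have h1 := congrFun (row_gact g x t) m
    rw [h, hτ, hb'] at h1
    simp [sg] at h1
    apply hm; linarith

/-! kernel 1 : half spaces -/

/-- affine map with given coefficients -/
noncomputable def afm (d : ℕ) (r : ℕ → ℝ) : (Fin d → ℝ) →ᵃ[ℝ] ℝ :=
  (∑ m : Fin d, r (m.val + 1) • (LinearMap.proj m : (Fin d → ℝ) →ₗ[ℝ] ℝ)).toAffineMap + AffineMap.const ℝ _ (r 0)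

lemma afm_apply (d : ℕ) (r : ℕ → ℝ) (p : Fin d → ℝ) :
    afm d r p = ∑ m : Fin d, r (m.val + 1) * p m + r 0 := by
  simp [afm, LinearMap.sum_apply]

lemma afm_linear (d : ℕ) (r : ℕ → ℝ) (h : (afm d r).linear = 0) (m : ℕ) (hm : m < d) : r (m + 1) = 0 := by
  have h1 := (afm d r).linearMap_vsub (Pi.single ⟨m, hm⟩ 1) 0
  rw [h] at h1
  simp only [LinearMap.zero_apply, vsub_eq_sub, afm_apply] at h1
  simp [Pi.single_apply] at h1
  exact h1.symm

/-- kernel 1 -/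
noncomputable def ker1 (d : ℕ) (r : ℕ → ℝ) (p : Fin d → ℝ) : ℝ := SignType.sign (afm d r p)

lemma abs_sign_le (a : ℝ) : |((SignType.sign a : SignType) : ℝ)| ≤ 1 := by
  rcases lt_trichotomy a 0 with h | h | h
  · simp [sign_neg h]
  · simp [h]
  · simp [sign_pos h]

lemma sign_sq {a : ℝ} (h : a ≠ 0) : ((SignType.sign a : SignType) : ℝ) * ((SignType.sign a : SignType) : ℝ) = 1 := by
  rcases lt_or_gt_of_ne h with h | h
  · simp [sign_neg h]
  · simp [sign_pos h]

lemma measurable_signr : Measurable fun a : ℝ => ((SignType.sign a : SignType) : ℝ) := by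
  have : (fun a : ℝ => ((SignType.sign a : SignType) : ℝ)) = fun a => if 0 < a then 1 else if a < 0 then -1 else 0 := by
    funext a
    rcases lt_trichotomy a 0 with h | h | h
    · simp [sign_neg h, h, h.le]
    · simp [h]
    · simp [sign_pos h, h]
  rw [this]
  exact Measurable.ite measurableSet_Ioi measurable_const (Measurable.ite measurableSet_Iio measurable_const measurable_const)

lemma sign_cont {a : ℝ} (h : a ≠ 0) : ContinuousAt (fun a : ℝ => ((SignType.sign a : SignType) : ℝ)) a :=
  ContinuousAt.comp (g := fun s : SignType => (s : ℝ)) (continuous_of_discreteTopology).continuousAt (continuousAt_sign_of_ne_zero h)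

lemma afm_ne {d : ℕ} (hd : ∀ t, c t ≤ d) {μ : Measure (Fin d → ℝ)} (hμ : IsMass μ) {x : Ix k c → ℝ} {t : Fin k}
    (hx : 0 < rnorm x t) : ∀ᵐ p ∂μ, afm d (row x t) p ≠ 0 := by
  by_cases h : (afm d (row x t)).linear = 0
  · have h1 := afm_linear d _ h
    obtain ⟨m, hm, hm'⟩ := row_ne_zero hx
    have h2 : row x t 0 ≠ 0 := by
      rcases Nat.eq_zero_or_pos m with rfl | hpos
      · exact hm'
      · obtain ⟨n, rfl⟩ : ∃ n, m = n + 1 := ⟨m - 1, by omega⟩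
        have := hd t
        exact absurd (h1 n (by omega)) hm'
    refine Filter.Eventually.of_forall fun p => ?_
    rw [afm_apply, Finset.sum_eq_zero (fun m _ => by rw [h1 m.val m.isLt, zero_mul]), zero_add]
    exact h2
  · have := hμ.2 _ h
    rw [ae_iff]
    simpa using this

lemma ker1_ok {d : ℕ} (hd : ∀ t, c t ≤ d) {μ : Fin j → Measure (Fin d → ℝ)} (hμ : ∀ i, IsMass (μ i))
    {K : Set (Ix k c → ℝ)} (hK : ∀ x ∈ K, ∀ t, 0 < rnorm x t) : KerOK (ker1 d) μ K where
  fin i := (hμ i).1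
  odd r p := by
    have : afm d (fun m => - r m) p = - afm d r p := by
      simp only [afm_apply, neg_mul, Finset.sum_neg_distrib]; ring
    rw [ker1, ker1, this, Left.sign_neg, SignType.coe_neg]
  bdd r p := abs_sign_le _
  meas r := by
    refine measurable_signr.comp ?_
    have : (fun p => afm d r p) = fun p => ∑ m : Fin d, r (m.val + 1) * p m + r 0 := by
      funext p; exact afm_apply _ _ _
    change Measurable (fun p => afm d r p)
    rw [this]
    fun_prop
  sq x hx t i := by
    filter_upwards [afm_ne hd (hμ i) (hK x hx t)] with p hp
    exact sign_sq hp
  cont x hx t i := by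
    filter_upwards [afm_ne hd (hμ i) (hK x hx t)] with p hp
    refine ContinuousAt.continuousWithinAt ?_
    refine ContinuousAt.comp (f := fun x' : Ix k c → ℝ => afm d (row x' t) p) (sign_cont hp) ?_
    simp only [afm_apply]
    refine Continuous.continuousAt ?_
    refine Continuous.add (continuous_finsetSum _ fun m _ => ?_) (continuous_row _ _)
    exact (continuous_row _ _).mul continuous_const

lemma equiparts_of_zero {d : ℕ} (hd : ∀ t, c t ≤ d) {μ : Fin j → Measure (Fin d → ℝ)} (hμ : ∀ i, IsMass (μ i))
    {x : Ix k c → ℝ} (hx : ∀ t, 0 < rnorm x t) {i0 : Fin j} (hi0 : μ i0 ≠ 0)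
    (hz : ∀ i, ∀ A : Finset (Fin k), A.Nonempty → tF (ker1 d) μ x i A = 0) :
    ∃ f : Fin k → ((Fin d → ℝ) →ᵃ[ℝ] ℝ),
      (∀ t, (f t).linear ≠ 0) ∧ ∀ i, Equiparts f (μ i) := by
  have ok : KerOK (ker1 d) μ ({x} : Set (Ix k c → ℝ)) := ker1_ok hd hμ (by rintro _ rfl t; exact hx t)
  refine ⟨fun t => afm d (row x t), fun t ht => ?_, fun i ε => ?_⟩
  · have := (hμ i0).1
    have h1 := hz i0 {t} (by simp)
    have h2 := afm_linear d _ ht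
    have h3 : ∀ p, afm d (row x t) p = row x t 0 := by
      intro p
      rw [afm_apply, Finset.sum_eq_zero (fun m _ => by rw [h2 m.val m.isLt, zero_mul]), zero_add]
    have h4 := ok.sq x rfl t i0
    have hne : (ae (μ i0)).NeBot := ae_neBot.mpr hi0
    obtain ⟨p, hp⟩ := h4.exists
    simp only [tF, Finset.prod_singleton, ker1, h3, integral_const, smul_eq_mul] at h1
    simp only [ker1, h3] at hp
    rcases mul_eq_zero.mp h1 with h | h
    · rw [measureReal_eq_zero_iff] at h
      exact hi0 (Measure.measure_univ_eq_zero.mp h)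
    · rw [h] at hp; norm_num at hp
  · have hfin := (hμ i).1
    let O : Set (Fin d → ℝ) := {p | ∀ t, if ε t then 0 < afm d (row x t) p else afm d (row x t) p < 0}
    have hOm : MeasurableSet O := by
      have : O = ⋂ t, {p | if ε t then 0 < afm d (row x t) p else afm d (row x t) p < 0} := by
        ext p; simp [O]
      rw [this]
      refine MeasurableSet.iInter fun t => ?_
      have hc : Continuous fun p => afm d (row x t) p := (afm d (row x t)).continuous_of_finiteDimensional
      cases ε t
      · simpa using (isOpen_lt hc continuous_const).measurableSet
      · simpa using (isOpen_lt continuous_const hc).measurableSet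
    let σ : Fin k → ℝ := fun t => if ε t then 1 else -1
    have h1 : ∀ᵐ p ∂(μ i), O.indicator (fun _ => (2 : ℝ) ^ k) p = ∏ t, (1 + σ t * ker1 d (row x t) p) := by
      have : ∀ᵐ p ∂(μ i), ∀ t, afm d (row x t) p ≠ 0 := ae_all_iff.mpr fun t => afm_ne hd (hμ i) (hx t)
      filter_upwards [this] with p hp
      have h2 : ∀ t, 1 + σ t * ker1 d (row x t) p = if (if ε t then 0 < afm d (row x t) p else afm d (row x t) p < 0) then 2 else 0 := by
        intro t
        simp only [σ, ker1]
        rcases lt_or_gt_of_ne (hp t) with h | h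
        · rw [sign_neg h]
          cases ε t <;> simp [h, h.le] <;> norm_num
        · rw [sign_pos h]
          cases ε t <;> simp [h, h.le] <;> norm_num
      rw [Finset.prod_congr rfl fun t _ => h2 t]
      by_cases hpO : p ∈ O
      · rw [Set.indicator_of_mem hpO, Finset.prod_congr rfl fun t _ => if_pos (hpO t)]
        simp
      · rw [Set.indicator_of_notMem hpO]
        have : ∃ t, ¬ (if ε t then 0 < afm d (row x t) p else afm d (row x t) p < 0) := by
          by_contra hcon
          push Not at hcon
          exact hpO hcon
        obtain ⟨t, ht⟩ := this
        exact (Finset.prod_eq_zero (Finset.mem_univ t) (if_neg ht)).symm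
    have h2 := integral_congr_ae h1
    rw [integral_indicator_const _ hOm] at h2
    have h3 : ∀ p, ∏ t, (1 + σ t * ker1 d (row x t) p) =
        ∑ A : Finset (Fin k), (∏ t ∈ A, σ t) * ∏ t ∈ A, ker1 d (row x t) p := by
      intro p
      rw [Finset.prod_one_add]
      simp only [Finset.prod_mul_distrib, Finset.powerset_univ]
    simp only [h3] at h2
    rw [integral_finsetSum _ fun A _ => (ok.integrable x A i).const_mul _] at h2
    simp only [integral_const_mul] at h2
    rw [Finset.sum_eq_single ∅] at h2
    · simp only [Finset.prod_empty, one_mul, integral_const, smul_eq_mul, mul_one] at h2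
      change μ i O = _
      have h4 : (μ i).real O = (μ i).real Set.univ / 2 ^ k := by
        rw [eq_div_iff (by positivity)]; exact h2
      have h5 := (ENNReal.ofReal_toReal (measure_ne_top (μ i) O)).symm
      rw [h5]
      change ENNReal.ofReal ((μ i).real O) = _
      rw [h4, ENNReal.ofReal_div_of_pos (by positivity), measureReal_def, ENNReal.ofReal_toReal (measure_ne_top _ _),
        ENNReal.ofReal_pow (by norm_num)]
      norm_num
    · intro A _ hA
      have := hz i A (Finset.nonempty_iff_ne_empty.mpr hA)
      unfold tF at this
      rw [this, mul_zero]
    · intro h; exact absurd (Finset.mem_univ _) h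

end test

/-! ### Part 8: kernel 0 -/

/-- cut heights -/
noncomputable def yy (n : ℕ) : ℝ := 4 ^ n - 1

lemma yy_zero : yy 0 = 0 := by simp [yy]
lemma yy_succ (n : ℕ) : yy n + 3 ≤ yy (n + 1) := by
  have : (1 : ℝ) ≤ 4 ^ n := one_le_pow₀ (by norm_num)
  simp only [yy, pow_succ]; linarith
lemma yy_lt {a b : ℕ} (h : a < b) : yy a + 3 ≤ yy b := by
  induction b, h using Nat.le_induction with
  | base => exact yy_succ a
  | succ b _ ih => linarith [yy_succ b]
lemma yy_mono {a b : ℕ} (h : a ≤ b) : yy a ≤ yy b := by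
  rcases h.lt_or_eq with h | rfl
  · linarith [yy_lt h]
  · exact le_rfl

/-- a unit ramp -/
noncomputable def rmp (h y : ℝ) : ℝ := max 0 (min h y)

lemma rmp_mono (h : ℝ) : Monotone (rmp h) := fun a b hab => by
  unfold rmp; gcongr
lemma rmp_cont (h : ℝ) : Continuous (rmp h) := by unfold rmp; fun_prop
lemma rmp_lo {h y : ℝ} (hy : y ≤ 0) : rmp h y = 0 := by
  unfold rmp; exact max_eq_left ((min_le_right _ _).trans hy)
lemma rmp_hi {h y : ℝ} (hh : 0 ≤ h) (hy : h ≤ y) : rmp h y = h := by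
  unfold rmp; rw [min_eq_left hy, max_eq_right hh]
lemma rmp_mid {h y : ℝ} (h0 : 0 ≤ y) (hy : y ≤ h) : rmp h y = y := by
  unfold rmp; rw [min_eq_right hy, max_eq_right h0]

/-- height to position -/
noncomputable def th (B : ℕ) (y : ℝ) : ℝ :=
  rmp (1 / 2) y + ∑ n ∈ Finset.Ico 1 B, rmp 1 (y - yy n + 1 / 2) + rmp (1 / 2) (y - yy B + 1)

lemma th_mono (B : ℕ) : Monotone (th B) := fun a b hab => by
  unfold th
  refine add_le_add (add_le_add (rmp_mono _ hab) (Finset.sum_le_sum fun n _ => rmp_mono _ (by linarith)))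
    (rmp_mono _ (by linarith))

lemma th_cont (B : ℕ) : Continuous (th B) := by
  unfold th
  refine ((rmp_cont _).add (continuous_finsetSum _ fun n _ => (rmp_cont _).comp (by fun_prop))).add
    ((rmp_cont _).comp (by fun_prop))

lemma th_zero {B : ℕ} (hB : 1 ≤ B) : th B 0 = 0 := by
  have h1 := yy_lt (a := 0) (b := B) (by omega)
  rw [yy_zero] at h1
  unfold th
  rw [rmp_lo le_rfl, rmp_lo (by linarith), Finset.sum_eq_zero]
  · simp
  · intro n hn
    rw [Finset.mem_Ico] at hn
    have h1 := yy_lt (a := 0) (b := n) (by omega)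
    rw [yy_zero] at h1
    exact rmp_lo (by linarith)

lemma th_top {B : ℕ} (hB : 1 ≤ B) {y : ℝ} (hy : yy B ≤ y) : th B y = B := by
  have h1 := yy_lt (a := 0) (b := B) (by omega)
  rw [yy_zero] at h1
  unfold th
  rw [rmp_hi (by norm_num) (by linarith), rmp_hi (by norm_num) (by linarith),
    Finset.sum_congr rfl (g := fun _ => (1 : ℝ))]
  · simp only [Finset.sum_const, Nat.card_Ico, nsmul_eq_mul, mul_one]
    rw [Nat.cast_sub hB]; push_cast; ring
  · intro n hn
    rw [Finset.mem_Ico] at hn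
    have h1 := yy_lt (a := n) (b := B) (by omega)
    exact rmp_hi (by norm_num) (by linarith)

lemma th_nonneg {B : ℕ} (hB : 1 ≤ B) {y : ℝ} (hy : 0 ≤ y) : 0 ≤ th B y := by
  rw [← th_zero hB]; exact th_mono B hy

lemma th_le {B : ℕ} (hB : 1 ≤ B) (y : ℝ) : th B y ≤ B := by
  rw [← th_top hB (le_max_right y (yy B))]
  exact th_mono B (le_max_left _ _)

lemma th_loc {B n : ℕ} (hn : 1 ≤ n) (hnB : n < B) {y : ℝ} (hy : |y - yy n| ≤ 1 / 2) :
    th B y = n + (y - yy n) := by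
  rw [abs_le] at hy
  have h1 := yy_lt (a := 0) (b := n) (by omega)
  rw [yy_zero] at h1
  have h2 := yy_lt hnB
  unfold th
  rw [rmp_hi (by norm_num) (by linarith), rmp_lo (y := y - yy B + 1) (by linarith),
    ← Finset.sum_Ico_consecutive _ hn hnB.le, Finset.sum_eq_sum_Ico_succ_bot hnB,
    Finset.sum_congr rfl (g := fun _ => (1 : ℝ)), Finset.sum_eq_zero (s := Finset.Ico (n + 1) B),
    rmp_mid (by linarith) (by linarith)]
  · simp only [Finset.sum_const, Nat.card_Ico, nsmul_eq_mul, mul_one]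
    rw [Nat.cast_sub hn]; push_cast; ring
  · intro m hm
    rw [Finset.mem_Ico] at hm
    have := yy_lt (a := n) (b := m) (by omega)
    exact rmp_lo (by linarith)
  · intro m hm
    rw [Finset.mem_Ico] at hm
    have := yy_lt (a := m) (b := n) (by omega)
    exact rmp_hi (by norm_num) (by linarith)

lemma th_inv {B n : ℕ} (hn : 1 ≤ n) (hnB : n < B) {y : ℝ} (hy : th B y = n) : y = yy n := by
  rcases lt_trichotomy y (yy n) with h | h | h
  · exfalso
    have h1 : th B (max y (yy n - 1 / 2)) = n + (max y (yy n - 1 / 2) - yy n) := th_loc hn hnB (by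
      rw [abs_le]; constructor
      · linarith [le_max_right y (yy n - 1 / 2)]
      · have : max y (yy n - 1 / 2) ≤ yy n := max_le h.le (by linarith)
        linarith)
    have h2 := th_mono B (le_max_left y (yy n - 1 / 2))
    have h3 : max y (yy n - 1 / 2) < yy n := max_lt h (by linarith)
    linarith
  · exact h
  · exfalso
    have h1 : th B (min y (yy n + 1 / 2)) = n + (min y (yy n + 1 / 2) - yy n) := th_loc hn hnB (by
      rw [abs_le]; constructor
      · have : yy n ≤ min y (yy n + 1 / 2) := le_min h.le (by linarith)
        linarith
      · linarith [min_le_right y (yy n + 1 / 2)])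
    have h2 := th_mono B (min_le_left y (yy n + 1 / 2))
    have h3 : yy n < min y (yy n + 1 / 2) := lt_min h (by linarith)
    linarith

/-- partial sums of absolute values -/
noncomputable def bb (r : ℕ → ℝ) (m : ℕ) : ℝ := ∑ l ∈ Finset.range m, |r l|

lemma bb_zero (r : ℕ → ℝ) : bb r 0 = 0 := by simp [bb]
lemma bb_succ (r : ℕ → ℝ) (m : ℕ) : bb r (m + 1) = bb r m + |r m| := by simp [bb, Finset.sum_range_succ]
lemma bb_mono (r : ℕ → ℝ) : Monotone (bb r) :=
  monotone_nat_of_le_succ fun m => by rw [bb_succ]; linarith [abs_nonneg (r m)]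
lemma bb_nonneg (r : ℕ → ℝ) (m : ℕ) : 0 ≤ bb r m := by rw [← bb_zero r]; exact bb_mono r (Nat.zero_le m)

/-- cut position -/
noncomputable def cp (B : ℕ) (r : ℕ → ℝ) (m : ℕ) : ℝ := th B (bb r m)

lemma cp_mono (B : ℕ) (r : ℕ → ℝ) : Monotone (cp B r) := fun _ _ h => th_mono B (bb_mono r h)
lemma cp_zero {B : ℕ} (hB : 1 ≤ B) (r : ℕ → ℝ) : cp B r 0 = 0 := by rw [cp, bb_zero, th_zero hB]
lemma cp_ne {B : ℕ} {r : ℕ → ℝ} {m : ℕ} (h : cp B r m < cp B r (m + 1)) : r m ≠ 0 := by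
  intro h0
  rw [cp, cp, bb_succ, h0, abs_zero, add_zero] at h
  exact lt_irrefl _ h

/-- kernel 0 -/
noncomputable def ker0 (B D : ℕ) (r : ℕ → ℝ) (u : ℝ) : ℝ :=
  ∑ m ∈ Finset.range (D + 1), (SignType.sign (r m) : ℝ) * if cp B r m ≤ u ∧ u < cp B r (m + 1) then 1 else 0

lemma ker0_eq {B D : ℕ} {r : ℕ → ℝ} {u : ℝ} {m : ℕ} (hm : m ≤ D) (h1 : cp B r m ≤ u) (h2 : u < cp B r (m + 1)) :
    ker0 B D r u = (SignType.sign (r m) : ℝ) := by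
  unfold ker0
  rw [Finset.sum_eq_single m]
  · rw [if_pos ⟨h1, h2⟩, mul_one]
  · intro n _ hn
    rw [if_neg, mul_zero]
    rintro ⟨h3, h4⟩
    rcases lt_or_gt_of_ne hn with h | h
    · have := cp_mono B r (show n + 1 ≤ m by omega)
      linarith
    · have := cp_mono B r (show m + 1 ≤ n by omega)
      linarith
  · intro h; simp at h; omega

lemma exists_cell {B : ℕ} (hB : 1 ≤ B) {r : ℕ → ℝ} {u : ℝ} {n : ℕ} (h0 : 0 ≤ u) (h1 : u < cp B r (n + 1)) :
    ∃ m ≤ n, cp B r m ≤ u ∧ u < cp B r (m + 1) := by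
  classical
  have hex : ∃ m, u < cp B r (m + 1) := ⟨n, h1⟩
  refine ⟨Nat.find hex, Nat.find_min' hex h1, ?_, Nat.find_spec hex⟩
  rcases Nat.eq_zero_or_pos (Nat.find hex) with h | h
  · rw [h, cp_zero hB]; exact h0
  · have := Nat.find_min hex (show Nat.find hex - 1 < Nat.find hex by omega)
    rw [show Nat.find hex - 1 + 1 = Nat.find hex by omega] at this
    exact not_lt.mp this

section k0
variable {j k : ℕ} {c : Fin k → ℕ}

/-- the reference measures -/
noncomputable def nu0 (j T : ℕ) (i : Fin j) : Measure ℝ :=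
  volume.restrict (Set.Ico ((i.val : ℝ) * T) ((i.val + 1) * T))

lemma bb_rnorm (x : Ix k c → ℝ) (t : Fin k) : bb (row x t) (c t + 1) = rnorm x t := (rnorm_row x t).symm

lemma cp_top {B : ℕ} (hB : 1 ≤ B) {x : Ix k c → ℝ} {t : Fin k} (h : yy B ≤ rnorm x t) :
    cp B (row x t) (c t + 1) = B := by rw [cp, bb_rnorm, th_top hB h]

lemma cell_of {B : ℕ} (hB : 1 ≤ B) {x : Ix k c → ℝ} {t : Fin k} (h : yy B ≤ rnorm x t) {u : ℝ}
    (h0 : 0 ≤ u) (h1 : u < B) {D : ℕ} (hD : c t ≤ D) :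
    ∃ m ≤ c t, cp B (row x t) m ≤ u ∧ u < cp B (row x t) (m + 1) ∧ row x t m ≠ 0 ∧
      ker0 B D (row x t) u = (SignType.sign (row x t m) : ℝ) := by
  obtain ⟨m, hm, h2, h3⟩ := exists_cell hB (n := c t) h0 (by rw [cp_top hB h]; exact h1)
  exact ⟨m, hm, h2, h3, cp_ne (lt_of_le_of_lt h2 h3), ker0_eq (hm.trans hD) h2 h3⟩

lemma cp_row_cont (B : ℕ) (t : Fin k) (m : ℕ) : Continuous fun x : Ix k c → ℝ => cp B (row x t) m := by
  refine (th_cont B).comp ?_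
  unfold bb
  refine continuous_finsetSum _ fun l _ => (continuous_row t l).abs

lemma ker0_ok {T : ℕ} (hB : 1 ≤ j * T) {D : ℕ} (hD : ∀ t, c t ≤ D)
    {K : Set (Ix k c → ℝ)} (hK : ∀ x ∈ K, ∀ t, yy (j * T) ≤ rnorm x t) :
    KerOK (ker0 (j * T) D) (nu0 j T) K where
  fin i := by unfold nu0; infer_instance
  odd r p := by
    have hb : ∀ m, bb (fun m => - r m) m = bb r m := fun m => by simp [bb]
    unfold ker0 cp
    rw [← Finset.sum_neg_distrib]
    refine Finset.sum_congr rfl fun m _ => ?_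
    rw [hb, hb, Left.sign_neg, SignType.coe_neg, neg_mul]
  bdd r p := by
    by_cases h : ∃ m ≤ D, cp (j * T) r m ≤ p ∧ p < cp (j * T) r (m + 1)
    · obtain ⟨m, hm, h1, h2⟩ := h
      rw [ker0_eq hm h1 h2]; exact abs_sign_le _
    · push Not at h
      unfold ker0
      rw [Finset.sum_eq_zero]
      · simp
      · intro m hm
        rw [if_neg, mul_zero]
        rintro ⟨h1, h2⟩
        exact absurd h2 (not_lt.mpr (h m (by simp at hm; omega) h1))
  meas r := by
    unfold ker0
    refine Finset.measurable_sum _ fun m _ => Measurable.const_mul ?_ _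
    exact Measurable.ite (measurableSet_Ico (a := cp (j * T) r m) (b := cp (j * T) r (m + 1))) measurable_const measurable_const
  sq x hx t i := by
    unfold nu0
    rw [ae_restrict_iff' measurableSet_Ico]
    refine Filter.Eventually.of_forall fun u hu => ?_
    have h0 : (0 : ℝ) ≤ u := le_trans (by positivity) hu.1
    have h1 : u < ((j * T : ℕ) : ℝ) := by
      refine lt_of_lt_of_le hu.2 ?_
      push_cast
      have : (i.val : ℝ) + 1 ≤ j := by exact_mod_cast i.isLt
      gcongr
    obtain ⟨m, _, _, _, h4, h5⟩ := cell_of hB (hK x hx t) h0 h1 (hD t)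
    rw [h5]; exact sign_sq h4
  cont x hx t i := by
    have hnull : ∀ᵐ u ∂(nu0 j T i), ∀ m : ℕ, u ≠ cp (j * T) (row x t) m := by
      rw [ae_all_iff]
      intro m
      refine ae_restrict_of_ae ?_
      rw [ae_iff]
      simp
    filter_upwards [hnull] with u hu
    refine ContinuousAt.continuousWithinAt ?_
    unfold ker0
    refine tendsto_finsetSum _ fun m _ => ?_
    change ContinuousAt (fun x' : Ix k c → ℝ => (SignType.sign (row x' t m) : ℝ) *
      if cp (j * T) (row x' t) m ≤ u ∧ u < cp (j * T) (row x' t) (m + 1) then 1 else 0) x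
    have c1 := (cp_row_cont (c := c) (j * T) t m).continuousAt (x := x)
    have c2 := (cp_row_cont (c := c) (j * T) t (m + 1)).continuousAt (x := x)
    by_cases ha : u < cp (j * T) (row x t) m
    · refine (continuousAt_const (y := (0 : ℝ))).congr ?_
      filter_upwards [c1.eventually (lt_mem_nhds ha)] with x' hx'
      rw [if_neg, mul_zero]
      rintro ⟨h1, _⟩; linarith
    · by_cases hb : cp (j * T) (row x t) (m + 1) < u
      · refine (continuousAt_const (y := (0 : ℝ))).congr ?_
        filter_upwards [c2.eventually (gt_mem_nhds hb)] with x' hx'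
        rw [if_neg, mul_zero]
        rintro ⟨_, h1⟩; linarith
      · have ha' : cp (j * T) (row x t) m < u := lt_of_le_of_ne (not_lt.mp ha) (hu m).symm
        have hb' : u < cp (j * T) (row x t) (m + 1) := lt_of_le_of_ne (not_lt.mp hb) (hu (m + 1))
        have hne := cp_ne (ha'.trans hb')
        have : ContinuousAt (fun x' : Ix k c → ℝ => (SignType.sign (row x' t m) : ℝ)) x :=
          ContinuousAt.comp (f := fun x' : Ix k c → ℝ => row x' t m) (sign_cont hne) (continuous_row t m).continuousAt
        refine this.congr ?_
        filter_upwards [c1.eventually (gt_mem_nhds ha'), c2.eventually (lt_mem_nhds hb')] with x' h1 h2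
        rw [if_pos ⟨h1.le, h2⟩, mul_one]

end k0

/-! ### Part 9: level sets -/

section lvl
variable {Ω : Type*} [MeasurableSpace Ω] {j k : ℕ} {c : Fin k → ℕ}

lemma level_measurable {S : (ℕ → ℝ) → Ω → ℝ} {ν : Fin j → Measure Ω} {K : Set (Ix k c → ℝ)} (ok : KerOK S ν K)
    (x : Ix k c → ℝ) (σ : Fin k → Bool) : MeasurableSet {p | ∀ t, S (row x t) p = sg (σ t)} := by
  have : {p | ∀ t, S (row x t) p = sg (σ t)} = ⋂ t, {p | S (row x t) p = sg (σ t)} := by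
    ext p; simp
  rw [this]
  exact MeasurableSet.iInter fun t => ok.meas _ (measurableSet_singleton _)

lemma level_meas {S : (ℕ → ℝ) → Ω → ℝ} {ν : Fin j → Measure Ω} {K : Set (Ix k c → ℝ)} (ok : KerOK S ν K)
    {x : Ix k c → ℝ} (hx : x ∈ K) (i : Fin j)
    (hz : ∀ A : Finset (Fin k), A.Nonempty → tF S ν x i A = 0) (σ : Fin k → Bool) :
    (ν i).real {p | ∀ t, S (row x t) p = sg (σ t)} = (ν i).real Set.univ / 2 ^ k := by
  have hfin := ok.fin i
  set O : Set Ω := {p | ∀ t, S (row x t) p = sg (σ t)} with hO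
  have hOm : MeasurableSet O := level_measurable ok x σ
  have h1 : ∀ᵐ p ∂(ν i), O.indicator (fun _ => (2 : ℝ) ^ k) p = ∏ t, (1 + (sg (σ t) : ℝ) * S (row x t) p) := by
    have : ∀ᵐ p ∂(ν i), ∀ t, S (row x t) p * S (row x t) p = 1 := ae_all_iff.mpr fun t => ok.sq x hx t i
    filter_upwards [this] with p hp
    have h2 : ∀ t, 1 + (sg (σ t) : ℝ) * S (row x t) p = if S (row x t) p = sg (σ t) then 2 else 0 := by
      intro t
      rcases mul_self_eq_one_iff.mp (hp t) with h | h <;> rw [h] <;>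
        rcases sg_or (σ t) with h' | h' <;> rw [h'] <;> norm_num
    rw [Finset.prod_congr rfl fun t _ => h2 t]
    by_cases hpO : p ∈ O
    · rw [Set.indicator_of_mem hpO, Finset.prod_congr rfl fun t _ => if_pos (hpO t)]
      simp
    · rw [Set.indicator_of_notMem hpO]
      have : ∃ t, ¬ S (row x t) p = sg (σ t) := by
        by_contra hcon
        push Not at hcon
        exact hpO hcon
      obtain ⟨t, ht⟩ := this
      exact (Finset.prod_eq_zero (Finset.mem_univ t) (if_neg ht)).symm
  have h2 := integral_congr_ae h1
  rw [integral_indicator_const _ hOm] at h2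
  have h3 : ∀ p, ∏ t, (1 + (sg (σ t) : ℝ) * S (row x t) p) =
      ∑ A : Finset (Fin k), (∏ t ∈ A, (sg (σ t) : ℝ)) * ∏ t ∈ A, S (row x t) p := by
    intro p
    rw [Finset.prod_one_add]
    simp only [Finset.prod_mul_distrib, Finset.powerset_univ]
  simp only [h3] at h2
  rw [integral_finsetSum _ fun A _ => (ok.integrable x A i).const_mul _] at h2
  simp only [integral_const_mul] at h2
  rw [Finset.sum_eq_single ∅] at h2
  · simp only [Finset.prod_empty, one_mul, integral_const, smul_eq_mul, mul_one] at h2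
    rw [eq_div_iff (by positivity)]; exact h2
  · intro A _ hA
    have := hz A (Finset.nonempty_iff_ne_empty.mpr hA)
    unfold tF at this
    rw [this, mul_zero]
  · intro h; exact absurd (Finset.mem_univ _) h

end lvl

lemma block_lemma {k : ℕ} {a b : ℝ} (P : Finset ℝ) (s : ℝ → Fin k → Bool)
    (E : (Fin k → Bool) → Set ℝ) (hP : ∀ p ∈ P, a < p ∧ p < b)
    (hs : ∀ u u', a ≤ u → u ≤ u' → u' < b → (∀ p ∈ P, ¬ (u < p ∧ p ≤ u')) → s u = s u')
    (hEm : ∀ σ, MeasurableSet (E σ)) (hE : ∀ u, a ≤ u → u < b → ∀ σ, u ∈ E σ ↔ s u = σ)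
    (hm : ∀ σ, (volume.restrict (Set.Ico a b)).real (E σ) = 1) :
    2 ^ k - 1 ≤ P.card ∧ (P.card = 2 ^ k - 1 → ∀ p ∈ P, ∃ q : ℕ, 0 < q ∧ q < 2 ^ k ∧ p = a + q) ∧
      ∀ σ, ∃ u, a ≤ u ∧ u < b ∧ s u = σ := by
  classical
  have hsurj : ∀ σ, ∃ u, a ≤ u ∧ u < b ∧ s u = σ := by
    intro σ
    by_contra hcon
    push Not at hcon
    have : (volume.restrict (Set.Ico a b)).real (E σ) = 0 := by
      rw [measureReal_def, Measure.restrict_apply (hEm σ)]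
      have : E σ ∩ Set.Ico a b = ∅ := by
        ext u
        simp only [Set.mem_inter_iff, Set.mem_Ico, Set.mem_empty_iff_false, iff_false]
        rintro ⟨h1, h2, h3⟩
        exact hcon u h2 h3 ((hE u h2 h3 σ).mp h1)
      rw [this]; simp
    rw [hm] at this; norm_num at this
  let n : ℝ → ℕ := fun u => (P.filter (· ≤ u)).card
  have hnmono : Monotone n := fun u u' h => Finset.card_le_card (fun p hp => by
    rw [Finset.mem_filter] at hp ⊢; exact ⟨hp.1, hp.2.trans h⟩)
  have hnle : ∀ u, n u ≤ P.card := fun u => Finset.card_le_card (Finset.filter_subset _ _)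
  have key : ∀ u u', a ≤ u → u ≤ u' → u' < b → n u = n u' → s u = s u' := by
    intro u u' h1 h2 h3 h4
    refine hs u u' h1 h2 h3 fun p hp ⟨h5, h6⟩ => ?_
    have : n u < n u' := Finset.card_lt_card (by
      rw [Finset.ssubset_iff_of_subset]
      · exact ⟨p, by simp [hp, h6], by simp [hp, h5]⟩
      · intro p hp
        rw [Finset.mem_filter] at hp ⊢; exact ⟨hp.1, hp.2.trans h2⟩)
    omega
  have key' : ∀ u u', a ≤ u → u < b → a ≤ u' → u' < b → n u = n u' → s u = s u' := by
    intro u u' h1 h2 h3 h4 h5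
    rcases le_total u u' with h | h
    · exact key u u' h1 h h4 h5
    · exact (key u' u h3 h h2 h5.symm).symm
  let f : Fin (P.card + 1) → (Fin k → Bool) := fun l =>
    if h : ∃ u, a ≤ u ∧ u < b ∧ n u = l.val then s h.choose else fun _ => false
  have hf : ∀ u (h1 : a ≤ u) (h2 : u < b), f ⟨n u, Nat.lt_succ_of_le (hnle u)⟩ = s u := by
    intro u h1 h2
    have hex : ∃ u', a ≤ u' ∧ u' < b ∧ n u' = n u := ⟨u, h1, h2, rfl⟩
    change dite _ _ _ = _
    rw [dif_pos hex]
    exact key' _ _ hex.choose_spec.1 hex.choose_spec.2.1 h1 h2 hex.choose_spec.2.2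
  have hfs : Function.Surjective f := by
    intro σ
    obtain ⟨u, h1, h2, h3⟩ := hsurj σ
    exact ⟨_, (hf u h1 h2).trans h3⟩
  have hcard := Fintype.card_le_of_surjective f hfs
  simp only [Fintype.card_pi, Fintype.card_bool, Finset.prod_const, Finset.card_univ, Fintype.card_fin] at hcard
  have hpos : 0 < 2 ^ k := by positivity
  refine ⟨by omega, fun hPc p hp => ?_, hsurj⟩
  have hfi : Function.Injective f := by
    refine ((Fintype.bijective_iff_surjective_and_card f).mpr ⟨hfs, ?_⟩).1
    simp only [Fintype.card_pi, Fintype.card_bool, Finset.prod_const, Finset.card_univ, Fintype.card_fin]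
    omega
  obtain ⟨hpa, hpb⟩ := hP p hp
  have hnp : 0 < n p := Finset.card_pos.mpr ⟨p, by simp [hp]⟩
  refine ⟨n p, hnp, by have := hnle p; omega, ?_⟩
  have e1 : (volume.restrict (Set.Ico a b)).real (⋃ l ∈ (Finset.univ : Finset (Fin (P.card + 1))).filter (fun l => l.val < n p), E (f l)) = n p := by
    rw [measureReal_biUnion_finset₀]
    · simp only [hm, Finset.sum_const, nsmul_eq_mul, mul_one]
      norm_cast
      have := hnle p
      rw [Fin.card_filter_val_lt]; omega
    · intro l _ l' _ hll
      rw [Function.onFun, AEDisjoint, Measure.restrict_apply ((hEm _).inter (hEm _))]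
      have : E (f l) ∩ E (f l') ∩ Set.Ico a b = ∅ := by
        ext u
        simp only [Set.mem_inter_iff, Set.mem_Ico, Set.mem_empty_iff_false, iff_false]
        rintro ⟨⟨h1, h1'⟩, h2, h3⟩
        exact hll (hfi (((hE u h2 h3 _).mp h1).symm.trans ((hE u h2 h3 _).mp h1')))
      rw [this]; simp
    · intro l _; exact (hEm _).nullMeasurableSet
  have e2 : (volume.restrict (Set.Ico a b)).real (⋃ l ∈ (Finset.univ : Finset (Fin (P.card + 1))).filter (fun l => l.val < n p), E (f l)) = p - a := by
    rw [measureReal_def, Measure.restrict_apply (Finset.measurableSet_biUnion _ fun l _ => hEm _)]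
    have : (⋃ l ∈ (Finset.univ : Finset (Fin (P.card + 1))).filter (fun l => l.val < n p), E (f l)) ∩ Set.Ico a b = Set.Ico a p := by
      ext u
      simp only [Set.mem_inter_iff, Set.mem_iUnion, Finset.mem_filter, Finset.mem_univ, true_and, Set.mem_Ico, exists_prop]
      constructor
      · rintro ⟨⟨l, h1, h2⟩, h3, h4⟩
        refine ⟨h3, ?_⟩
        have h5 := (hE u h3 h4 _).mp h2
        rw [← hf u h3 h4] at h5
        have h6 := congrArg Fin.val (hfi h5)
        by_contra hcon
        have := hnmono (not_lt.mp hcon)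
        simp only at h6
        omega
      · rintro ⟨h1, h2⟩
        refine ⟨⟨⟨n u, Nat.lt_succ_of_le (hnle u)⟩, ?_, ?_⟩, h1, h2.trans hpb⟩
        · refine Finset.card_lt_card ?_
          rw [Finset.ssubset_iff_of_subset]
          · exact ⟨p, by simp [hp], by simp [hp, h2]⟩
          · intro p' hp'
            rw [Finset.mem_filter] at hp' ⊢; exact ⟨hp'.1, hp'.2.trans h2.le⟩
        · exact (hE u h1 (h2.trans hpb) _).mpr (hf u h1 (h2.trans hpb)).symm
    rw [this, Real.volume_Ico, ENNReal.toReal_ofReal (by linarith)]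
  linarith

/-! ### Part 10: cuts of a zero -/

section zc
variable {j k : ℕ} {c : Fin k → ℕ}

lemma ker0_const {B D : ℕ} (hB : 1 ≤ B) {x : Ix k c → ℝ} {t : Fin k} (h : yy B ≤ rnorm x t) (hD : c t ≤ D)
    {u u' : ℝ} (h0 : 0 ≤ u) (h1 : u ≤ u') (h2 : u' < B)
    (hn : ∀ m, m < c t → ¬ (u < cp B (row x t) (m + 1) ∧ cp B (row x t) (m + 1) ≤ u')) :
    ker0 B D (row x t) u = ker0 B D (row x t) u' := by
  obtain ⟨m, hm, h3, h4, _, h5⟩ := cell_of hB h h0 (h1.trans_lt h2) hD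
  rw [h5]
  symm
  refine ker0_eq (hm.trans hD) (h3.trans h1) ?_
  rcases hm.lt_or_eq with h6 | h6
  · by_contra hcon
    exact hn m h6 ⟨h4, not_lt.mp hcon⟩
  · rw [h6, cp_top hB h]; exact h2

lemma ker0_sg {B D : ℕ} (hB : 1 ≤ B) {x : Ix k c → ℝ} {t : Fin k} (h : yy B ≤ rnorm x t) (hD : c t ≤ D)
    {u : ℝ} (h0 : 0 ≤ u) (h2 : u < B) :
    ker0 B D (row x t) u = (sg (decide (ker0 B D (row x t) u = -1)) : ℝ) := by
  obtain ⟨m, hm, h3, h4, h6, h5⟩ := cell_of hB h h0 h2 hD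
  rw [h5]
  rcases lt_or_gt_of_ne h6 with h | h
  · rw [sign_neg h]; simp [sg]
  · rw [sign_pos h]; simp [sg]; norm_num

lemma sg_real_inj {a b : Bool} (h : (sg a : ℝ) = sg b) : a = b := sg_inj (by exact_mod_cast h)

lemma zero_cuts {D : ℕ} (hj : 1 ≤ j) (hsum : ∑ t, c t = j * (2 ^ k - 1)) (hD : ∀ t, c t ≤ D)
    {x : Ix k c → ℝ} (hx : ∀ t, yy (j * 2 ^ k) ≤ rnorm x t)
    (hz : ∀ i, ∀ A : Finset (Fin k), A.Nonempty → tF (ker0 (j * 2 ^ k) D) (nu0 j (2 ^ k)) x i A = 0) :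
    (∀ t m, m < c t → ∃ N : ℕ, 0 < N ∧ N < j * 2 ^ k ∧ ¬ 2 ^ k ∣ N ∧ cp (j * 2 ^ k) (row x t) (m + 1) = N) ∧
    (∀ t m t' m', m < c t → m' < c t' → cp (j * 2 ^ k) (row x t) (m + 1) = cp (j * 2 ^ k) (row x t') (m' + 1) →
      t = t' ∧ m = m') ∧
    (∀ N : ℕ, 0 < N → N < j * 2 ^ k → ¬ 2 ^ k ∣ N → ∃ t m, m < c t ∧ cp (j * 2 ^ k) (row x t) (m + 1) = N) ∧
    (∀ i, i < j → ∀ σ : Fin k → Bool, ∃ u : ℝ, (i : ℝ) * (2 ^ k : ℕ) ≤ u ∧ u < (i + 1) * (2 ^ k : ℕ) ∧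
      ∀ t, ker0 (j * 2 ^ k) D (row x t) u = sg (σ t)) := by
  classical
  have hT : 0 < 2 ^ k := by positivity
  have hB : 1 ≤ j * 2 ^ k := Nat.mul_pos hj hT
  have ok : KerOK (ker0 (j * 2 ^ k) D) (nu0 j (2 ^ k)) ({x} : Set (Ix k c → ℝ)) :=
    ker0_ok hB hD (by rintro _ rfl; exact hx)
  set B := j * 2 ^ k with hBdef
  let s : ℝ → Fin k → Bool := fun u t => decide (ker0 B D (row x t) u = -1)
  let cut : (Σ t, Fin (c t)) → ℝ := fun q => cp B (row x q.1) (q.2.val + 1)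
  let P : Finset ℝ := Finset.univ.image cut
  let Pi : Fin j → Finset ℝ := fun i => P.filter fun p => (i.val : ℝ) * (2 ^ k : ℕ) < p ∧ p < (i.val + 1) * (2 ^ k : ℕ)
  have hub : ∀ i : Fin j, ∀ u : ℝ, u < (i.val + 1) * (2 ^ k : ℕ) → u < B := by
    intro i u hu
    refine lt_of_lt_of_le hu ?_
    rw [hBdef]; push_cast
    have : (i.val : ℝ) + 1 ≤ j := by exact_mod_cast i.isLt
    gcongr
  have hlb : ∀ i : Fin j, ∀ u : ℝ, (i.val : ℝ) * (2 ^ k : ℕ) ≤ u → 0 ≤ u := by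
    intro i u hu; exact le_trans (by positivity) hu
  have blk : ∀ i : Fin j, _ := fun i => block_lemma (a := (i.val : ℝ) * (2 ^ k : ℕ)) (b := (i.val + 1) * (2 ^ k : ℕ)) (Pi i) s
    (fun σ => {u | ∀ t, ker0 B D (row x t) u = sg (σ t)}) (fun p hp => (Finset.mem_filter.mp hp).2)
    (by
      intro u u' h1 h2 h3 h4
      funext t
      change decide _ = decide _
      rw [ker0_const hB (hx t) (hD t) (hlb i u h1) h2 (hub i u' h3)]
      rintro m hm ⟨h5, h6⟩
      refine h4 _ (Finset.mem_filter.mpr ⟨Finset.mem_image.mpr ⟨⟨t, ⟨m, hm⟩⟩, Finset.mem_univ _, rfl⟩, ?_⟩) ⟨h5, h6⟩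
      exact ⟨h1.trans_lt h5, h6.trans_lt h3⟩)
    (fun σ => level_measurable ok x σ)
    (by
      intro u h1 h2 σ
      constructor
      · intro h
        funext t
        refine sg_real_inj ?_
        rw [← h t]
        exact (ker0_sg hB (hx t) (hD t) (hlb i u h1) (hub i u h2)).symm
      · rintro rfl t
        exact ker0_sg hB (hx t) (hD t) (hlb i u h1) (hub i u h2))
    (by
      intro σ
      have := level_meas ok rfl i (hz i) σ
      change (nu0 j (2 ^ k) i).real _ = 1
      rw [this]
      unfold nu0
      rw [measureReal_restrict_apply_univ, measureReal_def, Real.volume_Ico]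
      rw [show ((i.val : ℝ) + 1) * (2 ^ k : ℕ) - i.val * (2 ^ k : ℕ) = 2 ^ k by push_cast; ring,
        ENNReal.toReal_ofReal (by positivity)]
      exact div_self (by positivity))
  have hdisj : ∀ i ∈ (Finset.univ : Finset (Fin j)), ∀ i' ∈ (Finset.univ : Finset (Fin j)), i ≠ i' → Disjoint (Pi i) (Pi i') := by
    have aux : ∀ i i' : Fin j, i.val < i'.val → Disjoint (Pi i) (Pi i') := by
      intro i i' h
      rw [Finset.disjoint_left]
      intro p h1 h2
      have h1 := (Finset.mem_filter.mp h1).2.2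
      have h2 := (Finset.mem_filter.mp h2).2.1
      have : ((i.val : ℝ) + 1) * (2 ^ k : ℕ) ≤ i'.val * (2 ^ k : ℕ) := by
        have : (i.val : ℝ) + 1 ≤ i'.val := by exact_mod_cast h
        gcongr
      linarith
    intro i _ i' _ h
    rcases lt_or_gt_of_ne (fun h' => h (Fin.ext h') : i.val ≠ i'.val) with h | h
    · exact aux i i' h
    · exact (aux i' i h).symm
  have hU : Finset.univ.biUnion Pi ⊆ P := by
    intro p hp
    obtain ⟨i, _, hi⟩ := Finset.mem_biUnion.mp hp
    exact (Finset.mem_filter.mp hi).1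
  have c1 : ∑ i, (Pi i).card ≤ P.card := by
    rw [← Finset.card_biUnion hdisj]; exact Finset.card_le_card hU
  have c2 : P.card ≤ j * (2 ^ k - 1) := by
    refine Finset.card_image_le.trans ?_
    rw [Finset.card_univ, Fintype.card_sigma]
    simp [hsum]
  have c3 : ∑ i : Fin j, (2 ^ k - 1) ≤ ∑ i, (Pi i).card := Finset.sum_le_sum fun i _ => (blk i).1
  have c4 : ∑ i : Fin j, (2 ^ k - 1) = j * (2 ^ k - 1) := by simp
  have c5 : ∀ i, (Pi i).card = 2 ^ k - 1 := by
    intro i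
    have := (Finset.sum_eq_sum_iff_of_le (s := Finset.univ) (f := fun _ : Fin j => 2 ^ k - 1) (g := fun i => (Pi i).card)
      fun i _ => (blk i).1).mp (by omega) i (Finset.mem_univ i)
    exact this.symm
  have hUe : Finset.univ.biUnion Pi = P := Finset.eq_of_subset_of_card_le hU (by
    rw [Finset.card_biUnion hdisj]; omega)
  have hinj : Function.Injective cut := by
    have : Finset.card (Finset.univ.image cut) = (Finset.univ : Finset (Σ t, Fin (c t))).card := by
      rw [Finset.card_univ, Fintype.card_sigma]
      simp only [Fintype.card_fin, hsum]
      change P.card = _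
      omega
    have := Finset.card_image_iff.mp this
    rw [Finset.coe_univ] at this
    exact Set.injOn_univ.mp this
  have hPi : ∀ i : Fin j, Pi i = (Finset.Ioo 0 (2 ^ k)).image fun q : ℕ => (i.val : ℝ) * (2 ^ k : ℕ) + q := by
    intro i
    refine Finset.eq_of_subset_of_card_le ?_ ?_
    · intro p hp
      obtain ⟨q, h1, h2, h3⟩ := (blk i).2.1 (c5 i) p hp
      exact Finset.mem_image.mpr ⟨q, Finset.mem_Ioo.mpr ⟨h1, h2⟩, h3.symm⟩
    · refine Finset.card_image_le.trans ?_
      rw [c5 i]; simp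
  refine ⟨?_, ?_, ?_, ?_⟩
  · intro t m hm
    have h1 : cut ⟨t, ⟨m, hm⟩⟩ ∈ P := Finset.mem_image_of_mem _ (Finset.mem_univ _)
    rw [← hUe] at h1
    obtain ⟨i, _, hi⟩ := Finset.mem_biUnion.mp h1
    rw [hPi i] at hi
    obtain ⟨q, hq, h2⟩ := Finset.mem_image.mp hi
    rw [Finset.mem_Ioo] at hq
    refine ⟨i.val * 2 ^ k + q, by omega, ?_, ?_, ?_⟩
    · have : (i.val + 1) * 2 ^ k ≤ j * 2 ^ k := Nat.mul_le_mul_right _ i.isLt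
      rw [hBdef]; nlinarith [hq.2]
    · intro h
      have := (Nat.dvd_add_right (Dvd.intro_left _ rfl)).mp h
      exact absurd (Nat.le_of_dvd hq.1 this) (by omega)
    · change cut ⟨t, ⟨m, hm⟩⟩ = _
      rw [← h2]; push_cast; ring
  · intro t m t' m' hm hm' h
    have := hinj (a₁ := ⟨t, ⟨m, hm⟩⟩) (a₂ := ⟨t', ⟨m', hm'⟩⟩) h
    have h1 := congrArg Sigma.fst this
    simp only at h1
    subst h1
    simp at this
    exact ⟨rfl, this⟩
  · intro N h1 h2 h3
    have hi : N / 2 ^ k < j := Nat.div_lt_of_lt_mul (by rw [mul_comm]; exact h2)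
    have hm : (N : ℝ) ∈ Pi ⟨N / 2 ^ k, hi⟩ := by
      rw [hPi]
      refine Finset.mem_image.mpr ⟨N % 2 ^ k, Finset.mem_Ioo.mpr ⟨?_, Nat.mod_lt _ hT⟩, ?_⟩
      · exact Nat.pos_of_ne_zero fun h => h3 (Nat.dvd_of_mod_eq_zero h)
      · have := Nat.div_add_mod' N (2 ^ k)
        exact_mod_cast this
    obtain ⟨q, _, hq⟩ := Finset.mem_image.mp (Finset.mem_filter.mp hm).1
    exact ⟨q.1, q.2.val, q.2.isLt, hq⟩
  · intro i hi σ
    obtain ⟨u, h1, h2, h3⟩ := (blk ⟨i, hi⟩).2.2 σ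
    refine ⟨u, h1, h2, fun t => ?_⟩
    rw [← h3]
    exact ker0_sg hB (hx t) (hD t) (hlb ⟨i, hi⟩ u h1) (hub ⟨i, hi⟩ u h2)

end zc

/-! ### Part 11: columns and compatible points -/

/-- column description of an equiparting matrix -/
structure IsCol (j k : ℕ) (c : Fin k → ℕ) (g : ℕ → Fin k → Bool) : Prop where
  m1 : ∀ i, i < j → ∀ σ : Fin k → Bool, ∃ q, q < 2 ^ k ∧ g (i * 2 ^ k + q) = σ
  m2 : ∀ N, 0 < N → N < j * 2 ^ k → ¬ 2 ^ k ∣ N → ∃! t, g (N - 1) t ≠ g N t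
  m3 : ∀ N, 0 < N → N < j * 2 ^ k → 2 ^ k ∣ N → g (N - 1) = g N
  m4 : ∀ t, ((Finset.Ioo 0 (j * 2 ^ k)).filter fun N => g (N - 1) t ≠ g N t).card = c t

/-- compatibility of a point with a column sequence -/
structure Cpt (k : ℕ) (c : Fin k → ℕ) (B : ℕ) (x : Ix k c → ℝ) (g : ℕ → Fin k → Bool) (n : Fin k → ℕ → ℕ) : Prop where
  n0 : ∀ t, n t 0 = 0
  nt : ∀ t, n t (c t + 1) = B + 1
  mono : ∀ t m, m ≤ c t → n t m < n t (m + 1)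
  lt : ∀ t m, m ≤ c t → n t m < B
  row : ∀ t m, m ≤ c t → row x t m = sg (g (n t m) t) * (yy (n t (m + 1)) - yy (n t m))
  chg : ∀ t N, 0 < N → N < B → (g (N - 1) t ≠ g N t ↔ ∃ m, 1 ≤ m ∧ m ≤ c t ∧ n t m = N)

lemma blk_inj {k : ℕ} {g : ℕ → Fin k → Bool} {a : ℕ} (h : ∀ σ : Fin k → Bool, ∃ q, q < 2 ^ k ∧ g (a + q) = σ)
    {q q' : ℕ} (hq : q < 2 ^ k) (hq' : q' < 2 ^ k) (he : g (a + q) = g (a + q')) : q = q' := by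
  have hs : Function.Surjective fun q : Fin (2 ^ k) => g (a + q.val) := fun σ => by
    obtain ⟨q, h1, h2⟩ := h σ
    exact ⟨⟨q, h1⟩, h2⟩
  have hi := ((Fintype.bijective_iff_surjective_and_card _).mpr ⟨hs, by simp⟩).1
  have := hi (a₁ := ⟨q, hq⟩) (a₂ := ⟨q', hq'⟩) he
  simpa using this

section cz
variable {j k : ℕ} {c : Fin k → ℕ}

lemma zero_compat {D : ℕ} (hj : 1 ≤ j) (hsum : ∑ t, c t = j * (2 ^ k - 1)) (hD : ∀ t, c t ≤ D)
    {x : Ix k c → ℝ} (hx : ∀ t, rnorm x t = yy (j * 2 ^ k + 1))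
    (hz : ∀ i, ∀ A : Finset (Fin k), A.Nonempty → tF (ker0 (j * 2 ^ k) D) (nu0 j (2 ^ k)) x i A = 0) :
    ∃ g n, IsCol j k c g ∧ Cpt k c (j * 2 ^ k) x g n := by
  classical
  have hx' : ∀ t, yy (j * 2 ^ k) ≤ rnorm x t := fun t => by rw [hx t]; exact yy_mono (by omega)
  have hT : 0 < 2 ^ k := by positivity
  have hB : 1 ≤ j * 2 ^ k := Nat.mul_pos hj hT
  obtain ⟨za, zb, zc, zd⟩ := zero_cuts hj hsum hD hx' hz
  set B := j * 2 ^ k with hBdef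
  have hn : ∀ t, ∃ n : ℕ → ℕ, n 0 = 0 ∧ n (c t + 1) = B + 1 ∧ ∀ m, m < c t →
      0 < n (m + 1) ∧ n (m + 1) < B ∧ ¬ 2 ^ k ∣ n (m + 1) ∧ cp B (row x t) (m + 1) = n (m + 1) := by
    intro t
    choose N hN using za t
    refine ⟨fun m => match m with | 0 => 0 | m + 1 => if h : m < c t then N m h else B + 1, rfl, ?_, ?_⟩
    · simp
    · intro m hm
      simp only [dif_pos hm]
      exact hN m hm
  choose n n0 nt n2 using hn
  let g : ℕ → Fin k → Bool := fun N t => decide (ker0 B D (row x t) N = -1)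
  have hlt : ∀ t m, m ≤ c t → n t m < B := by
    intro t m hm
    cases m with
    | zero => rw [n0]; exact hB
    | succ m => exact (n2 t m (by omega)).2.1
  have hcp : ∀ t m, m ≤ c t → cp B (row x t) m = n t m := by
    intro t m hm
    cases m with
    | zero => rw [n0, cp_zero hB]; simp
    | succ m => exact (n2 t m (by omega)).2.2.2
  have hmono : ∀ t m, m ≤ c t → n t m < n t (m + 1) := by
    intro t m hm
    rcases hm.lt_or_eq with h | h
    · have h1 := cp_mono B (row x t) (Nat.le_succ m)
      rw [Nat.succ_eq_add_one, hcp t m hm, hcp t (m + 1) h] at h1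
      have h1 : n t m ≤ n t (m + 1) := by exact_mod_cast h1
      refine lt_of_le_of_ne h1 fun he => ?_
      cases m with
      | zero => have := (n2 t 0 h).1; rw [n0] at he; omega
      | succ m =>
        have := zb t m t (m + 1) (by omega) h (by rw [hcp t _ hm, hcp t _ h, he])
        omega
    · rw [h, nt]; have := hlt t (c t) le_rfl; omega
  have hbb : ∀ t m, m ≤ c t + 1 → bb (row x t) m = yy (n t m) := by
    intro t m hm
    rcases hm.lt_or_eq with h | h
    · cases m with
      | zero => rw [bb_zero, n0, yy_zero]
      | succ m =>
        have := n2 t m (by omega)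
        exact th_inv this.1 this.2.1 this.2.2.2
    · rw [h, bb_rnorm, nt, hx]
  have hgk : ∀ N t, N < B → ker0 B D (row x t) N = sg (g N t) := by
    intro N t hN
    exact ker0_sg hB (hx' t) (hD t) (by positivity) (by exact_mod_cast hN)
  have hrow : ∀ t m, m ≤ c t → row x t m = sg (g (n t m) t) * (yy (n t (m + 1)) - yy (n t m)) := by
    intro t m hm
    have h1 : |row x t m| = yy (n t (m + 1)) - yy (n t m) := by
      rw [← hbb t _ (by omega), ← hbb t _ (by omega), bb_succ]; ring
    have h2 : (SignType.sign (row x t m) : ℝ) = sg (g (n t m) t) := by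
      rw [← hgk _ _ (hlt t m hm)]
      symm
      refine ker0_eq (hm.trans (hD t)) (hcp t m hm).le ?_
      rcases hm.lt_or_eq with h | h
      · rw [hcp t _ h]; exact_mod_cast hmono t m hm
      · rw [h, cp_top hB (hx' t)]; exact_mod_cast hlt t _ le_rfl
    rw [← h1, ← h2, sign_mul_abs]
  have hchg1 : ∀ t N, 0 < N → N < B → g (N - 1) t ≠ g N t → ∃ m, m < c t ∧ n t (m + 1) = N := by
    intro t N h0 hN hne
    by_contra hcon
    push Not at hcon
    refine hne (sg_real_inj ?_)
    rw [← hgk _ _ (by omega), ← hgk _ _ hN]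
    refine ker0_const hB (hx' t) (hD t) (by positivity) (by exact_mod_cast Nat.sub_le N 1) (by exact_mod_cast hN) ?_
    rintro m hm ⟨h1, h2⟩
    rw [hcp t _ hm] at h1 h2
    have h1 : N - 1 < n t (m + 1) := by exact_mod_cast h1
    have h2 : n t (m + 1) ≤ N := by exact_mod_cast h2
    exact hcon m hm (by omega)
  have hm1 : ∀ i, i < j → ∀ σ : Fin k → Bool, ∃ q, q < 2 ^ k ∧ g (i * 2 ^ k + q) = σ := by
    intro i hi σ
    obtain ⟨u, h1, h2, h3⟩ := zd i hi σ
    have hu0 : 0 ≤ u := le_trans (by positivity) h1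
    have hf1 : i * 2 ^ k ≤ ⌊u⌋₊ := Nat.le_floor (by exact_mod_cast h1)
    have hf2 : ⌊u⌋₊ < (i + 1) * 2 ^ k := (Nat.floor_lt hu0).mpr (by exact_mod_cast h2)
    have hf3 : (i + 1) * 2 ^ k ≤ j * 2 ^ k := Nat.mul_le_mul_right _ hi
    have huB : u < B := by
      refine lt_of_lt_of_le h2 ?_
      rw [hBdef]; exact_mod_cast hf3
    refine ⟨⌊u⌋₊ - i * 2 ^ k, by rw [add_mul, one_mul] at hf2; omega, ?_⟩
    rw [Nat.add_sub_cancel' hf1]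
    funext t
    refine sg_real_inj ?_
    rw [← hgk _ _ (by omega), ← h3 t]
    refine ker0_const hB (hx' t) (hD t) (by positivity) (Nat.floor_le hu0) huB ?_
    rintro m hm ⟨h4, h5⟩
    rw [hcp t _ hm] at h4 h5
    have h4 : ⌊u⌋₊ < n t (m + 1) := by exact_mod_cast h4
    have := Nat.le_floor h5
    rw [Nat.succ_eq_add_one] at this
    omega
  have huniq : ∀ t m t' m', m < c t → m' < c t' → n t (m + 1) = n t' (m' + 1) → t = t' ∧ m = m' := by
    intro t m t' m' h1 h2 h3
    refine zb t m t' m' h1 h2 ?_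
    rw [hcp t _ h1, hcp t' _ h2, h3]
  have hchg2 : ∀ t m, m < c t → g (n t (m + 1) - 1) t ≠ g (n t (m + 1)) t := by
    intro t m hm he
    obtain ⟨h0, hN, hd, _⟩ := n2 t m hm
    set N := n t (m + 1) with hNdef
    have hall : g (N - 1) = g N := by
      funext t'
      by_cases ht : t' = t
      · rw [ht]; exact he
      · by_contra hne
        obtain ⟨m', hm', h⟩ := hchg1 t' N h0 hN hne
        exact ht (huniq t' m' t m hm' hm h).1
    have e1 := Nat.div_add_mod' N (2 ^ k)
    have e2 : 0 < N % 2 ^ k := Nat.pos_of_ne_zero fun h => hd (Nat.dvd_of_mod_eq_zero h)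
    have e3 := Nat.mod_lt N hT
    have hi : N / 2 ^ k < j := Nat.div_lt_of_lt_mul (by rw [mul_comm]; exact hN)
    have := blk_inj (hm1 _ hi) (q := N % 2 ^ k - 1) (q' := N % 2 ^ k) (by omega) e3 (by
      rw [e1, ← hall]; congr 1; omega)
    omega
  have hchg : ∀ t N, 0 < N → N < B → (g (N - 1) t ≠ g N t ↔ ∃ m, m < c t ∧ n t (m + 1) = N) := by
    intro t N h0 hN
    refine ⟨hchg1 t N h0 hN, ?_⟩
    rintro ⟨m, hm, rfl⟩
    exact hchg2 t m hm
  refine ⟨g, n, ⟨hm1, ?_, ?_, ?_⟩, ⟨n0, nt, hmono, hlt, hrow, ?_⟩⟩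
  · intro N h0 hN hd
    obtain ⟨t, m, hm, h⟩ := zc N h0 hN hd
    have h' : n t (m + 1) = N := by
      rw [hcp t _ hm] at h; exact_mod_cast h
    refine ⟨t, (hchg t N h0 hN).mpr ⟨m, hm, h'⟩, ?_⟩
    intro t' ht'
    obtain ⟨m', hm', h''⟩ := (hchg t' N h0 hN).mp ht'
    exact (huniq t' m' t m hm' hm (h''.trans h'.symm)).1
  · intro N h0 hN hd
    funext t
    by_contra hne
    obtain ⟨m, hm, rfl⟩ := (hchg t N h0 hN).mp hne
    exact (n2 t m hm).2.2.1 hd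
  · intro t
    have : ((Finset.Ioo 0 B).filter fun N => g (N - 1) t ≠ g N t) = (Finset.range (c t)).image fun m => n t (m + 1) := by
      ext N
      simp only [Finset.mem_filter, Finset.mem_Ioo, Finset.mem_image, Finset.mem_range]
      constructor
      · rintro ⟨⟨h1, h2⟩, h3⟩
        exact (hchg t N h1 h2).mp h3
      · rintro ⟨m, hm, rfl⟩
        exact ⟨⟨(n2 t m hm).1, (n2 t m hm).2.1⟩, hchg2 t m hm⟩
    rw [this, Finset.card_image_of_injOn, Finset.card_range]
    intro m hm m' hm' h
    exact (huniq t m t m' (by simpa using hm) (by simpa using hm') h).2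
  · intro t N h0 hN
    rw [hchg t N h0 hN]
    constructor
    · rintro ⟨m, hm, h⟩; exact ⟨m + 1, by omega, by omega, h⟩
    · rintro ⟨m, h1, h2, h3⟩; exact ⟨m - 1, by omega, by rw [Nat.sub_add_cancel h1]; exact h3⟩

lemma ix_ext {x y : Ix k c → ℝ} (h : ∀ t m, m ≤ c t → row x t m = row y t m) : x = y := by
  funext ⟨t, m⟩
  have := h t m.val (by omega)
  simpa [row, m.isLt] using this

namespace Cpt
variable {B : ℕ} {x : Ix k c → ℝ} {g : ℕ → Fin k → Bool} {n : Fin k → ℕ → ℕ}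

lemma cellc (h : Cpt k c B x g n) {t : Fin k} {m : ℕ} (hm : m ≤ c t) {N : ℕ} (h1 : n t m ≤ N) (h2 : N < n t (m + 1))
    (h3 : N < B) : g N t = g (n t m) t := by
  induction N, h1 using Nat.le_induction with
  | base => rfl
  | succ N h1 ih =>
    rw [← ih (by omega) (by omega)]
    by_contra hne
    obtain ⟨m', h4, h5, h6⟩ := (h.chg t (N + 1) (by omega) h3).mp (by simpa using Ne.symm hne)
    -- strict monotonicity
    have hmon : ∀ a b, a ≤ b → b ≤ c t + 1 → n t a ≤ n t b := by
      intro a b hab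
      induction b, hab using Nat.le_induction with
      | base => intro _; exact le_rfl
      | succ b hb ih' => intro hb'; exact (ih' (by omega)).trans (h.mono t b (by omega)).le
    rcases Nat.lt_or_ge m m' with hh | hh
    · have := hmon (m + 1) m' hh (by omega); omega
    · have := hmon m' m hh (by omega); omega

lemma smono (h : Cpt k c B x g n) {t : Fin k} {a b : ℕ} (hab : a < b) (hb : b ≤ c t + 1) : n t a < n t b := by
  induction b, hab using Nat.le_induction with
  | base => exact h.mono t a (by omega)
  | succ b hab ih => exact (ih (by omega)).trans (h.mono t b (by omega))

lemma cell_ex (h : Cpt k c B x g n) (t : Fin k) {N : ℕ} (hN : N < B) : ∃ m, m ≤ c t ∧ n t m ≤ N ∧ N < n t (m + 1) := by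
  classical
  have hex : ∃ m, N < n t (m + 1) := ⟨c t, by rw [h.nt]; omega⟩
  refine ⟨Nat.find hex, Nat.find_min' hex (by rw [h.nt]; omega), ?_, Nat.find_spec hex⟩
  rcases Nat.eq_zero_or_pos (Nat.find hex) with h0 | h0
  · rw [h0, h.n0]; omega
  · have := Nat.find_min hex (show Nat.find hex - 1 < Nat.find hex by omega)
    rw [show Nat.find hex - 1 + 1 = Nat.find hex by omega] at this
    exact not_lt.mp this

lemma absrow (h : Cpt k c B x g n) {t : Fin k} {m : ℕ} (hm : m ≤ c t) :
    |_root_.row x t m| = yy (n t (m + 1)) - yy (n t m) := by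
  have h1 := yy_lt (h.mono t m hm)
  rw [h.row t m hm, abs_mul]
  rcases sg_or (g (n t m) t) with h' | h' <;> rw [h'] <;> simp <;> linarith

lemma bbe (h : Cpt k c B x g n) (t : Fin k) {m : ℕ} (hm : m ≤ c t + 1) : bb (_root_.row x t) m = yy (n t m) := by
  induction m with
  | zero => rw [bb_zero, h.n0, yy_zero]
  | succ m ih => rw [bb_succ, ih (by omega), h.absrow (by omega)]; ring

lemma rn (h : Cpt k c B x g n) (t : Fin k) : rnorm x t = yy (B + 1) := by
  rw [← bb_rnorm, h.bbe t le_rfl, h.nt]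

lemma yy_inj {a b : ℕ} (h : yy a = yy b) : a = b := by
  rcases lt_trichotomy a b with h1 | h1 | h1
  · have := yy_lt h1; linarith
  · exact h1
  · have := yy_lt h1; linarith

/-- the point determines the columns -/
lemma inj (h : Cpt k c B x g n) {g' : ℕ → Fin k → Bool} {n' : Fin k → ℕ → ℕ} (h' : Cpt k c B x g' n')
    {N : ℕ} (hN : N < B) : g N = g' N := by
  have hn : ∀ t m, m ≤ c t + 1 → n t m = n' t m := fun t m hm => yy_inj ((h.bbe t hm).symm.trans (h'.bbe t hm))
  funext t
  obtain ⟨m, h1, h2, h3⟩ := h.cell_ex t hN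
  rw [h.cellc h1 h2 h3 hN, h'.cellc h1 (by rw [← hn t m (by omega)]; exact h2) (by rw [← hn t _ (by omega)]; exact h3) hN,
    ← hn t m (by omega)]
  have e := h.row t m h1
  rw [h'.row t m h1, ← hn t m (by omega), ← hn t _ (by omega)] at e
  have := yy_lt (h.mono t m h1)
  exact (sg_real_inj (mul_right_cancel₀ (by linarith) e)).symm

end Cpt

/-- each column sequence has a compatible point, which is unique -/
lemma compat_exists (hj : 1 ≤ j) {g : ℕ → Fin k → Bool} (hg : IsCol j k c g) : ∃ x n, Cpt k c (j * 2 ^ k) x g n := by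
  classical
  have hT : 0 < 2 ^ k := by positivity
  have hB : 1 ≤ j * 2 ^ k := Nat.mul_pos hj hT
  set B := j * 2 ^ k with hBdef
  let S : Fin k → Finset ℕ := fun t => (Finset.Ioo 0 B).filter fun N => g (N - 1) t ≠ g N t
  have hS : ∀ t, (S t).card = c t := hg.m4
  let n : Fin k → ℕ → ℕ := fun t m => match m with
    | 0 => 0
    | m + 1 => if h : m < c t then (S t).orderEmbOfFin (hS t) ⟨m, h⟩ else B + 1
  have n0 : ∀ t, n t 0 = 0 := fun t => rfl
  have nt : ∀ t, n t (c t + 1) = B + 1 := fun t => by simp [n]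
  have n1 : ∀ t m (h : m < c t), n t (m + 1) = (S t).orderEmbOfFin (hS t) ⟨m, h⟩ := fun t m h => by simp [n, h]
  have n2 : ∀ t m, m < c t → n t (m + 1) ∈ S t := fun t m h => by
    rw [n1 t m h]; exact Finset.orderEmbOfFin_mem _ _ _
  have n3 : ∀ t m, m < c t → 0 < n t (m + 1) ∧ n t (m + 1) < B := fun t m h =>
    Finset.mem_Ioo.mp (Finset.mem_filter.mp (n2 t m h)).1
  have hlt : ∀ t m, m ≤ c t → n t m < B := by
    intro t m hm
    cases m with
    | zero => rw [n0 t]; exact hB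
    | succ m => exact (n3 t m (by omega)).2
  refine ⟨fun i => sg (g (n i.1 i.2.val) i.1) * (yy (n i.1 (i.2.val + 1)) - yy (n i.1 i.2.val)), n, n0, nt, ?_, hlt, ?_, ?_⟩
  · intro t m hm
    rcases hm.lt_or_eq with h | h
    · cases m with
      | zero => rw [n0 t]; exact (n3 t 0 h).1
      | succ m =>
        rw [n1 t m (by omega), n1 t (m + 1) h]
        exact (Finset.orderEmbOfFin (S t) (hS t)).strictMono (by simp)
    · rw [h, nt]; have := hlt t (c t) le_rfl; omega
  · intro t m hm
    rw [row, dif_pos (by omega)]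
  · intro t N h0 hN
    constructor
    · intro hne
      have : N ∈ Set.range ((S t).orderEmbOfFin (hS t)) := by
        rw [Finset.range_orderEmbOfFin]
        exact Finset.mem_coe.mpr (Finset.mem_filter.mpr ⟨Finset.mem_Ioo.mpr ⟨h0, hN⟩, hne⟩)
      obtain ⟨m, hm⟩ := this
      exact ⟨m.val + 1, by omega, by omega, by rw [n1 t m.val m.isLt]; exact hm⟩
    · rintro ⟨m, h1, h2, rfl⟩
      obtain ⟨m, rfl⟩ : ∃ m', m = m' + 1 := ⟨m - 1, by omega⟩
      exact (Finset.mem_filter.mp (n2 t m (by omega))).2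

lemma compat_unique {B : ℕ} {g : ℕ → Fin k → Bool} {x x' : Ix k c → ℝ} {n n' : Fin k → ℕ → ℕ}
    (h : Cpt k c B x g n) (h' : Cpt k c B x' g n') : x = x' := by
  have key : ∀ t m, m ≤ c t + 1 → n t m = n' t m := by
    intro t
    -- the m-th values agree by strong comparison
    have aux : ∀ {x x' : Ix k c → ℝ} {n n' : Fin k → ℕ → ℕ}, Cpt k c B x g n → Cpt k c B x' g n' →
        ∀ m, m ≤ c t → (∀ l, l ≤ m → n t l = n' t l) → n t (m + 1) ≤ n' t (m + 1) := by
      intro x x' n n' h h' m hm hl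
      rcases hm.lt_or_eq with hlt | heq
      · by_contra hcon
        push Not at hcon
        have hN0 : 0 < n' t (m + 1) := by have := h'.mono t m hm; omega
        have hNB := h'.lt t (m + 1) hlt
        obtain ⟨a, h1, h2, h3⟩ := (h.chg t _ hN0 hNB).mp ((h'.chg t _ hN0 hNB).mpr ⟨m + 1, by omega, hlt, rfl⟩)
        rcases Nat.lt_or_ge m a with hma | hma
        · rcases Nat.lt_or_ge (m + 1) a with h4 | h4
          · have := h.smono (t := t) h4 (by omega); omega
          · have : a = m + 1 := by omega
            subst this; omega
        · have := hl a hma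
          have h5 := h'.smono (t := t) (show a < m + 1 by omega) (by omega)
          omega
      · rw [heq, h.nt, h'.nt]
    have : ∀ m, m ≤ c t + 1 → ∀ l, l ≤ m → n t l = n' t l := by
      intro m
      induction m with
      | zero => intro _ l hl; rw [Nat.le_zero.mp hl, h.n0, h'.n0]
      | succ m ih =>
        intro hm l hl
        have ih := ih (by omega)
        rcases hl.lt_or_eq with h1 | h1
        · exact ih l (by omega)
        · rw [h1]
          exact le_antisymm (aux h h' m (by omega) ih) (aux h' h m (by omega) fun l hl => (ih l hl).symm)
    intro m hm
    exact this m hm m le_rfl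
  refine ix_ext fun t m hm => ?_
  rw [h.row t m hm, h'.row t m hm, key t m (by omega), key t _ (by omega)]

end cz

/-! ### Part 12: matrices and columns -/

section mc
variable {j k : ℕ} {c : Fin k → ℕ}

/-- matrix of a column sequence -/
def matOf (j k : ℕ) (g : ℕ → Fin k → Bool) : Fin j → Fin (2 ^ k) → Fin k → Bool := fun i q => g (i.val * 2 ^ k + q.val)

/-- columns of a matrix -/
def colOf (G : Fin j → Fin (2 ^ k) → Fin k → Bool) (N : ℕ) : Fin k → Bool :=
  if h : N / 2 ^ k < j then G ⟨N / 2 ^ k, h⟩ ⟨N % 2 ^ k, Nat.mod_lt _ (by positivity)⟩ else fun _ => false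

lemma matOf_colOf (G : Fin j → Fin (2 ^ k) → Fin k → Bool) : matOf j k (colOf G) = G := by
  funext i q
  have hT : 0 < 2 ^ k := by positivity
  have h1 : (i.val * 2 ^ k + q.val) / 2 ^ k = i.val := by
    rw [mul_comm, Nat.mul_add_div hT, Nat.div_eq_of_lt q.isLt, add_zero]
  have h2 : (i.val * 2 ^ k + q.val) % 2 ^ k = q.val := by
    rw [mul_comm, Nat.mul_add_mod, Nat.mod_eq_of_lt q.isLt]
  unfold matOf colOf
  rw [dif_pos (by rw [h1]; exact i.isLt)]
  exact congrArg₂ G (Fin.ext h1) (Fin.ext h2)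

lemma colOf_matOf (g : ℕ → Fin k → Bool) {N : ℕ} (hN : N < j * 2 ^ k) : colOf (matOf j k g) N = g N := by
  unfold colOf matOf
  rw [dif_pos (Nat.div_lt_of_lt_mul (by rw [mul_comm]; exact hN))]
  simp only
  rw [Nat.div_add_mod']

lemma cnt_split {g : ℕ → Fin k → Bool} (m3 : ∀ N, 0 < N → N < j * 2 ^ k → 2 ^ k ∣ N → g (N - 1) = g N) (t : Fin k) :
    ((Finset.Ioo 0 (j * 2 ^ k)).filter fun N => g (N - 1) t ≠ g N t).card = ∑ i, grayTransCount k (matOf j k g i) t := by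
  classical
  have hT : 0 < 2 ^ k := by positivity
  unfold grayTransCount
  rw [← Finset.card_sigma]
  symm
  refine Finset.card_bij (fun p _ => p.1.val * 2 ^ k + p.2.val + 1) ?_ ?_ ?_
  · rintro ⟨i, q⟩ hp
    rw [Finset.mem_sigma, Finset.mem_filter] at hp
    have h := hp.2.2
    have h1 : (i.val + 1) * 2 ^ k ≤ j * 2 ^ k := Nat.mul_le_mul_right _ i.isLt
    rw [add_mul, one_mul] at h1
    have h2 := q.isLt
    rw [Finset.mem_filter, Finset.mem_Ioo]
    exact ⟨⟨by simp, by simp only; omega⟩, h⟩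
  · rintro ⟨i, q⟩ _ ⟨i', q'⟩ _ h
    have h2 := q.isLt
    have h3 := q'.isLt
    simp only at h
    have e : i.val * 2 ^ k + q.val = i'.val * 2 ^ k + q'.val := by omega
    have e1 := congrArg (· / 2 ^ k) e
    have e2 := congrArg (· % 2 ^ k) e
    rw [mul_comm, Nat.mul_add_div hT, Nat.div_eq_of_lt (by omega), mul_comm, Nat.mul_add_div hT, Nat.div_eq_of_lt (by omega)] at e1
    rw [mul_comm, Nat.mul_add_mod, Nat.mod_eq_of_lt (by omega), mul_comm, Nat.mul_add_mod, Nat.mod_eq_of_lt (by omega)] at e2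
    have : i = i' := Fin.ext (by simpa using e1)
    subst this
    have : q = q' := Fin.ext e2
    subst this
    rfl
  · intro N hN
    rw [Finset.mem_filter, Finset.mem_Ioo] at hN
    obtain ⟨⟨h0, hB⟩, hne⟩ := hN
    have hd : ¬ 2 ^ k ∣ N := fun h => hne (by rw [m3 N h0 hB h])
    have e1 := Nat.div_add_mod' N (2 ^ k)
    have e2 : 0 < N % 2 ^ k := Nat.pos_of_ne_zero fun h => hd (Nat.dvd_of_mod_eq_zero h)
    have e3 := Nat.mod_lt N hT
    refine ⟨⟨⟨N / 2 ^ k, Nat.div_lt_of_lt_mul (by rw [mul_comm]; exact hB)⟩, ⟨N % 2 ^ k - 1, by omega⟩⟩, ?_, ?_⟩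
    · rw [Finset.mem_sigma, Finset.mem_filter]
      refine ⟨Finset.mem_univ _, Finset.mem_univ _, ?_⟩
      change g (N / 2 ^ k * 2 ^ k + (N % 2 ^ k - 1)) t ≠ g (N / 2 ^ k * 2 ^ k + (N % 2 ^ k - 1 + 1)) t
      rw [show N / 2 ^ k * 2 ^ k + (N % 2 ^ k - 1) = N - 1 by omega,
        show N / 2 ^ k * 2 ^ k + (N % 2 ^ k - 1 + 1) = N by omega]
      exact hne
    · simp only; omega

lemma em_of_col {g : ℕ → Fin k → Bool} (h : IsCol j k c g) : IsEquipartingMatrix j k c (matOf j k g) := by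
  have hT : 0 < 2 ^ k := by positivity
  refine ⟨fun i => ⟨?_, ?_⟩, ?_, ?_⟩
  · refine (Fintype.bijective_iff_surjective_and_card _).mpr ⟨fun σ => ?_, by simp⟩
    obtain ⟨q, h1, h2⟩ := h.m1 i.val i.isLt σ
    exact ⟨⟨q, h1⟩, h2⟩
  · intro q
    have h1 : (i.val + 1) * 2 ^ k ≤ j * 2 ^ k := Nat.mul_le_mul_right _ i.isLt
    rw [add_mul, one_mul] at h1
    have h2 := q.isLt
    exact h.m2 (i.val * 2 ^ k + q.val + 1) (by omega) (by omega) (by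
      intro hd
      rw [add_assoc] at hd
      have := (Nat.dvd_add_right (Dvd.intro_left _ rfl)).mp hd
      exact absurd (Nat.le_of_dvd (by omega) this) (by omega))
  · intro i hi
    have h1 : (i.val + 1 + 1) * 2 ^ k ≤ j * 2 ^ k := Nat.mul_le_mul_right _ hi
    have := h.m3 ((i.val + 1) * 2 ^ k) (by positivity) (by rw [add_mul _ 1, one_mul] at h1; omega) (Dvd.intro_left _ rfl)
    rw [add_mul, one_mul] at this
    change g (i.val * 2 ^ k + (2 ^ k - 1)) = g ((i.val + 1) * 2 ^ k + 0)
    rw [add_zero, add_mul, one_mul, ← this]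
    congr 1; omega
  · intro t
    rw [← cnt_split h.m3, h.m4]

lemma col_of_em {g : ℕ → Fin k → Bool} (h : IsEquipartingMatrix j k c (matOf j k g)) : IsCol j k c g := by
  have hT : 0 < 2 ^ k := by positivity
  have m3 : ∀ N, 0 < N → N < j * 2 ^ k → 2 ^ k ∣ N → g (N - 1) = g N := by
    rintro N h0 hN ⟨i, rfl⟩
    have hi0 : 0 < i := Nat.pos_of_mul_pos_left h0
    have hi : i < j := by
      rw [mul_comm] at hN
      exact lt_of_mul_lt_mul_right hN (by omega)
    obtain ⟨i, rfl⟩ : ∃ i', i = i' + 1 := ⟨i - 1, by omega⟩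
    have := h.2.1 ⟨i, by omega⟩ hi
    change g (i * 2 ^ k + (2 ^ k - 1)) = g ((i + 1) * 2 ^ k + 0) at this
    rw [add_zero] at this
    rw [mul_comm, ← this, add_mul, one_mul]
    congr 1; omega
  refine ⟨?_, ?_, m3, ?_⟩
  · intro i hi σ
    obtain ⟨q, hq⟩ := (h.1 ⟨i, hi⟩).1.2 σ
    exact ⟨q.val, q.isLt, hq⟩
  · intro N h0 hB hd
    have e1 := Nat.div_add_mod' N (2 ^ k)
    have e2 : 0 < N % 2 ^ k := Nat.pos_of_ne_zero fun h => hd (Nat.dvd_of_mod_eq_zero h)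
    have e3 := Nat.mod_lt N hT
    have := (h.1 ⟨N / 2 ^ k, Nat.div_lt_of_lt_mul (by rw [mul_comm]; exact hB)⟩).2 ⟨N % 2 ^ k - 1, by omega⟩
    change ∃! t, g (N / 2 ^ k * 2 ^ k + (N % 2 ^ k - 1)) t ≠ g (N / 2 ^ k * 2 ^ k + (N % 2 ^ k - 1 + 1)) t at this
    rw [show N / 2 ^ k * 2 ^ k + (N % 2 ^ k - 1) = N - 1 by omega,
        show N / 2 ^ k * 2 ^ k + (N % 2 ^ k - 1 + 1) = N by omega] at this
    exact this
  · intro t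
    rw [cnt_split m3, h.2.2]

lemma Cpt.congr {B : ℕ} {x : Ix k c → ℝ} {g g' : ℕ → Fin k → Bool} {n : Fin k → ℕ → ℕ} (h : Cpt k c B x g n)
    (he : ∀ N, N < B → g' N = g N) : Cpt k c B x g' n where
  n0 := h.n0
  nt := h.nt
  mono := h.mono
  lt := h.lt
  row t m hm := by rw [he _ (h.lt t m hm)]; exact h.row t m hm
  chg t N h0 hN := by rw [he _ hN, he _ (by omega)]; exact h.chg t N h0 hN

/-- the reference zeros -/
def Zr (j k : ℕ) (c : Fin k → ℕ) : Set (Ix k c → ℝ) := {x | ∃ g n, IsCol j k c g ∧ Cpt k c (j * 2 ^ k) x g n}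

lemma card_Zr (hj : 1 ≤ j) : Nat.card (Zr j k c) = Nat.card (EMx j k c) := by
  have hex : ∀ G : EMx j k c, ∃ x n, Cpt k c (j * 2 ^ k) x (colOf G.1) n := fun G =>
    compat_exists hj (col_of_em (by rw [matOf_colOf]; exact G.2))
  choose X n hX using hex
  symm
  refine Nat.card_congr (Equiv.ofBijective (fun G : EMx j k c => (⟨X G, colOf G.1, n G,
    col_of_em (by rw [matOf_colOf]; exact G.2), hX G⟩ : Zr j k c)) ⟨?_, ?_⟩)
  · intro G G' h
    have hx : X G = X G' := congrArg Subtype.val h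
    refine Subtype.ext ?_
    rw [← matOf_colOf G.1, ← matOf_colOf G'.1]
    funext i q
    have h1 : (i.val + 1) * 2 ^ k ≤ j * 2 ^ k := Nat.mul_le_mul_right _ i.isLt
    rw [add_mul, one_mul] at h1
    have h2 := hX G'
    rw [← hx] at h2
    exact (hX G).inj h2 (N := i.val * 2 ^ k + q.val) (by have := q.isLt; omega)
  · rintro ⟨x, g, n', hg, hc⟩
    refine ⟨⟨matOf j k g, em_of_col hg⟩, Subtype.ext ?_⟩
    exact compat_unique (hX _) (hc.congr fun N hN => colOf_matOf g hN)

lemma Zr_finite : (Zr j k c).Finite := by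
  have hex : ∀ x : Zr j k c, ∃ g n, IsCol j k c g ∧ Cpt k c (j * 2 ^ k) x.1 g n := fun x => x.2
  choose g n hg hc using hex
  have : Finite (Zr j k c) := by
    refine Finite.of_injective (β := Fin j → Fin (2 ^ k) → Fin k → Bool) (fun x => matOf j k (g x)) ?_
    intro x x' h
    dsimp only at h
    refine Subtype.ext (compat_unique (hc x) ((hc x').congr fun N hN => ?_))
    rw [← colOf_matOf (g x) hN, h, colOf_matOf (g x') hN]
  exact Set.toFinite _

end mc

/-! ### Part 13: local structure of the reference map at a zero -/

lemma char_sum {k : ℕ} {A : Finset (Fin k)} (hA : A.Nonempty) :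
    ∑ σ : Fin k → Bool, ∏ t ∈ A, (sg (σ t) : ℝ) = 0 := by
  classical
  have h1 : ∀ σ : Fin k → Bool, ∏ t ∈ A, (sg (σ t) : ℝ) = ∏ t, if t ∈ A then (sg (σ t) : ℝ) else 1 := by
    intro σ
    rw [Finset.prod_ite_mem, Finset.univ_inter]
  simp only [h1]
  have := Finset.prod_univ_sum (fun _ : Fin k => (Finset.univ : Finset Bool)) (fun t b => if t ∈ A then (sg b : ℝ) else 1)
  rw [Fintype.piFinset_univ] at this
  rw [← this]
  obtain ⟨t, ht⟩ := hA
  refine Finset.prod_eq_zero (Finset.mem_univ t) ?_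
  simp [ht, sg]

lemma piece_int {f : ℝ → ℝ} {a v : ℕ → ℝ} {n : ℕ} (hm : ∀ q, q < n → a q ≤ a (q + 1))
    (hf : ∀ q, q < n → ∀ u, a q ≤ u → u < a (q + 1) → f u = v q) :
    a 0 ≤ a n ∧ IntegrableOn f (Set.Ico (a 0) (a n)) ∧
      ∫ u in Set.Ico (a 0) (a n), f u = ∑ q ∈ Finset.range n, v q * (a (q + 1) - a q) := by
  induction n with
  | zero => simp
  | succ n ih =>
    obtain ⟨h1, h2, h3⟩ := ih (fun q hq => hm q (by omega)) (fun q hq => hf q (by omega))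
    have h4 := hm n (by omega)
    have hc : Set.EqOn f (fun _ => v n) (Set.Ico (a n) (a (n + 1))) := fun u hu => hf n (by omega) u hu.1 hu.2
    have h5 : IntegrableOn f (Set.Ico (a n) (a (n + 1))) := by
      rw [integrableOn_congr_fun hc measurableSet_Ico]
      exact integrableOn_const (by rw [Real.volume_Ico]; exact ENNReal.ofReal_ne_top)
    have h6 : ∫ u in Set.Ico (a n) (a (n + 1)), f u = v n * (a (n + 1) - a n) := by
      rw [setIntegral_congr_fun measurableSet_Ico hc, setIntegral_const, measureReal_def, Real.volume_Ico,
        ENNReal.toReal_ofReal (by linarith), smul_eq_mul, mul_comm]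
    refine ⟨h1.trans h4, ?_, ?_⟩
    · rw [← Set.Ico_union_Ico_eq_Ico h1 h4]; exact h2.union h5
    · rw [← Set.Ico_union_Ico_eq_Ico h1 h4, setIntegral_union (Set.Ico_disjoint_Ico_same) measurableSet_Ico h2 h5, h3, h6,
        Finset.sum_range_succ]

section loc
variable {j k : ℕ} {c : Fin k → ℕ}

/-- row entry as linear map -/
noncomputable def rowL (t : Fin k) (m : ℕ) : (Ix k c → ℝ) →ₗ[ℝ] ℝ :=
  if h : m < c t + 1 then LinearMap.proj (⟨t, ⟨m, h⟩⟩ : Ix k c) else 0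

lemma rowL_apply (t : Fin k) (m : ℕ) (δ : Ix k c → ℝ) : rowL t m δ = row δ t m := by
  unfold rowL row
  by_cases h : m < c t + 1
  · rw [dif_pos h, dif_pos h]; rfl
  · rw [dif_neg h, dif_neg h]; rfl

lemma row_add (x y : Ix k c → ℝ) (t : Fin k) (m : ℕ) : row (x + y) t m = row x t m + row y t m := by
  rw [← rowL_apply, map_add, rowL_apply, rowL_apply]

lemma abs_row_le (δ : Ix k c → ℝ) (t : Fin k) (m : ℕ) : |row δ t m| ≤ ‖δ‖ := by
  unfold row
  by_cases h : m < c t + 1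
  · rw [dif_pos h]; exact norm_le_pi_norm δ _
  · rw [dif_neg h, abs_zero]; exact norm_nonneg _

/-- linear part of partial sums -/
noncomputable def eL (g : ℕ → Fin k → Bool) (n : Fin k → ℕ → ℕ) (t : Fin k) (m : ℕ) : (Ix k c → ℝ) →ₗ[ℝ] ℝ :=
  ∑ l ∈ Finset.range m, (sg (g (n t l) t) : ℝ) • rowL t l

lemma eL_apply (g : ℕ → Fin k → Bool) (n : Fin k → ℕ → ℕ) (t : Fin k) (m : ℕ) (δ : Ix k c → ℝ) :
    eL g n t m δ = ∑ l ∈ Finset.range m, (sg (g (n t l) t) : ℝ) * row δ t l := by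
  simp [eL, LinearMap.sum_apply, rowL_apply]

lemma abs_eL (g : ℕ → Fin k → Bool) (n : Fin k → ℕ → ℕ) (t : Fin k) (m : ℕ) (δ : Ix k c → ℝ) :
    |eL g n t m δ| ≤ m * ‖δ‖ := by
  rw [eL_apply]
  refine (Finset.abs_sum_le_sum_abs _ _).trans ?_
  refine (Finset.sum_le_sum (g := fun _ => ‖δ‖) fun l _ => ?_).trans (by simp)
  rw [abs_mul]
  have := abs_row_le δ t l
  rcases sg_or (g (n t l) t) with h | h <;> rw [h] <;> simpa using this

namespace Cpt
variable {B : ℕ} {x : Ix k c → ℝ} {g : ℕ → Fin k → Bool} {n : Fin k → ℕ → ℕ}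

lemma loc_row (h : Cpt k c B x g n) {δ : Ix k c → ℝ} (hδ : ‖δ‖ ≤ 1) {t : Fin k} {m : ℕ} (hm : m ≤ c t) :
    (SignType.sign (_root_.row (x + δ) t m) : ℝ) = sg (g (n t m) t) ∧
    |_root_.row (x + δ) t m| = yy (n t (m + 1)) - yy (n t m) + sg (g (n t m) t) * _root_.row δ t m := by
  have h1 := yy_lt (h.mono t m hm)
  have h2 := (abs_le.mp ((abs_row_le δ t m).trans hδ))
  rw [row_add, h.row t m hm]
  rcases sg_or (g (n t m) t) with h' | h' <;> rw [h']
  · have : (0 : ℝ) < ((1 : ℤ) : ℝ) * (yy (n t (m + 1)) - yy (n t m)) + _root_.row δ t m := by push_cast; linarith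
    rw [sign_pos this, abs_of_pos this]; simp
  · have : ((-1 : ℤ) : ℝ) * (yy (n t (m + 1)) - yy (n t m)) + _root_.row δ t m < 0 := by push_cast; linarith
    rw [sign_neg this, abs_of_neg this]; simp; ring

lemma loc_bb (h : Cpt k c B x g n) {δ : Ix k c → ℝ} (hδ : ‖δ‖ ≤ 1) (t : Fin k) {m : ℕ} (hm : m ≤ c t + 1) :
    bb (_root_.row (x + δ) t) m = yy (n t m) + eL g n t m δ := by
  induction m with
  | zero => simp [bb_zero, h.n0, yy_zero, eL]
  | succ m ih =>
    rw [bb_succ, ih (by omega), (h.loc_row hδ (by omega)).2, eL_apply, eL_apply, Finset.sum_range_succ]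
    ring

end Cpt

lemma cut_unique {g : ℕ → Fin k → Bool} (hg : IsCol j k c g) {x : Ix k c → ℝ} {n : Fin k → ℕ → ℕ}
    (h : Cpt k c (j * 2 ^ k) x g n) {t t' : Fin k} {m m' : ℕ} (h1 : 1 ≤ m) (h2 : m ≤ c t) (h1' : 1 ≤ m') (h2' : m' ≤ c t')
    (he : n t m = n t' m') : t = t' ∧ m = m' := by
  have hpos : 0 < n t m := by
    have := h.smono (t := t) (show 0 < m by omega) (by omega); omega
  have hB := h.lt t m h2
  have c1 := (h.chg t _ hpos hB).mpr ⟨m, h1, h2, rfl⟩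
  have c2 := (h.chg t' _ hpos hB).mpr ⟨m', h1', h2', he.symm⟩
  have hd : ¬ 2 ^ k ∣ n t m := fun hd => c1 (by rw [hg.m3 _ hpos hB hd])
  have : t = t' := (hg.m2 _ hpos hB hd).unique c1 c2
  subst this
  refine ⟨rfl, ?_⟩
  rcases lt_trichotomy m m' with h3 | h3 | h3
  · have := h.smono (t := t) h3 (by omega); omega
  · exact h3
  · have := h.smono (t := t) h3 (by omega); omega

lemma local_affine {D : ℕ} (hj : 1 ≤ j) (hD : ∀ t, c t ≤ D) {g : ℕ → Fin k → Bool} (hg : IsCol j k c g)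
    {x : Ix k c → ℝ} {n : Fin k → ℕ → ℕ} (h : Cpt k c (j * 2 ^ k) x g n) :
    ∃ ρ > 0, ∃ L : (Ix k c → ℝ) →ₗ[ℝ] TE j k, ∀ δ, ‖δ‖ < ρ →
      tPhi (ker0 (j * 2 ^ k) D) (nu0 j (2 ^ k)) (yy (j * 2 ^ k + 1)) (x + δ) = L δ := by
  classical
  have hT : 0 < 2 ^ k := by positivity
  have hB : 1 ≤ j * 2 ^ k := Nat.mul_pos hj hT
  -- displacement of the breakpoint at N
  let pe : ℕ → ((Ix k c → ℝ) →ₗ[ℝ] ℝ) := fun N =>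
    if hN : ∃ q : Fin k × ℕ, 1 ≤ q.2 ∧ q.2 ≤ c q.1 ∧ n q.1 q.2 = N then eL g n hN.choose.1 hN.choose.2 else 0
  have pe1 : ∀ t m, 1 ≤ m → m ≤ c t → pe (n t m) = eL g n t m := by
    intro t m h1 h2
    have hN : ∃ q : Fin k × ℕ, 1 ≤ q.2 ∧ q.2 ≤ c q.1 ∧ n q.1 q.2 = n t m := ⟨(t, m), h1, h2, rfl⟩
    have e : pe (n t m) = eL g n hN.choose.1 hN.choose.2 := dif_pos hN
    obtain ⟨e1, e2, e3⟩ := hN.choose_spec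
    obtain ⟨e4, e5⟩ := cut_unique hg h e1 e2 h1 h2 e3
    rw [e, e4, e5]
  have pe0 : ∀ N, 2 ^ k ∣ N → pe N = 0 := by
    intro N hd
    refine dif_neg ?_
    rintro ⟨⟨t, m⟩, h1, h2, rfl⟩
    simp only at h1 h2
    have hpos : 0 < n t m := by
      have := h.smono (t := t) (show 0 < m by omega) (by omega); omega
    refine (h.chg t _ hpos (h.lt t m h2)).mpr ⟨m, h1, h2, rfl⟩ ?_
    rw [hg.m3 _ hpos (h.lt t m h2) hd]
  have peb : ∀ N δ, |pe N δ| ≤ (D + 1) * ‖δ‖ := by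
    intro N δ
    by_cases hN : ∃ q : Fin k × ℕ, 1 ≤ q.2 ∧ q.2 ≤ c q.1 ∧ n q.1 q.2 = N
    · have e : pe N = eL g n hN.choose.1 hN.choose.2 := dif_pos hN
      rw [e]
      refine (abs_eL _ _ _ _ _).trans ?_
      have h1 : (hN.choose.2 : ℝ) ≤ D + 1 := by
        have := hN.choose_spec.2.1.trans (hD _)
        have : (hN.choose.2 : ℝ) ≤ D := by exact_mod_cast this
        linarith
      gcongr
    · have e : pe N = 0 := dif_neg hN
      rw [e]; simp; positivity
  let av : Fin j → Finset (Fin k) → ℕ → ℝ := fun i A q => ∏ t ∈ A, (sg (g (i.val * 2 ^ k + q) t) : ℝ)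
  let L1 : Fin j × NE k → ((Ix k c → ℝ) →ₗ[ℝ] ℝ) := fun r =>
    ∑ q ∈ Finset.range (2 ^ k), av r.1 r.2.1 q • (pe (r.1.val * 2 ^ k + q + 1) - pe (r.1.val * 2 ^ k + q))
  have hav : ∀ i A, A.Nonempty → ∑ q ∈ Finset.range (2 ^ k), av i A q = 0 := by
    intro i A hA
    rw [← Fin.sum_univ_eq_sum_range (fun q => av i A q)]
    have hs : Function.Surjective fun q : Fin (2 ^ k) => g (i.val * 2 ^ k + q.val) := fun σ => by
      obtain ⟨q, h1, h2⟩ := hg.m1 i.val i.isLt σ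
      exact ⟨⟨q, h1⟩, h2⟩
    have hb := ((Fintype.bijective_iff_surjective_and_card _).mpr ⟨hs, by simp⟩)
    rw [← char_sum hA]
    exact Fintype.sum_bijective _ hb _ _ fun q => rfl
  refine ⟨1 / (4 * (D + 1)), by positivity,
    (LinearMap.pi L1).prod (LinearMap.pi fun t => eL g n t (c t + 1)), fun δ hδ => ?_⟩
  have hδ4 : (D + 1) * ‖δ‖ ≤ 1 / 4 := by
    have h1 := hδ.le
    rw [le_div_iff₀ (by positivity)] at h1
    linarith
  have hδ1 : ‖δ‖ ≤ 1 := by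
    have h1 : 0 ≤ (D : ℝ) * ‖δ‖ := by positivity
    nlinarith [norm_nonneg δ]
  have eb : ∀ t m, m ≤ c t + 1 → |eL g n t m δ| ≤ 1 / 4 := by
    intro t m hm
    refine (abs_eL _ _ _ _ _).trans (le_trans ?_ hδ4)
    have h1 : (m : ℝ) ≤ D + 1 := by
      have := hD t
      exact_mod_cast (show m ≤ D + 1 by omega)
    gcongr
  have hrn : ∀ t, rnorm (x + δ) t = yy (j * 2 ^ k + 1) + eL g n t (c t + 1) δ := by
    intro t
    rw [← bb_rnorm, h.loc_bb hδ1 t le_rfl, h.nt]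
  refine Prod.ext ?_ ?_
  swap
  · funext t
    change rnorm (x + δ) t - _ = eL g n t (c t + 1) δ
    rw [hrn]; ring
  · funext ⟨i, A, hA⟩
    change tF _ _ (x + δ) i A = L1 (i, ⟨A, hA⟩) δ
    have cp0 : ∀ t, cp (j * 2 ^ k) (row (x + δ) t) 0 = 0 := fun t => cp_zero hB _
    have cp1 : ∀ t m, 1 ≤ m → m ≤ c t → cp (j * 2 ^ k) (row (x + δ) t) m = n t m + eL g n t m δ := by
      intro t m h1 h2
      have hpos : 0 < n t m := by
        have := h.smono (t := t) (show 0 < m by omega) (by omega); omega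
      rw [cp, h.loc_bb hδ1 t (by omega), th_loc hpos (h.lt t m h2)]
      · ring
      · rw [add_sub_cancel_left]; exact (eb t m (by omega)).trans (by norm_num)
    have cp2 : ∀ t, cp (j * 2 ^ k) (row (x + δ) t) (c t + 1) = (j * 2 ^ k : ℕ) := by
      intro t
      refine cp_top hB ?_
      rw [hrn]
      have := yy_succ (j * 2 ^ k)
      have := (abs_le.mp (eb t (c t + 1) le_rfl)).1
      linarith
    let p : ℕ → ℝ := fun N => N + pe N δ
    have pb : ∀ N, -(1 / 4) ≤ pe N δ ∧ pe N δ ≤ 1 / 4 := fun N => abs_le.mp ((peb N δ).trans hδ4)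
    have hi : (i.val + 1) * 2 ^ k ≤ j * 2 ^ k := Nat.mul_le_mul_right _ i.isLt
    rw [add_mul, one_mul] at hi
    have key := piece_int (f := fun u => ∏ t ∈ A, ker0 (j * 2 ^ k) D (row (x + δ) t) u)
      (a := fun q => p (i.val * 2 ^ k + q)) (v := av i A) (n := 2 ^ k)
      (by
        intro q hq
        have h1 := pb (i.val * 2 ^ k + q)
        have h2 := pb (i.val * 2 ^ k + (q + 1))
        simp only [p]; push_cast at h1 h2 ⊢
        linarith [h1.2, h2.1])
      (by
        intro q hq u hu1 hu2
        refine Finset.prod_congr rfl fun t _ => ?_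
        set N := i.val * 2 ^ k + q with hN
        have hu2 : u < p (N + 1) := hu2
        have hNB : N < j * 2 ^ k := by omega
        obtain ⟨m, hm, hm1, hm2⟩ := h.cell_ex t hNB
        rw [h.cellc hm hm1 hm2 hNB, ← (h.loc_row hδ1 hm).1]
        refine ker0_eq (hm.trans (hD t)) (le_trans ?_ hu1) (lt_of_lt_of_le hu2 ?_)
        · rcases Nat.eq_zero_or_pos m with h0 | h0
          · rw [h0, cp0]
            change 0 ≤ (N : ℝ) + pe N δ
            rcases Nat.eq_zero_or_pos N with hN0 | hN0
            · rw [hN0, pe0 0 (dvd_zero _)]; simp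
            · have : (1 : ℝ) ≤ N := by exact_mod_cast hN0
              linarith [(pb N).1]
          · rw [cp1 t m h0 hm]
            change _ ≤ (N : ℝ) + pe N δ
            rcases hm1.lt_or_eq with h3 | h3
            · have : (n t m : ℝ) + 1 ≤ N := by exact_mod_cast h3
              linarith [(pb N).1, (abs_le.mp (eb t m (by omega))).2]
            · rw [← h3, pe1 t m h0 hm]
        · change ((N + 1 : ℕ) : ℝ) + pe (N + 1) δ ≤ _
          rcases hm.lt_or_eq with h0 | h0
          · rw [cp1 t (m + 1) (by omega) h0]
            rcases (show N + 1 ≤ n t (m + 1) from hm2).lt_or_eq with h3 | h3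
            · have : ((N + 1 : ℕ) : ℝ) + 1 ≤ n t (m + 1) := by exact_mod_cast h3
              linarith [(pb (N + 1)).2, (abs_le.mp (eb t (m + 1) (by omega))).1]
            · rw [h3, pe1 t (m + 1) (by omega) h0]
          · rw [h0, cp2]
            rcases (show N + 1 ≤ j * 2 ^ k from hNB).lt_or_eq with h3 | h3
            · have : ((N + 1 : ℕ) : ℝ) + 1 ≤ (j * 2 ^ k : ℕ) := by exact_mod_cast h3
              linarith [(pb (N + 1)).2]
            · rw [h3, pe0 _ (Dvd.intro_left _ rfl)]; simp)
    obtain ⟨_, _, key⟩ := key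
    have pa : p (i.val * 2 ^ k + 0) = (i.val : ℝ) * (2 ^ k : ℕ) := by
      simp only [p, add_zero]
      rw [pe0 _ (Dvd.intro_left _ rfl)]; simp
    have pz : p (i.val * 2 ^ k + 2 ^ k) = ((i.val : ℝ) + 1) * (2 ^ k : ℕ) := by
      simp only [p]
      rw [pe0 _ ((Nat.dvd_add_right (Dvd.intro_left _ rfl)).mpr dvd_rfl)]; push_cast
      simp; ring
    rw [pa, pz] at key
    unfold tF nu0
    rw [key]
    have e1 : ∀ q, av i A q * (p (i.val * 2 ^ k + (q + 1)) - p (i.val * 2 ^ k + q)) =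
        av i A q + av i A q * (pe (i.val * 2 ^ k + q + 1) δ - pe (i.val * 2 ^ k + q) δ) := by
      intro q
      simp only [p, ← add_assoc]
      push_cast; ring
    rw [Finset.sum_congr rfl fun q _ => e1 q, Finset.sum_add_distrib, hav i A hA, zero_add]
    simp [L1, LinearMap.sum_apply]

end loc

/-! ### Part 14: zeros of the reference map -/

section zr
variable {j k : ℕ} {c : Fin k → ℕ}

/-- the reference map -/
noncomputable def Ph0 (j k : ℕ) (c : Fin k → ℕ) (D : ℕ) (x : Ix k c → ℝ) : TE j k :=
  tPhi (ker0 (j * 2 ^ k) D) (nu0 j (2 ^ k)) (yy (j * 2 ^ k + 1)) x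

lemma zr_of_zero {D : ℕ} (hj : 1 ≤ j) (hsum : ∑ t, c t = j * (2 ^ k - 1)) (hD : ∀ t, c t ≤ D)
    {x : Ix k c → ℝ} (h : Ph0 j k c D x = 0) : x ∈ Zr j k c := by
  refine zero_compat hj hsum hD (fun t => ?_) fun i A hA => ?_
  · have := congrFun (congrArg Prod.snd h) t
    have : rnorm x t - yy (j * 2 ^ k + 1) = 0 := this
    linarith
  · exact congrFun (congrArg Prod.fst h) (i, ⟨A, hA⟩)

lemma zr_local {D : ℕ} (hj : 1 ≤ j) (hsum : ∑ t, c t = j * (2 ^ k - 1)) (hD : ∀ t, c t ≤ D)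
    {x : Ix k c → ℝ} (hx : x ∈ Zr j k c) :
    ∃ ρ > 0, ∃ L : (Ix k c → ℝ) →ₗ[ℝ] TE j k, Function.Injective L ∧ ∀ δ, ‖δ‖ < ρ → Ph0 j k c D (x + δ) = L δ := by
  obtain ⟨g, n, hg, hc⟩ := hx
  obtain ⟨ρ, hρ, L, hL⟩ := local_affine hj hD hg hc
  refine ⟨ρ, hρ, L, ?_, hL⟩
  rw [← LinearMap.ker_eq_bot, LinearMap.ker_eq_bot']
  intro δ hδ
  by_contra hne
  have hn : 0 < ‖δ‖ := norm_pos_iff.mpr hne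
  have hsub : (fun s : ℝ => x + s • δ) '' Set.Ioo 0 (ρ / ‖δ‖) ⊆ Zr j k c := by
    rintro _ ⟨s, ⟨hs0, hs1⟩, rfl⟩
    refine zr_of_zero (D := D) hj hsum hD ?_
    unfold Ph0
    rw [hL, map_smul, hδ, smul_zero]
    rw [norm_smul, Real.norm_of_nonneg hs0.le]
    rwa [lt_div_iff₀ hn] at hs1
  have hinf : (Set.Ioo 0 (ρ / ‖δ‖)).Infinite := Set.Ioo_infinite (by positivity)
  refine (hinf.image ?_).mono hsub Zr_finite
  intro s _ s' _ h
  have h1 : s • δ = s' • δ := add_left_cancel h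
  exact smul_left_injective ℝ hne h1

lemma zr_zero {D : ℕ} (hj : 1 ≤ j) (hsum : ∑ t, c t = j * (2 ^ k - 1)) (hD : ∀ t, c t ≤ D)
    {x : Ix k c → ℝ} (hx : x ∈ Zr j k c) : Ph0 j k c D x = 0 := by
  obtain ⟨ρ, hρ, L, _, hL⟩ := zr_local hj hsum hD hx
  have := hL 0 (by simpa using hρ)
  rwa [add_zero, map_zero] at this

lemma four_inj {a b a' b' : ℕ} (h : a < b) (h' : a' < b') (e : 4 ^ b - 4 ^ a = 4 ^ b' - 4 ^ a') : a = a' ∧ b = b' := by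
  have aux : ∀ {a b a' b' : ℕ}, a < b → a' < b' → 4 ^ b - 4 ^ a = 4 ^ b' - 4 ^ a' → ¬ b < b' := by
    intro a b a' b' h h' e hb
    have h1 : 4 ^ a < 4 ^ b := Nat.pow_lt_pow_right (by norm_num) h
    have h2 : 4 ^ (a' + 1) ≤ 4 ^ b' := Nat.pow_le_pow_right (by norm_num) h'
    have h3 : 4 ^ (b + 1) ≤ 4 ^ b' := Nat.pow_le_pow_right (by norm_num) hb
    have h4 : 0 < 4 ^ a := by positivity
    rw [pow_succ] at h2 h3
    omega
  have hb : b = b' := by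
    rcases lt_trichotomy b b' with h1 | h1 | h1
    · exact absurd h1 (aux h h' e)
    · exact h1
    · exact absurd h1 (aux h' h e.symm)
  subst hb
  refine ⟨?_, rfl⟩
  have h1 : 4 ^ a < 4 ^ b := Nat.pow_lt_pow_right (by norm_num) h
  have h2 : 4 ^ a' < 4 ^ b := Nat.pow_lt_pow_right (by norm_num) h'
  exact Nat.pow_right_injective (le_refl 2 |>.trans (by norm_num)) (show 4 ^ a = 4 ^ a' by omega)

lemma zr_coords (hj : 1 ≤ j) {x : Ix k c → ℝ} (hx : x ∈ Zr j k c) :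
    ∃ (s : Ix k c → ℤ) (w : Ix k c → ℕ), (∀ i, s i = 1 ∨ s i = -1) ∧ Function.Injective w ∧
      (∀ i, 0 < w i ∧ w i < 4 ^ (j * 2 ^ k + 1)) ∧ ∀ i, x i = s i * w i := by
  obtain ⟨g, n, hg, h⟩ := hx
  have hT : 0 < 2 ^ k := by positivity
  have hmn : ∀ i : Ix k c, n i.1 i.2.val < n i.1 (i.2.val + 1) := fun i => h.mono _ _ (by have := i.2.isLt; omega)
  refine ⟨fun i => sg (g (n i.1 i.2.val) i.1), fun i => 4 ^ n i.1 (i.2.val + 1) - 4 ^ n i.1 i.2.val,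
    fun i => sg_or _, ?_, ?_, ?_⟩
  · have hc1 : ∀ t, 1 ≤ c t := by
      intro t
      by_contra hc
      have hconst : ∀ N, N < j * 2 ^ k → g N t = g 0 t := by
        intro N hN
        obtain ⟨m, hm, h1, h2⟩ := h.cell_ex t hN
        have : m = 0 := by omega
        subst this
        rw [h.cellc hm h1 h2 hN, h.n0]
      have hlt : 2 ^ k ≤ j * 2 ^ k := Nat.le_mul_of_pos_left _ hj
      obtain ⟨q, hq, h1⟩ := hg.m1 0 (by omega) (fun _ => true)
      obtain ⟨q', hq', h2⟩ := hg.m1 0 (by omega) (fun _ => false)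
      have e1 := congrFun h1 t
      have e2 := congrFun h2 t
      rw [zero_mul, zero_add, hconst _ (by omega)] at e1 e2
      rw [e1] at e2; exact absurd e2 (by decide)
    rintro ⟨t, m⟩ ⟨t', m'⟩ he
    obtain ⟨e1, e2⟩ := four_inj (hmn ⟨t, m⟩) (hmn ⟨t', m'⟩) he
    simp only at e1 e2
    have hm := m.isLt
    have hm' := m'.isLt
    have hz : ∀ t m, 1 ≤ m → m ≤ c t → 0 < n t m := by
      intro t m h1 h2
      have := h.smono (t := t) (show 0 < m by omega) (by omega); omega
    have hfin : t = t' ∧ m.val = m'.val := by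
      rcases Nat.eq_zero_or_pos m.val with h0 | h0
      · rcases Nat.eq_zero_or_pos m'.val with h0' | h0'
        · rw [h0, h0'] at e2
          exact ⟨(cut_unique hg h (by omega) (hc1 t) (by omega) (hc1 t') e2).1, by omega⟩
        · have := hz t' m'.val h0' (by omega)
          rw [h0, h.n0] at e1; omega
      · rcases Nat.eq_zero_or_pos m'.val with h0' | h0'
        · have := hz t m.val h0 (by omega)
          rw [h0', h.n0] at e1; omega
        · exact cut_unique hg h h0 (by omega) h0' (by omega) e1
    obtain ⟨rfl, h2⟩ := hfin
    rw [Fin.ext h2]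
  · intro i
    have h1 := hmn i
    have h2 : 4 ^ n i.1 i.2.val < 4 ^ n i.1 (i.2.val + 1) := Nat.pow_lt_pow_right (by norm_num) h1
    have h3 : n i.1 (i.2.val + 1) ≤ j * 2 ^ k + 1 := by
      rcases (show i.2.val + 1 ≤ c i.1 + 1 from i.2.isLt).lt_or_eq with h3 | h3
      · have := h.lt i.1 (i.2.val + 1) (by omega); omega
      · rw [h3, h.nt]
    have h4 : 4 ^ n i.1 (i.2.val + 1) ≤ 4 ^ (j * 2 ^ k + 1) := Nat.pow_le_pow_right (by norm_num) h3
    have h5 : 0 < 4 ^ n i.1 i.2.val := by positivity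
    exact ⟨Nat.sub_pos_of_lt h2, lt_of_lt_of_le (Nat.sub_lt (by positivity) h5) h4⟩
  · intro i
    have h2 : 4 ^ n i.1 i.2.val ≤ 4 ^ n i.1 (i.2.val + 1) := Nat.pow_le_pow_right (by norm_num) (hmn i).le
    have := h.row i.1 i.2.val (by have := i.2.isLt; omega)
    rw [row, dif_pos i.2.isLt] at this
    rw [Nat.cast_sub h2]
    change x ⟨i.1, i.2⟩ = _
    rw [this]
    simp only [yy]
    push_cast; ring

end zr

/-! ### Part 15: the counting argument -/

section core
variable {j k : ℕ} {c : Fin k → ℕ}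

lemma rnorm_lip {D : ℕ} (hD : ∀ t, c t ≤ D) (x y : Ix k c → ℝ) (t : Fin k) :
    |rnorm x t - rnorm y t| ≤ (D + 1) * ‖x - y‖ := by
  unfold rnorm
  rw [← Finset.sum_sub_distrib]
  refine (Finset.abs_sum_le_sum_abs _ _).trans ?_
  have h1 : ∀ m : Fin (c t + 1), |(|x ⟨t, m⟩| - |y ⟨t, m⟩|)| ≤ ‖x - y‖ := fun m =>
    (abs_abs_sub_abs_le_abs_sub _ _).trans (norm_le_pi_norm (x - y) ⟨t, m⟩)
  refine (Finset.sum_le_sum fun m _ => h1 m).trans ?_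
  rw [Finset.sum_const, Finset.card_univ, Fintype.card_fin, nsmul_eq_mul]
  refine mul_le_mul_of_nonneg_right ?_ (norm_nonneg _)
  push_cast
  have : (c t : ℝ) ≤ D := by exact_mod_cast hD t
  linarith

/-- scaled integer point -/
noncomputable def ipt (h : ℝ) (v : Ix k c → ℤ) : Ix k c → ℝ := fun i => h * v i

lemma ipt_smul (h : ℝ) (g : SGrp k c) (v : Ix k c → ℤ) : ipt h (g • v) = gact g (ipt h v) := by
  funext i
  simp only [ipt, gact, SGrp.smul_v]
  push_cast; ring

lemma ipt_close {M : ℕ} {h : ℝ} (hh : 0 ≤ h) {C : Fin (M + 1) → Ix k c → ℤ} (hC : C ∈ zch (Ix k c) M)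
    (l l' : Fin (M + 1)) : ‖ipt h (C l) - ipt h (C l')‖ ≤ h := by
  obtain ⟨e, σ, r, -, hσ, hC⟩ := hC
  rw [pi_norm_le_iff_of_nonneg hh]
  intro i
  have h1 : |((C l i : ℤ) : ℝ) - (C l' i : ℤ)| ≤ 1 := by
    rw [hC, hC]
    rcases hσ i with h | h <;> rw [h] <;> split_ifs <;> simp
  rw [Pi.sub_apply, Real.norm_eq_abs, ipt, ipt, ← mul_sub, abs_mul, abs_of_nonneg hh]
  nlinarith

lemma hull_close {M : ℕ} {h : ℝ} (hh : 0 ≤ h) {C : Fin (M + 1) → Ix k c → ℤ} (hC : C ∈ zch (Ix k c) M)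
    {a : Fin (M + 1) → ℝ} (ha : ∀ l, 0 ≤ a l) (hs : ∑ l, a l = 1) {x : Ix k c → ℝ}
    (hx : ∑ l, a l • ipt h (C l) = x) (l : Fin (M + 1)) : ‖ipt h (C l) - x‖ ≤ h := by
  have : ipt h (C l) - x = ∑ m, a m • (ipt h (C l) - ipt h (C m)) := by
    simp only [smul_sub, Finset.sum_sub_distrib, hx, ← Finset.sum_smul, hs, one_smul]
  rw [this]
  refine (norm_sum_le _ _).trans ?_
  calc ∑ m, ‖a m • (ipt h (C l) - ipt h (C m))‖ ≤ ∑ m, a m * h := by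
        refine Finset.sum_le_sum fun m _ => ?_
        rw [norm_smul, Real.norm_eq_abs, abs_of_nonneg (ha m)]
        exact mul_le_mul_of_nonneg_left (ipt_close hh hC _ _) (ha m)
    _ = h := by rw [← Finset.sum_mul, hs, one_mul]

lemma fin_min {α : Type*} {s : Set α} (hs : s.Finite) {P : α → ℝ → Prop} (h : ∀ x ∈ s, ∃ r > 0, P x r)
    (hm : ∀ x r r', r' ≤ r → P x r → P x r') : ∃ r > 0, ∀ x ∈ s, P x r := by
  induction s, hs using Set.Finite.induction_on with
  | empty => exact ⟨1, one_pos, by simp⟩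
  | insert _ _ ih =>
    obtain ⟨r, hr, h1⟩ := ih fun x hx => h x (Set.mem_insert_of_mem _ hx)
    obtain ⟨r', hr', h2⟩ := h _ (Set.mem_insert _ _)
    refine ⟨min r r', lt_min hr hr', ?_⟩
    rintro x (rfl | hx)
    · exact hm _ _ _ (min_le_right _ _) h2
    · exact hm _ _ _ (min_le_left _ _) (h1 x hx)

lemma cpt_low {α E : Type*} [TopologicalSpace α] [NormedAddCommGroup E] {K : Set α} (hK : IsCompact K) {f : α → E}
    (hf : ContinuousOn f K) (h : ∀ x ∈ K, f x ≠ 0) : ∃ η > 0, ∀ x ∈ K, η ≤ ‖f x‖ := by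
  rcases K.eq_empty_or_nonempty with rfl | hne
  · exact ⟨1, one_pos, by simp⟩
  · obtain ⟨x0, hx0, hmin⟩ := hK.exists_isMinOn hne hf.norm
    exact ⟨‖f x0‖, norm_pos_iff.mpr (h x0 hx0), fun x hx => hmin hx⟩

lemma modl {α E : Type*} [NormedAddCommGroup α] [NormedAddCommGroup E] {K : Set α} (hK : IsCompact K) {f : α → E}
    (hf : ContinuousOn f K) {ε : ℝ} (hε : 0 < ε) :
    ∃ δ > 0, ∀ x ∈ K, ∀ y ∈ K, ‖x - y‖ < δ → ‖f x - f y‖ < ε := by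
  have := hK.uniformContinuousOn_of_continuous hf
  rw [Metric.uniformContinuousOn_iff] at this
  obtain ⟨δ, hδ, h⟩ := this ε hε
  refine ⟨δ, hδ, fun x hx y hy hxy => ?_⟩
  have := h x hx y hy (by rwa [dist_eq_norm])
  rwa [dist_eq_norm] at this

/-- choice of a mesh -/
lemma mesh {P : ℕ} (hP : 0 < P) {δ : ℝ} (hδ : 0 < δ) :
    ∃ (h : ℝ) (q : ℕ), 0 < h ∧ h < δ ∧ 1 / h = 2 * q + 1 / P := by
  obtain ⟨n, hn⟩ := exists_nat_one_div_lt hδ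
  have hP' : (0 : ℝ) < P := by exact_mod_cast hP
  have h1 : (0 : ℝ) < 1 / P := by positivity
  refine ⟨1 / (2 * ((n + 1 : ℕ) : ℝ) + 1 / P), n + 1, by positivity, ?_, by rw [one_div_one_div]⟩
  refine lt_trans ?_ hn
  apply one_div_lt_one_div_of_lt
  · positivity
  · push_cast
    have : (0 : ℝ) ≤ n := by positivity
    linarith

lemma zr_chain (hj : 1 ≤ j) (hsum : ∑ t, c t = j * (2 ^ k - 1)) {h : ℝ} {q : ℕ} (hh : 0 < h)
    (hq : 1 / h = 2 * q + 1 / ((4 ^ (j * 2 ^ k + 1) : ℕ) : ℝ)) {x : Ix k c → ℝ} (hx : x ∈ Zr j k c) :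
    ∃ C ∈ zch (Ix k c) (j * (2 ^ k - 1) + k), (∃ a : Fin (j * (2 ^ k - 1) + k + 1) → ℝ, (∀ l, 0 < a l) ∧ ∑ l, a l = 1 ∧
      ∑ l, a l • ipt h (C l) = x) ∧ ∀ C' ∈ zch (Ix k c) (j * (2 ^ k - 1) + k),
      ∀ a : Fin (j * (2 ^ k - 1) + k + 1) → ℝ, (∀ l, 0 ≤ a l) →
      ∑ l, a l = 1 → ∑ l, a l • ipt h (C' l) = x → C' = C := by
  obtain ⟨s, w, hs, hw, hlt, hxe⟩ := zr_coords hj hx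
  generalize hP : 4 ^ (j * 2 ^ k + 1) = P at *
  have hP0 : 0 < P := by rw [← hP]; positivity
  have hP' : (0 : ℝ) < P := by exact_mod_cast hP0
  have key := zig_unique (card_Ix hsum) (z := fun i => x i / h) (e := fun i => s i * (2 * q * w i)) (σ := s)
    (φ := fun i => w i / P) (fun i => ⟨s i * (q * w i), by ring⟩) hs
    (fun i => div_pos (by exact_mod_cast (hlt i).1) hP')
    (fun i => (div_lt_one hP').mpr (by exact_mod_cast (hlt i).2))
    (by
      intro a b hab
      dsimp only at hab
      rw [div_left_inj' hP'.ne'] at hab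
      exact hw (by exact_mod_cast hab))
    (by
      intro i
      rw [div_eq_mul_one_div, hq, hxe]
      push_cast; ring)
  have conv : ∀ (C : Fin (j * (2 ^ k - 1) + k + 1) → Ix k c → ℤ) (a : Fin (j * (2 ^ k - 1) + k + 1) → ℝ),
      ∑ l, a l • ipt h (C l) = x ↔ ∀ i, ∑ l, a l * (C l i : ℝ) = x i / h := by
    intro C a
    rw [funext_iff]
    refine forall_congr' fun i => ?_
    rw [eq_div_iff hh.ne', Finset.sum_mul, Finset.sum_apply]
    simp only [Pi.smul_apply, ipt, smul_eq_mul]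
    rw [Finset.sum_congr rfl fun l _ => show a l * (h * (C l i : ℝ)) = a l * (C l i : ℝ) * h by ring]
  obtain ⟨C, hC, ⟨a, h1, h2, h3⟩, h4⟩ := key
  exact ⟨C, hC, ⟨a, h1, h2, (conv C a).mpr h3⟩, fun C' hC' a' g1 g2 g3 => h4 C' hC' a' g1 g2 ((conv C' a').mp g3)⟩

lemma ipt_finite {h : ℝ} (hh : 0 < h) {K : Set (Ix k c → ℝ)} (hK : IsCompact K) :
    {v : Ix k c → ℤ | ipt h v ∈ K}.Finite := by
  obtain ⟨R, hR⟩ := hK.isBounded.exists_norm_le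
  refine (Set.finite_Icc (fun _ : Ix k c => -⌈R / h⌉) (fun _ => ⌈R / h⌉)).subset ?_
  intro v hv
  have h1 : ∀ i, |v i| ≤ ⌈R / h⌉ := by
    intro i
    have h2 := (norm_le_pi_norm (ipt h v) i).trans (hR _ hv)
    rw [ipt, Real.norm_eq_abs, abs_mul, abs_of_pos hh] at h2
    have h3 : |(v i : ℝ)| ≤ R / h := by rw [le_div_iff₀ hh]; linarith
    have h4 := h3.trans (Int.le_ceil _)
    exact_mod_cast h4
  exact ⟨fun i => (abs_le.mp (h1 i)).1, fun i => (abs_le.mp (h1 i)).2⟩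

lemma pair_ne {k : ℕ} (t s : Fin k) : ({t, s} : Finset (Fin k)).Nonempty := ⟨t, by simp⟩

/-- coordinate functionals -/
def cf1 (j k : ℕ) (u : ℝ) (q : Fin j × NE k) : TE j k →ₗ[ℝ] ℝ :=
  u • ((LinearMap.proj q).comp (LinearMap.fst ℝ (Fin j × NE k → ℝ) (Fin k → ℝ)))

/-- coordinate functionals -/
def cf2 (j k : ℕ) (u : ℝ) (t : Fin k) : TE j k →ₗ[ℝ] ℝ :=
  u • ((LinearMap.proj t).comp (LinearMap.snd ℝ (Fin j × NE k → ℝ) (Fin k → ℝ)))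

lemma cf1_apply (u : ℝ) (q : Fin j × NE k) (e : TE j k) : cf1 j k u q e = u * e.1 q := rfl
lemma cf2_apply (u : ℝ) (t : Fin k) (e : TE j k) : cf2 j k u t e = u * e.2 t := rfl

lemma cf1_le {u : ℝ} (hu : |u| = 1) (q : Fin j × NE k) (e : TE j k) : |cf1 j k u q e| ≤ ‖e‖ := by
  rw [cf1_apply, abs_mul, hu, one_mul]
  exact (norm_le_pi_norm e.1 q).trans (norm_fst_le e)

lemma cf2_le {u : ℝ} (hu : |u| = 1) (t : Fin k) (e : TE j k) : |cf2 j k u t e| ≤ ‖e‖ := by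
  rw [cf2_apply, abs_mul, hu, one_mul]
  exact (norm_le_pi_norm e.2 t).trans (norm_snd_le e)

lemma abs_sg (b : Bool) : |(sg b : ℝ)| = 1 := by rcases sg_or b with h | h <;> rw [h] <;> simp

end core

/-! ### Part 16: the core -/

section core2
variable {j k : ℕ} {c : Fin k → ℕ}

theorem core {D : ℕ} (hj : 1 ≤ j) (hk : 1 ≤ k) (hsum : ∑ t, c t = j * (2 ^ k - 1)) (hD : ∀ t, c t ≤ D)
    {Y : ℝ} (hY : 2 ≤ Y)
    (Φ : Bool → (Ix k c → ℝ) → TE j k) (hΦ0 : Φ false = Ph0 j k c D)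
    (hcont : ∀ b, ContinuousOn (Φ b) (KK k c Y 1))
    (heq : ∀ b g x, Φ b (gact g x) = g • Φ b x)
    (hsnd : ∀ b x t, (Φ b x).2 t = rnorm x t - Y)
    {i0 : Fin j} {m0 : ℝ} (hm0 : 0 < m0)
    (hpair : ∀ b, ∀ x ∈ KK k c Y 1, ∀ t s : Fin k, t ≠ s → ∀ β, row x t = (fun m => (sg β : ℝ) * row x s m) →
      m0 ≤ sg β * (Φ b x).1 (i0, ⟨{t, s}, pair_ne t s⟩))
    (hno : ∀ x ∈ KK k c Y 1, Φ true x ≠ 0) :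
    2 * Nat.card (SGrp k c) ∣ Nat.card (Zr j k c) := by
  classical
  have hKc := isCompact_KK (k := k) (c := c) Y 1
  -- local structure near zeros
  have hloc : ∃ ρ > 0, ∀ x ∈ Zr j k c, ∃ L : (Ix k c → ℝ) →ₗ[ℝ] TE j k, Function.Injective L ∧
      ∀ δ, ‖δ‖ < ρ → Φ false (x + δ) = L δ := by
    refine fin_min Zr_finite ?_ ?_
    · intro x hx
      rw [hΦ0]
      exact zr_local hj hsum hD hx
    · rintro x r r' hr ⟨L, h1, h2⟩
      exact ⟨L, h1, fun δ hδ => h2 δ (hδ.trans_le hr)⟩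
  obtain ⟨ρ, hρ, hloc⟩ := hloc
  have hzero : ∀ x ∈ Zr j k c, Φ false x = 0 := fun x hx => by rw [hΦ0]; exact zr_zero hj hsum hD hx
  have hZY : ∀ x ∈ Zr j k c, ∀ t, rnorm x t = Y := by
    intro x hx t
    have := hsnd false x t
    rw [hzero x hx] at this
    have h0 : (0 : TE j k).2 t = 0 := rfl
    rw [h0] at this; linarith
  have hZK : ∀ x ∈ Zr j k c, x ∈ KK k c Y 1 := by
    intro x hx t
    rw [hZY x hx t]; simp
  have hsep : ∀ x ∈ Zr j k c, ∀ x' ∈ Zr j k c, ‖x' - x‖ < ρ → x' = x := by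
    intro x hx x' hx' hlt
    obtain ⟨L, hL, h2⟩ := hloc x hx
    have h3 := h2 _ hlt
    rw [add_sub_cancel, hzero x' hx'] at h3
    have h4 : x' - x = 0 := hL (by rw [← h3, map_zero])
    exact sub_eq_zero.mp h4
  -- lower bounds
  obtain ⟨η1, hη1, hlow1⟩ := cpt_low hKc (hcont true) hno
  obtain ⟨η0, hη0, hlow0⟩ : ∃ η > 0, ∀ x ∈ KK k c Y 1 \ ⋃ z ∈ Zr j k c, Metric.ball z (ρ / 2), η ≤ ‖Φ false x‖ := by
    refine cpt_low (hKc.diff (isOpen_biUnion fun _ _ => Metric.isOpen_ball)) ((hcont false).mono Set.diff_subset) ?_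
    rintro x ⟨-, hx⟩ h0
    apply hx
    rw [hΦ0] at h0
    exact Set.mem_biUnion (zr_of_zero hj hsum hD h0) (Metric.mem_ball_self (by linarith))
  have hε1 : 0 < min (min η0 η1) m0 / 2 := by have := lt_min (lt_min hη0 hη1) hm0; linarith
  set ε1 := min (min η0 η1) m0 / 2 with hε1d
  have hε1a : 2 * ε1 ≤ η0 := by
    have h1 := min_le_left (min η0 η1) m0
    have h2 := min_le_left η0 η1
    linarith
  have hε1b : 2 * ε1 ≤ η1 := by
    have h1 := min_le_left (min η0 η1) m0
    have h2 := min_le_right η0 η1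
    linarith
  have hε1c : 2 * ε1 ≤ m0 := by
    have h1 := min_le_right (min η0 η1) m0
    linarith
  obtain ⟨δ0, hδ0, hmod0⟩ := modl hKc (hcont false) hε1
  obtain ⟨δ1, hδ1, hmod1⟩ := modl hKc (hcont true) hε1
  have hD0 : (0 : ℝ) < D + 1 := by positivity
  obtain ⟨h, q, hh, hhδ, hq⟩ := mesh (P := 4 ^ (j * 2 ^ k + 1)) (by positivity)
    (lt_min (lt_min hδ0 hδ1) (lt_min (show 0 < ρ / 2 by linarith) (show 0 < 1 / 4 / ((D : ℝ) + 1) by positivity)))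
  rw [lt_min_iff, lt_min_iff, lt_min_iff] at hhδ
  obtain ⟨⟨hh0, hh1⟩, hhρ, hhD⟩ := hhδ
  have hhD' : ((D : ℝ) + 1) * h < 1 / 4 := by rw [lt_div_iff₀ hD0] at hhD; linarith
  have hmod : ∀ b, ∀ x ∈ KK k c Y 1, ∀ y ∈ KK k c Y 1, ‖x - y‖ ≤ h → ‖Φ b x - Φ b y‖ < ε1 := by
    intro b x hx y hy hxy
    cases b
    · exact hmod0 x hx y hy (hxy.trans_lt hh0)
    · exact hmod1 x hx y hy (hxy.trans_lt hh1)
  have hrn : ∀ x y : Ix k c → ℝ, ‖x - y‖ ≤ h → ∀ t, |rnorm x t - rnorm y t| < 1 / 4 := by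
    intro x y hxy t
    refine (rnorm_lip hD x y t).trans_lt (lt_of_le_of_lt ?_ hhD')
    exact mul_le_mul_of_nonneg_left hxy hD0.le
  have hKpos : ∀ x ∈ KK k c Y 1, ∀ t, 0 < rnorm x t := by
    intro x hx t
    have := (abs_le.mp (hx t)).1
    linarith
  have hhalf : ∀ x ∈ KK k c Y (1 / 2), x ∈ KK k c Y 1 := fun x hx t => (hx t).trans (by norm_num)
  have hnear : ∀ x ∈ KK k c Y (1 / 2), ∀ y, ‖y - x‖ ≤ h → y ∈ KK k c Y 1 := by
    intro x hx y hxy t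
    have h1 := abs_le.mp (hx t)
    have h2 := abs_lt.mp (hrn y x hxy t)
    rw [abs_le]
    constructor <;> linarith [h1.1, h1.2, h2.1, h2.2]
  -- the system of chains
  set M := j * (2 ^ k - 1) + k with hMd
  have hM : 1 ≤ M := by omega
  let S : ChainSys (SGrp k c) (Ix k c → ℤ) M := zsys hM (by
    intro g
    exact ⟨fun i => sg (g.β i.1), g.px, fun i => sg_or _, fun v i => SGrp.smul_v g v i⟩)
  have hSch : S.ch = zch (Ix k c) M := rfl
  let A : Set (Ix k c → ℤ) := {v | ipt h v ∈ KK k c Y (1 / 2) ∧ ∀ g : SGrp k c, g • v = v → g = 1}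
  have hAfin : A.Finite := (ipt_finite hh (isCompact_KK Y (1 / 2))).subset fun v hv => hv.1
  -- nonfree points
  have hnf : ∀ v : Ix k c → ℤ, ipt h v ∈ KK k c Y 1 → (∃ g : SGrp k c, g • v = v ∧ g ≠ 1) →
      ∃ (q : Fin j × NE k) (u : ℝ), |u| = 1 ∧ ∀ b, m0 ≤ u * (Φ b (ipt h v)).1 q := by
    rintro v hv ⟨g, hg, hg1⟩
    obtain ⟨t, s, hts, β, hr⟩ := nonfree (hKpos _ hv) hg1 (by rw [← ipt_smul, hg])
    exact ⟨_, sg β, abs_sg β, fun b => hpair b _ hv t s hts β hr⟩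
  -- chains through zeros
  have hch : ∀ z : Zr j k c, ∃ C ∈ zch (Ix k c) M, (∃ a : Fin (M + 1) → ℝ, (∀ l, 0 < a l) ∧ ∑ l, a l = 1 ∧
      ∑ l, a l • ipt h (C l) = z.1) ∧ ∀ C' ∈ zch (Ix k c) M,
      ∀ a : Fin (M + 1) → ℝ, (∀ l, 0 ≤ a l) →
      ∑ l, a l = 1 → ∑ l, a l • ipt h (C' l) = z.1 → C' = C := fun z => zr_chain hj hsum hh hq z.2
  choose Cz hCz hCza hCzu using hch
  have hCzclose : ∀ z l, ‖ipt h (Cz z l) - z.1‖ ≤ h := by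
    intro z l
    obtain ⟨a, h1, h2, h3⟩ := hCza z
    exact hull_close hh.le (hCz z) (fun l => (h1 l).le) h2 h3 l
  have hCzinj : Function.Injective Cz := by
    intro z z' he
    have h1 := hCzclose z 0
    have h2 := hCzclose z' 0
    rw [← he] at h2
    refine Subtype.ext (hsep _ z'.2 _ z.2 ?_)
    have : z.1 - z'.1 = (ipt h (Cz z 0) - z'.1) - (ipt h (Cz z 0) - z.1) := by abel
    rw [this]
    refine (norm_sub_le _ _).trans_lt ?_
    linarith
  have hcard : (Set.range Cz).ncard = Nat.card (Zr j k c) := by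
    exact Nat.card_range_of_injective hCzinj
  have hTA : ∀ z l, Cz z l ∈ A := by
    intro z l
    have hc := hCzclose z l
    have hK2 : ipt h (Cz z l) ∈ KK k c Y (1 / 2) := by
      intro t
      have := hrn _ _ hc t
      rw [hZY _ z.2 t] at this
      linarith
    refine ⟨hK2, fun g hg => ?_⟩
    by_contra hg1
    obtain ⟨q', u, hu, hb⟩ := hnf _ (hhalf _ hK2) ⟨g, hg, hg1⟩
    have h1 := hmod false _ (hhalf _ hK2) _ (hZK _ z.2) hc
    rw [hzero _ z.2, sub_zero] at h1
    have h2 := cf1_le hu q' (Φ false (ipt h (Cz z l)))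
    rw [cf1_apply] at h2
    have h3 := hb false
    have h4 := le_abs_self (u * (Φ false (ipt h (Cz z l))).1 q')
    linarith
  -- robust zero test
  have hrob : ∃ ε > 0, ∀ C ∈ {C : Fin (M + 1) → Ix k c → ℤ | ∀ l, C l ∈ A}, C ∈ zch (Ix k c) M →
      ∀ w' : Fin (M + 1) → TE j k, (∀ l, ‖w' l - Φ false (ipt h (C l))‖ < ε) → (ZeroIn w' ↔ C ∈ Set.range Cz) := by
    refine fin_min ?_ ?_ ?_
    · have := Set.Finite.pi' (fun _ : Fin (M + 1) => hAfin)
      exact this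
    · intro C hCA
      by_cases hC : C ∈ zch (Ix k c) M
      swap
      · exact ⟨1, one_pos, fun h => absurd h hC⟩
      by_cases hz : ∃ z : Zr j k c, ‖ipt h (C 0) - z.1‖ < ρ / 2
      · obtain ⟨z, hz⟩ := hz
        obtain ⟨L, hL, hL2⟩ := hloc _ z.2
        have hval : ∀ l, Φ false (ipt h (C l)) = L (ipt h (C l) - z.1) := by
          intro l
          rw [← hL2, add_sub_cancel]
          have : ipt h (C l) - z.1 = (ipt h (C l) - ipt h (C 0)) + (ipt h (C 0) - z.1) := by abel
          rw [this]
          refine (norm_add_le _ _).trans_lt ?_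
          have := ipt_close hh.le hC l 0
          linarith
        have hsumL : ∀ a : Fin (M + 1) → ℝ, ∑ l, a l • Φ false (ipt h (C l)) =
            L (∑ l, a l • ipt h (C l) - (∑ l, a l) • z.1) := by
          intro a
          simp only [hval]
          rw [Finset.sum_smul, ← Finset.sum_sub_distrib, map_sum]
          refine Finset.sum_congr rfl fun l _ => ?_
          rw [← smul_sub, map_smul]
        by_cases hCT : C ∈ Set.range Cz
        · obtain ⟨z', rfl⟩ := hCT
          have hzz : z' = z := by
            refine Subtype.ext (hsep _ z.2 _ z'.2 ?_)
            have h1 := hCzclose z' 0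
            have : z'.1 - z.1 = (ipt h (Cz z' 0) - z.1) - (ipt h (Cz z' 0) - z'.1) := by abel
            rw [this]
            refine (norm_sub_le _ _).trans_lt ?_
            linarith
          subst hzz
          obtain ⟨a, h1, h2, h3⟩ := hCza z'
          obtain ⟨ε, hε, hy⟩ := robust_yes (finrank_TE (j := j) (k := k)) h1 h2
            (w := fun l => Φ false (ipt h (Cz z' l))) (by rw [hsumL, h2, h3, one_smul, sub_self, map_zero]) (by
              intro a' ha' hs'
              rw [hsumL, ha', zero_smul, sub_zero] at hs'
              have h5 : ∑ l, a' l • ipt h (Cz z' l) = 0 := hL (by rw [hs', map_zero])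
              refine zig_indep hC a' ha' fun i => ?_
              have h6 := congrFun h5 i
              rw [Finset.sum_apply] at h6
              simp only [Pi.smul_apply, ipt, smul_eq_mul, Pi.zero_apply] at h6
              rw [Finset.sum_congr rfl fun l _ => show a' l * (h * (Cz z' l i : ℝ)) = h * (a' l * (Cz z' l i : ℝ)) by ring,
                ← Finset.mul_sum] at h6
              exact (mul_eq_zero.mp h6).resolve_left hh.ne')
          exact ⟨ε, hε, fun _ w' hw' => ⟨fun _ => ⟨z', rfl⟩, fun _ => hy w' hw'⟩⟩
        · have hnz : ¬ ZeroIn fun l => Φ false (ipt h (C l)) := by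
            rintro ⟨a, h1, h2, h3⟩
            rw [hsumL, h2, one_smul] at h3
            have h5 : ∑ l, a l • ipt h (C l) - z.1 = 0 := hL (by rw [h3, map_zero])
            exact hCT ⟨z, (hCzu z C hC a h1 h2 (sub_eq_zero.mp h5)).symm⟩
          obtain ⟨ε, hε, hy⟩ := robust_not hnz
          exact ⟨ε, hε, fun _ w' hw' => ⟨fun hz => absurd hz (hy w' hw'), fun hz => absurd hz hCT⟩⟩
      · have hCT : C ∉ Set.range Cz := by
          rintro ⟨z, rfl⟩
          exact hz ⟨z, (hCzclose z 0).trans_lt hhρ⟩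
        refine ⟨ε1, hε1, fun _ w' hw' => ⟨fun hz' => absurd hz' ?_, fun hz => absurd hz hCT⟩⟩
        refine not_zeroIn_of_close (y := Φ false (ipt h (C 0))) (η := η0) (hlow0 _ ⟨hhalf _ (hCA 0).1, ?_⟩) ?_
        · intro hmem
          obtain ⟨z, hzZ, hzb⟩ := Set.mem_iUnion₂.mp hmem
          rw [Metric.mem_ball, dist_eq_norm] at hzb
          exact hz ⟨⟨z, hzZ⟩, hzb⟩
        · intro l
          have h1 := hmod false _ (hhalf _ (hCA l).1) _ (hhalf _ (hCA 0).1) (ipt_close hh.le hC l 0)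
          have h2 := hw' l
          have h3 := norm_sub_le_norm_sub_add_norm_sub (w' l) (Φ false (ipt h (C l))) (Φ false (ipt h (C 0)))
          linarith
    · intro C r r' hr hP hC w' hw'
      exact hP hC w' fun l => (hw' l).trans_le hr
  obtain ⟨ε2, hε2, hrob⟩ := hrob
  have hεpos : 0 < min (min ε1 ε2) (1 / 4) := lt_min (lt_min hε1 hε2) (by norm_num)
  set ε := min (min ε1 ε2) (1 / 4) with hεd
  have hεa : ε ≤ ε1 := (min_le_left _ _).trans (min_le_left _ _)
  have hεb : ε ≤ ε2 := (min_le_left _ _).trans (min_le_right _ _)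
  have hεc : ε ≤ 1 / 4 := min_le_right _ _
  rw [← hcard]
  refine parity_count' hM (finrank_TE (j := j) (k := k)) S SGrp.norm_smul_eq (fun b v => Φ b (ipt h v)) A hAfin ?_ ?_ ?_
    ε hεpos ?_ ?_ (Set.range Cz) ?_ ?_
  · rintro g v ⟨hv, hf⟩
    refine ⟨fun t => ?_, fun g' hg' => ?_⟩
    · rw [ipt_smul, rnorm_gact]; exact hv _
    · have h1 : (g⁻¹ * g' * g) • v = v := by
        rw [mul_smul, mul_smul, hg', inv_smul_smul]
      have h2 := hf _ h1
      have h3 : g' = g * (g⁻¹ * g' * g) * g⁻¹ := by group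
      rw [h3, h2]; group
  · rintro g v ⟨-, hf⟩ hg
    exact hf g hg
  · intro b v _ g
    rw [ipt_smul, heq]
  · rintro C hC ⟨l0, hl0⟩
    rw [hSch] at hC
    by_cases hK2 : ipt h (C l0) ∈ KK k c Y (1 / 2)
    · have hfr : ∃ g : SGrp k c, g • (C l0) = C l0 ∧ g ≠ 1 := by
        by_contra hcon
        push Not at hcon
        exact hl0 ⟨hK2, hcon⟩
      obtain ⟨q', u, hu, hb⟩ := hnf _ (hhalf _ hK2) hfr
      refine ⟨cf1 j k u q', cf1_le hu q', fun b l => ?_⟩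
      have hcl := ipt_close hh.le hC l l0
      have h1 := hmod b _ (hnear _ hK2 _ hcl) _ (hhalf _ hK2) hcl
      have h2 := cf1_le hu q' (Φ b (ipt h (C l)) - Φ b (ipt h (C l0)))
      rw [map_sub] at h2
      have h3 := hb b
      rw [← cf1_apply] at h3
      have h4 := (abs_le.mp h2).1
      linarith
    · have : ∃ t, 1 / 2 < |rnorm (ipt h (C l0)) t - Y| := by
        by_contra hcon
        push Not at hcon
        exact hK2 hcon
      obtain ⟨t, ht⟩ := this
      have hcl : ∀ l, |rnorm (ipt h (C l)) t - rnorm (ipt h (C l0)) t| < 1 / 4 :=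
        fun l => hrn _ _ (ipt_close hh.le hC l l0) t
      rcases lt_abs.mp ht with ht | ht
      · refine ⟨cf2 j k 1 t, cf2_le (by simp) t, fun b l => ?_⟩
        rw [cf2_apply, hsnd]
        have := (abs_lt.mp (hcl l)).1
        linarith
      · refine ⟨cf2 j k (-1) t, cf2_le (by simp) t, fun b l => ?_⟩
        rw [cf2_apply, hsnd]
        have := (abs_lt.mp (hcl l)).2
        linarith
  · intro C hC hCA w' hw'
    rw [hSch] at hC
    refine not_zeroIn_of_close (y := Φ true (ipt h (C 0))) (η := η1) (hlow1 _ (hhalf _ (hCA 0).1)) fun l => ?_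
    have h1 := hmod true _ (hhalf _ (hCA l).1) _ (hhalf _ (hCA 0).1) (ipt_close hh.le hC l 0)
    have h2 := hw' l
    have h3 := norm_sub_le_norm_sub_add_norm_sub (w' l) (Φ true (ipt h (C l))) (Φ true (ipt h (C 0)))
    linarith
  · rintro _ ⟨z, rfl⟩
    exact ⟨hCz z, hTA z⟩
  · intro C hC hCA w' hw'
    exact hrob C hCA hC w' fun l => (hw' l).trans_le hεb

end core2

/-- If the number of equivalence classes of `c`-equiparting matrices is odd and
`d = max (c 0, …, c (k-1))`, then any `j` masses on `ℝ^d` are simultaneously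
equiparted by some arrangement of `k` affine hyperplanes. -/
theorem equiparting_of_odd_numEquivClasses (j k : ℕ) (hj : 1 ≤ j) (hk : 2 ≤ k)
    (c : Fin k → ℕ) (hsum : (∑ t, c t) = j * (2 ^ k - 1))
    (hodd : Odd (numEquivClasses j k c))
    (μ : Fin j → Measure (Fin (Finset.univ.sup c) → ℝ))
    (hμ : ∀ i, IsMass (μ i)) :
    ∃ f : Fin k → ((Fin (Finset.univ.sup c) → ℝ) →ᵃ[ℝ] ℝ),
      (∀ t, (f t).linear ≠ 0) ∧ ∀ i, Equiparts f (μ i) := by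
  have hD : ∀ t, c t ≤ Finset.univ.sup c := fun t => Finset.le_sup (Finset.mem_univ t)
  generalize Finset.univ.sup c = d at *
  by_cases hall : ∀ i, μ i = 0
  · have hd : 0 < d := by
      by_contra h0
      have hc0 : ∀ t, c t = 0 := fun t => by have := hD t; omega
      simp only [hc0, Finset.sum_const_zero] at hsum
      have h2 : 2 ^ 2 ≤ 2 ^ k := Nat.pow_le_pow_right (by norm_num) hk
      have h3 : 0 < j * (2 ^ k - 1) := Nat.mul_pos hj (by omega)
      omega
    refine ⟨fun _ => (LinearMap.proj (R := ℝ) (φ := fun _ : Fin d => ℝ) (⟨0, hd⟩ : Fin d)).toAffineMap, fun t ht => ?_, fun i ε => ?_⟩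
    · have h1 := LinearMap.congr_fun ht (fun _ => (1 : ℝ))
      simp at h1
    · rw [hall i]; simp
  push Not at hall
  obtain ⟨i0, hi0⟩ := hall
  have hfin0 := (hμ i0).1
  set B := j * 2 ^ k with hBd
  have hB : 1 ≤ B := Nat.mul_pos hj (by positivity)
  set Y : ℝ := yy (B + 1) with hYd
  have hYB : yy B + 3 ≤ Y := yy_lt (Nat.lt_succ_self B)
  have hy0 : (0 : ℝ) ≤ yy B := by rw [← yy_zero]; exact yy_mono (Nat.zero_le _)
  have hlow : ∀ x ∈ KK k c Y 1, ∀ t, yy B ≤ rnorm x t := by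
    intro x hx t
    have := (abs_le.mp (hx t)).1
    linarith
  have hpos : ∀ x ∈ KK k c Y 1, ∀ t, 0 < rnorm x t := by
    intro x hx t
    have := (abs_le.mp (hx t)).1
    linarith
  have ok0 : KerOK (ker0 B d) (nu0 j (2 ^ k)) (KK k c Y 1) := ker0_ok hB hD hlow
  have ok1 : KerOK (ker1 d) μ (KK k c Y 1) := ker1_ok hD hμ hpos
  by_cases hno : ∃ x ∈ KK k c Y 1, tPhi (ker1 d) μ Y x = 0
  · obtain ⟨x, hx, h0⟩ := hno
    exact equiparts_of_zero hD hμ (hpos x hx) hi0 fun i A hA =>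
      congrFun (congrArg Prod.fst h0) (i, ⟨A, hA⟩)
  exfalso
  push Not at hno
  have hm1 : 0 < (μ i0).real Set.univ := by
    rw [measureReal_def, ENNReal.toReal_pos_iff]
    exact ⟨by rw [Measure.measure_univ_pos]; exact hi0, measure_lt_top _ _⟩
  have hm2 : 1 ≤ (nu0 j (2 ^ k) i0).real Set.univ := by
    have h1 : (1 : ℝ) ≤ 2 ^ k := one_le_pow₀ (by norm_num)
    rw [nu0, measureReal_def, Measure.restrict_apply_univ, Real.volume_Ico, ENNReal.toReal_ofReal]
    · push_cast; linarith
    · push_cast; linarith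
  have hsq : ∀ b, (sg b : ℝ) * sg b = 1 := by
    intro b; rcases sg_or b with h | h <;> rw [h] <;> simp
  have key := core (D := d) hj (by omega) hsum hD (Y := Y) (by linarith)
    (fun b => bif b then tPhi (ker1 d) μ Y else Ph0 j k c d) rfl
    (by
      rintro (_ | _)
      · exact ok0.tPhi_cont Y
      · exact ok1.tPhi_cont Y)
    (by
      rintro (_ | _) g x
      · exact ok0.tPhi_gact Y g x
      · exact ok1.tPhi_gact Y g x)
    (by
      rintro (_ | _) x t
      · rfl
      · rfl)
    (i0 := i0) (m0 := min 1 ((μ i0).real Set.univ)) (lt_min one_pos hm1)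
    (by
      rintro (_ | _) x hx t s hts β hr
      · have h1 := ok0.pair hx hts hr i0
        refine (min_le_left _ _).trans ?_
        change 1 ≤ (sg β : ℝ) * tF (ker0 B d) (nu0 j (2 ^ k)) x i0 {t, s}
        rw [h1, ← mul_assoc, hsq, one_mul]; exact hm2
      · have h1 := ok1.pair hx hts hr i0
        refine (min_le_right _ _).trans ?_
        change _ ≤ (sg β : ℝ) * tF (ker1 d) μ x i0 {t, s}
        rw [h1, ← mul_assoc, hsq, one_mul])
    hno
  rw [card_Zr hj, card_em hj] at key
  have h2 := Nat.dvd_of_mul_dvd_mul_right Nat.card_pos key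
  rw [← even_iff_two_dvd] at h2
  exact (Nat.not_even_iff_odd.mpr hodd) h2
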